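/- For every integer n ≥ 11 and every plane triangulation T on n vertices, every edge-coloring of T using at least 2n + 1 distinct colors contains a rainbow matching of size 5; that is, rb(𝒯ₙ, 5K₂) ≤ 2n + 1. -/

import Mathlib

/-- A topological planar embedding of a simple graph `G`: an injective placement `f` of the
vertices in the plane together with, for each edge, an arc `γ e : ℝ → ℝ × ℝ` that is
continuous and injective on `[0,1]`, joins the images of the two endpoints of the edge,
whose interior avoids all vertex images, and such that interiors of distinct arcs are
pairwise disjoint. -/
def SimpleGraph.IsPlanarEmbedding {V : Type*} (G : SimpleGraph V) (f : V → ℝ × ℝ)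
    (γ : G.edgeSet → ℝ → ℝ × ℝ) : Prop :=
  Function.Injective f ∧
  (∀ e : G.edgeSet, ContinuousOn (γ e) (Set.Icc 0 1)) ∧
  (∀ e : G.edgeSet, Set.InjOn (γ e) (Set.Icc 0 1)) ∧
  (∀ e : G.edgeSet, ∃ u v : V, (e : Sym2 V) = s(u, v) ∧ γ e 0 = f u ∧ γ e 1 = f v) ∧
  (∀ e : G.edgeSet, ∀ t ∈ Set.Ioo (0 : ℝ) 1, ∀ v : V, γ e t ≠ f v) ∧
  (∀ e₁ e₂ : G.edgeSet, e₁ ≠ e₂ → ∀ t₁ ∈ Set.Ioo (0 : ℝ) 1, ∀ t₂ ∈ Set.Ioo (0 : ℝ) 1,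
      γ e₁ t₁ ≠ γ e₂ t₂)

/-- A simple graph is planar if it admits a topological planar embedding. -/
def SimpleGraph.IsPlanar {V : Type*} (G : SimpleGraph V) : Prop :=
  ∃ f γ, G.IsPlanarEmbedding f γ

/-- A plane triangulation on `n` vertices: a maximal planar simple graph on `n ≥ 3`
vertices, i.e. a planar graph with exactly `3n - 6` edges. -/
def IsPlaneTriangulation {n : ℕ} (G : SimpleGraph (Fin n)) : Prop :=
  3 ≤ n ∧ G.IsPlanar ∧ G.edgeSet.ncard = 3 * n - 6

/-- `M` is a matching of size `k` in `G` (a copy of `kK₂`): a set of `k` pairwise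
vertex-disjoint edges of `G`. -/
def IsMatchingOfSize {V : Type*} (G : SimpleGraph V) (M : Finset (Sym2 V)) (k : ℕ) : Prop :=
  M.card = k ∧ (↑M : Set (Sym2 V)) ⊆ G.edgeSet ∧
    ∀ e ∈ M, ∀ e' ∈ M, e ≠ e' → ∀ v : V, v ∈ e → v ∉ e'

/-- Under the edge-coloring `c`, the graph `G` contains a rainbow matching of size `k`. -/
def HasRainbowMatching {V α : Type*} (G : SimpleGraph V) (c : Sym2 V → α) (k : ℕ) : Prop :=
  ∃ M : Finset (Sym2 V), IsMatchingOfSize G M k ∧ Set.InjOn c (↑M : Set (Sym2 V))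

/-- `r` colors suffice for rainbow `kK₂` in every plane triangulation on `n` vertices:
every edge-coloring of such a triangulation using at least `r` distinct colors contains
a rainbow matching of size `k`. -/
def RainbowThreshold (n k r : ℕ) : Prop :=
  ∀ G : SimpleGraph (Fin n), IsPlaneTriangulation G →
    ∀ c : Sym2 (Fin n) → ℕ, r ≤ (c '' G.edgeSet).ncard → HasRainbowMatching G c k



open Classical in
/-- algebraic planarity -/
def VK {V : Type*} (G : SimpleGraph V) : Prop :=
  ∃ σ : V → V → ZMod 2, ∃ k : V → Sym2 V → ZMod 2,
    (∀ a b, a ≠ b → σ a b + σ b a = 1) ∧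
    ∀ a b c d, G.Adj a b → G.Adj c d → a ≠ c → a ≠ d → b ≠ c → b ≠ d →
      k a s(c, d) + k b s(c, d) + k c s(a, b) + k d s(a, b) = σ a c + σ a d + σ b c + σ b d

lemma exists_clog {E : Type*} [NormedAddCommGroup E] [NormedSpace ℝ E] (g : E → ℂ)
    (hg : Continuous g) (h0 : ∀ x, g x ≠ 0) :
    ∃ f : E → ℂ, Continuous f ∧ ∀ x, Complex.exp (f x) = g x := by
  have hs : IsSimplyConnected (Set.univ : Set E) := by
    have := (convex_univ (𝕜 := ℝ) (E := E)).contractibleSpace ⟨0, trivial⟩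
    exact (inferInstance : SimplyConnectedSpace (Set.univ : Set E))
  obtain ⟨f, hf, hf'⟩ := Complex.exists_continuousOn_eqOn_exp_comp hs isOpen_univ
    hg.continuousOn (by rintro ⟨x, -, hx⟩; exact h0 x hx)
  exact ⟨f, continuousOn_univ.1 hf, fun x => hf' (Set.mem_univ x)⟩

lemma const_of_exp_const (d : ℝ → ℂ) (hd : Continuous d)
    (h : ∀ t, Complex.exp (d t) = Complex.exp (d 0)) (t : ℝ) : d t = d 0 := by
  have := Complex.isCoveringMap_exp.eq_of_comp_eq (g₁ := d) (g₂ := fun _ => d 0) hd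
    continuous_const (by ext s; simp [h s]) 0 rfl
  exact congrFun this t

noncomputable def clogDelta (p : ℝ → ℂ) : ℂ := by
  classical
  exact if h : ∃ l : ℝ → ℂ, Continuous l ∧ ∀ t, Complex.exp (l t) = p t then
    h.choose 1 - h.choose 0 else 0

lemma clogDelta_eq (p : ℝ → ℂ) (l : ℝ → ℂ) (C : ℂ) (hC : C ≠ 0) (hl : Continuous l)
    (hp : Continuous p) (h : ∀ t, Complex.exp (l t) = C * p t) : clogDelta p = l 1 - l 0 := by
  have h0 : ∀ t, p t ≠ 0 := fun t h' => by
    have := h t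
    rw [h', mul_zero] at this
    exact Complex.exp_ne_zero _ this
  have hex := exists_clog p hp h0
  unfold clogDelta
  rw [dif_pos hex]
  set m := hex.choose
  have hm := hex.choose_spec
  have := const_of_exp_const (fun t => m t - l t) (hm.1.sub hl) (by
    intro t
    simp only [Complex.exp_sub, h, m, hm.2]
    rw [div_eq_div_iff (by simp [hC, h0]) (by simp [hC, h0])]
    ring) 1
  linear_combination this

lemma mem_of_eq_mk {V : Type*} {e : Sym2 V} {x y : V} (h : e = s(x, y)) : x ∈ e ∧ y ∈ e := by
  subst h; simp

lemma VK_of_curves {V : Type*} (G : SimpleGraph V) (f : V → ℂ) (hf : Function.Injective f)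
    (g : Sym2 V → ℝ → ℂ) (src tgt : Sym2 V → V)
    (hst : ∀ e ∈ G.edgeSet, e = s(src e, tgt e))
    (hgc : ∀ e ∈ G.edgeSet, Continuous (g e))
    (hg0 : ∀ e ∈ G.edgeSet, g e 0 = f (src e)) (hg1 : ∀ e ∈ G.edgeSet, g e 1 = f (tgt e))
    (hv : ∀ e ∈ G.edgeSet, ∀ v, v ∉ e → ∀ t, g e t ≠ f v)
    (he : ∀ e ∈ G.edgeSet, ∀ e' ∈ G.edgeSet, (∀ v ∈ e, v ∉ e') → ∀ s t, g e s ≠ g e' t) :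
    VK G := by
  classical
  -- the logarithms
  let A : V → V → ℂ := fun u v => Complex.log (f v - f u)
  have hA : ∀ u v, u ≠ v → Complex.exp (A u v) = f v - f u := fun u v huv =>
    Complex.exp_log (sub_ne_zero.2 fun h => huv (hf h).symm)
  have hpi : (2 * Real.pi * Complex.I : ℂ) ≠ 0 := Complex.two_pi_I_ne_zero
  -- M
  have hM : ∀ u v, ∃ M : ℤ, u ≠ v → A u v - A v u = Real.pi * Complex.I * (2 * M + 1) := by
    intro u v
    by_cases huv : u = v
    · exact ⟨0, fun h => absurd huv h⟩
    have : Complex.exp (A u v) = Complex.exp (A v u + Real.pi * Complex.I) := by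
      rw [Complex.exp_add, hA u v huv, hA v u (Ne.symm huv), Complex.exp_pi_mul_I]; ring
    obtain ⟨n, hn⟩ := Complex.exp_eq_exp_iff_exists_int.1 this
    exact ⟨n, fun _ => by rw [hn]; ring⟩
  choose M hM using hM
  have hk : ∀ (v : V) (e : Sym2 V), ∃ k : ℤ, e ∈ G.edgeSet → v ∉ e →
      clogDelta (fun t => g e t - f v) = A v (tgt e) - A v (src e) + k * (2 * Real.pi * Complex.I) := by
    intro v e
    by_cases h : e ∈ G.edgeSet ∧ v ∉ e
    · obtain ⟨he1, he2⟩ := h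
      obtain ⟨l, hl, hl'⟩ := exists_clog (fun t => g e t - f v)
        ((hgc e he1).sub continuous_const) (fun t => sub_ne_zero.2 (hv e he1 v he2 t))
      have h1 := clogDelta_eq (fun t => g e t - f v) l 1 one_ne_zero hl
        ((hgc e he1).sub continuous_const) (fun t => by rw [hl' t, one_mul])
      have hs : v ≠ src e := fun h => he2 (by rw [hst e he1, h]; simp)
      have ht : v ≠ tgt e := fun h => he2 (by rw [hst e he1, h]; simp)
      obtain ⟨n0, h0⟩ := Complex.exp_eq_exp_iff_exists_int.1
        ((hl' 0).trans (by rw [hA v _ hs, hg0 e he1] : _ = Complex.exp (A v (src e))))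
      obtain ⟨n1, h1'⟩ := Complex.exp_eq_exp_iff_exists_int.1
        ((hl' 1).trans (by rw [hA v _ ht, hg1 e he1] : _ = Complex.exp (A v (tgt e))))
      refine ⟨n1 - n0, fun _ _ => ?_⟩
      rw [h1, h0, h1']
      push_cast
      ring
    · exact ⟨0, fun h1 h2 => absurd ⟨h1, h2⟩ h⟩
  choose k hk using hk
  have hMsymm : ∀ a b, a ≠ b → M a b + M b a = -1 := by
    intro a b hab
    have h1 := hM a b hab
    have h2 := hM b a hab.symm
    have h3 : (2 * Real.pi * Complex.I : ℂ) * ((M a b + M b a + 1 : ℤ) : ℂ) = 0 := by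
      push_cast
      linear_combination -h1 - h2
    have := (mul_eq_zero.1 h3).resolve_left hpi
    have : M a b + M b a + 1 = 0 := by exact_mod_cast this
    omega
  have main : ∀ e ∈ G.edgeSet, ∀ e' ∈ G.edgeSet, (∀ v ∈ e, v ∉ e') →
      (M (src e) (tgt e') - M (src e) (src e') - M (tgt e) (tgt e') + M (tgt e) (src e')) +
      (k (src e) e' + k (tgt e') e - k (src e') e - k (tgt e) e') = 0 := by
    intro e h1 e' h2 hdis
    have hF : Continuous (fun x : ℝ × ℝ => g e' x.2 - g e x.1) :=
      ((hgc e' h2).comp continuous_snd).sub ((hgc e h1).comp continuous_fst)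
    obtain ⟨L, hL, hL'⟩ := exists_clog (fun x : ℝ × ℝ => g e' x.2 - g e x.1) hF
      (fun x => sub_ne_zero.2 (he e h1 e' h2 hdis _ _).symm)
    have ma : src e ∈ e := (mem_of_eq_mk (hst e h1)).1
    have mb : tgt e ∈ e := (mem_of_eq_mk (hst e h1)).2
    have mc : src e' ∈ e' := (mem_of_eq_mk (hst e' h2)).1
    have md : tgt e' ∈ e' := (mem_of_eq_mk (hst e' h2)).2
    have Dg : ∀ (e : Sym2 V) (h : e ∈ G.edgeSet) (v : V), Continuous (fun t => g e t - f v) :=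
      fun e h v => (hgc e h).sub continuous_const
    have e1 := clogDelta_eq (fun t => g e' t - f (src e)) (fun t => L (0, t)) 1 one_ne_zero
      (hL.comp (by fun_prop)) (Dg e' h2 _) (fun t => by rw [hL', hg0 e h1, one_mul])
    have e2 := clogDelta_eq (fun t => g e' t - f (tgt e)) (fun t => L (1, t)) 1 one_ne_zero
      (hL.comp (by fun_prop)) (Dg e' h2 _) (fun t => by rw [hL', hg1 e h1, one_mul])
    have e3 := clogDelta_eq (fun t => g e t - f (src e')) (fun t => L (t, 0)) (-1) (by norm_num)
      (hL.comp (by fun_prop)) (Dg e h1 _) (fun t => by rw [hL', hg0 e' h2]; ring)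
    have e4 := clogDelta_eq (fun t => g e t - f (tgt e')) (fun t => L (t, 1)) (-1) (by norm_num)
      (hL.comp (by fun_prop)) (Dg e h1 _) (fun t => by rw [hL', hg1 e' h2]; ring)
    rw [hk _ _ h2 (hdis _ ma)] at e1
    rw [hk _ _ h2 (hdis _ mb)] at e2
    rw [hk _ _ h1 (fun h => hdis _ h mc)] at e3
    rw [hk _ _ h1 (fun h => hdis _ h md)] at e4
    have n1 : src e ≠ tgt e' := fun h => hdis _ ma (h ▸ md)
    have n2 : src e ≠ src e' := fun h => hdis _ ma (h ▸ mc)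
    have n3 : tgt e ≠ tgt e' := fun h => hdis _ mb (h ▸ md)
    have n4 : tgt e ≠ src e' := fun h => hdis _ mb (h ▸ mc)
    have m1 := hM _ _ n1
    have m2 := hM _ _ n2
    have m3 := hM _ _ n3
    have m4 := hM _ _ n4
    have : (2 * Real.pi * Complex.I : ℂ) * (((M (src e) (tgt e') - M (src e) (src e') - M (tgt e) (tgt e') + M (tgt e) (src e')) +
      (k (src e) e' + k (tgt e') e - k (src e') e - k (tgt e) e') : ℤ) : ℂ) = 0 := by
      push_cast
      linear_combination e1 - e2 - e3 + e4 - m1 + m2 + m3 - m4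
    have := (mul_eq_zero.1 this).resolve_left hpi
    exact_mod_cast this
  refine ⟨fun a b => (M a b : ZMod 2), fun v e => (k v e : ZMod 2), ?_, ?_⟩
  · intro a b hab
    have := congrArg (Int.cast : ℤ → ZMod 2) (hMsymm a b hab)
    push_cast at this
    rw [this]; decide
  · intro a b c d hab hcd h1 h2 h3 h4
    have hab' : s(a,b) ∈ G.edgeSet := hab
    have hcd' : s(c,d) ∈ G.edgeSet := hcd
    have := congrArg (Int.cast : ℤ → ZMod 2) (main s(a,b) hab s(c,d) hcd (by
      intro v hv hv'
      simp only [Sym2.mem_iff] at hv hv'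
      rcases hv with h | h <;> rcases hv' with h' | h' <;> subst h <;> contradiction))
    push_cast at this
    have two : (2 : ZMod 2) = 0 := rfl
    rcases Sym2.eq_iff.1 (hst _ hab') with ⟨ha, hb⟩ | ⟨ha, hb⟩ <;>
    rcases Sym2.eq_iff.1 (hst _ hcd') with ⟨hc, hd⟩ | ⟨hc, hd⟩ <;>
    rw [← ha, ← hb, ← hc, ← hd] at this <;> simp only [CharTwo.sub_eq_add] at this <;>
    linear_combination this - (M a c + M a d + M b c + M b d : ZMod 2) * two

lemma VK_of_planar {V : Type*} (G : SimpleGraph V) (h : G.IsPlanar) : VK G := by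
  classical
  obtain ⟨f, γ, hf, hc, hi, hst, hv, he⟩ := h
  choose src tgt hs h0 h1 using hst
  let φ : ℝ × ℝ → ℂ := Complex.equivRealProdCLM.symm
  have φc : Continuous φ := Complex.equivRealProdCLM.symm.continuous
  have φi : Function.Injective φ := Complex.equivRealProdCLM.symm.injective
  by_cases hV : Nonempty V
  swap
  · exact ⟨fun _ _ => 0, fun _ _ => 0, fun a => absurd ⟨a⟩ hV, fun a => absurd ⟨a⟩ hV⟩
  let pr : ℝ → ℝ := fun t => (Set.projIcc (0:ℝ) 1 zero_le_one t : ℝ)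
  have prm : ∀ t, pr t ∈ Set.Icc (0:ℝ) 1 := fun t => Subtype.coe_prop _
  have prc : Continuous pr := continuous_subtype_val.comp continuous_projIcc
  have pr0 : pr 0 = 0 := by simp [pr]
  have pr1 : pr 1 = 1 := by simp [pr]
  have cases01 : ∀ t ∈ Set.Icc (0:ℝ) 1, t = 0 ∨ t = 1 ∨ t ∈ Set.Ioo (0:ℝ) 1 := by
    intro t ht
    rcases eq_or_lt_of_le ht.1 with h | h
    · exact Or.inl h.symm
    rcases eq_or_lt_of_le ht.2 with h' | h'
    · exact Or.inr (Or.inl h')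
    · exact Or.inr (Or.inr ⟨h, h'⟩)
  have hvv : ∀ e : G.edgeSet, ∀ v, v ∉ (e : Sym2 V) → ∀ t ∈ Set.Icc (0:ℝ) 1, γ e t ≠ f v := by
    intro e v hve t ht
    rcases cases01 t ht with rfl | rfl | ht
    · rw [h0]; intro h; exact hve (by rw [hs e, ← hf h]; simp)
    · rw [h1]; intro h; exact hve (by rw [hs e, ← hf h]; simp)
    · exact hv e t ht v
  apply VK_of_curves G (fun v => φ (f v)) (φi.comp hf)
    (fun e t => if h : e ∈ G.edgeSet then φ (γ ⟨e, h⟩ (pr t)) else 0)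
    (fun e => if h : e ∈ G.edgeSet then src ⟨e, h⟩ else hV.some)
    (fun e => if h : e ∈ G.edgeSet then tgt ⟨e, h⟩ else hV.some)
  · intro e he
    simp only [he, dite_true]
    exact hs ⟨e, he⟩
  · intro e he
    simp only [he, dite_true]
    exact φc.comp ((hc ⟨e, he⟩).comp_continuous prc prm)
  · intro e he
    simp only [he, dite_true, pr0, h0]
  · intro e he
    simp only [he, dite_true, pr1, h1]
  · intro e he v hve t
    simp only [he, dite_true]
    exact fun h => hvv ⟨e, he⟩ v hve _ (prm t) (φi h)
  · intro e h1e e' h2e hdis s t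
    simp only [h1e, h2e, dite_true]
    intro h
    have h := φi h
    have ms : src ⟨e, h1e⟩ ∈ e := (mem_of_eq_mk (hs ⟨e, h1e⟩)).1
    have mt : tgt ⟨e, h1e⟩ ∈ e := (mem_of_eq_mk (hs ⟨e, h1e⟩)).2
    have ms' : src ⟨e', h2e⟩ ∈ e' := (mem_of_eq_mk (hs ⟨e', h2e⟩)).1
    have mt' : tgt ⟨e', h2e⟩ ∈ e' := (mem_of_eq_mk (hs ⟨e', h2e⟩)).2
    have hne : (⟨e, h1e⟩ : G.edgeSet) ≠ ⟨e', h2e⟩ := by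
      intro h
      have h := congrArg Subtype.val h
      simp only at h
      exact hdis _ ms (h ▸ ms)
    rcases cases01 _ (prm s) with hs0 | hs0 | hs0
    · rw [hs0, h0] at h
      exact hvv ⟨e', h2e⟩ _ (hdis _ ms) _ (prm t) h.symm
    · rw [hs0, h1] at h
      exact hvv ⟨e', h2e⟩ _ (hdis _ mt) _ (prm t) h.symm
    · rcases cases01 _ (prm t) with ht0 | ht0 | ht0
      · rw [ht0, h0] at h
        exact hvv ⟨e, h1e⟩ _ (fun h => hdis _ h ms') _ (prm s) h
      · rw [ht0, h1] at h
        exact hvv ⟨e, h1e⟩ _ (fun h => hdis _ h mt') _ (prm s) h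
      · exact he _ _ hne _ hs0 _ ht0 h


set_option linter.unusedSimpArgs false
section Minor
variable {V : Type*} {G : SimpleGraph V}

/-- `x` and `y` are joined by a walk inside `B`. -/
def Reach (G : SimpleGraph V) (B : Set V) (x y : V) : Prop :=
  ∃ p : G.Walk x y, ∀ z ∈ p.support, z ∈ B

lemma Reach.refl {B : Set V} {x : V} (h : x ∈ B) : Reach G B x x :=
  ⟨SimpleGraph.Walk.nil, by simpa using h⟩

lemma Reach.symm {B : Set V} {x y : V} (h : Reach G B x y) : Reach G B y x := by
  obtain ⟨p, hp⟩ := h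
  exact ⟨p.reverse, by simpa using hp⟩

lemma Reach.trans {B : Set V} {x y z : V} (h : Reach G B x y) (h' : Reach G B y z) :
    Reach G B x z := by
  obtain ⟨p, hp⟩ := h
  obtain ⟨q, hq⟩ := h'
  refine ⟨p.append q, fun w hw => ?_⟩
  rw [SimpleGraph.Walk.mem_support_append_iff] at hw
  exact hw.elim (hp w) (hq w)

lemma Reach.of_adj {B : Set V} {x y : V} (hx : x ∈ B) (hy : y ∈ B) (h : G.Adj x y) :
    Reach G B x y := ⟨SimpleGraph.Walk.cons h SimpleGraph.Walk.nil, by simp [hx, hy]⟩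

lemma Reach.mono {B C : Set V} {x y : V} (h : Reach G B x y) (hBC : B ⊆ C) : Reach G C x y := by
  obtain ⟨p, hp⟩ := h
  exact ⟨p, fun z hz => hBC (hp z hz)⟩

lemma Reach.mem_left {B : Set V} {x y : V} (h : Reach G B x y) : x ∈ B := by
  obtain ⟨p, hp⟩ := h
  exact hp _ p.start_mem_support

lemma Reach.mem_right {B : Set V} {x y : V} (h : Reach G B x y) : y ∈ B := h.symm.mem_left

/-- if `P` is closed under adjacency in `B`, reachability preserves `P`. -/
lemma Reach.closed {B : Set V} {x y : V} (h : Reach G B x y) (P : V → Prop)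
    (hP : ∀ a b, a ∈ B → b ∈ B → G.Adj a b → P a → P b) (hx : P x) : P y := by
  obtain ⟨p, hp⟩ := h
  induction p with
  | nil => exact hx
  | cons h q ih =>
    exact ih (hP _ _ (hp _ (by simp)) (hp _ (by simp)) h hx) (fun z hz => hp z (by simp [hz]))

/-- connected vertex sets -/
def Conn (G : SimpleGraph V) (B : Set V) : Prop :=
  B.Nonempty ∧ ∀ x ∈ B, ∀ y ∈ B, Reach G B x y

lemma Conn.singleton (x : V) : Conn G {x} :=
  ⟨⟨x, rfl⟩, by rintro a rfl b rfl; exact Reach.refl rfl⟩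

lemma Conn.union {B C : Set V} (hB : Conn G B) (hC : Conn G C) {x y : V} (hx : x ∈ B) (hy : y ∈ C)
    (h : G.Adj x y) : Conn G (B ∪ C) := by
  refine ⟨⟨x, Or.inl hx⟩, ?_⟩
  have key : ∀ a ∈ B ∪ C, Reach G (B ∪ C) x a := by
    rintro a (ha | ha)
    · exact (hB.2 x hx a ha).mono Set.subset_union_left
    · exact (Reach.of_adj (B := B ∪ C) (Or.inl hx) (Or.inr hy) h).trans
        ((hC.2 y hy a ha).mono Set.subset_union_right)
  exact fun a ha b hb => (key a ha).symm.trans (key b hb)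

lemma Conn.pair {x y : V} (h : G.Adj x y) : Conn G {x, y} :=
  Conn.union (Conn.singleton x) (Conn.singleton y) rfl rfl h

lemma Conn.of_root {B : Set V} {x : V} (hx : x ∈ B) (h : ∀ y ∈ B, Reach G B x y) : Conn G B :=
  ⟨⟨x, hx⟩, fun a ha b hb => (h a ha).symm.trans (h b hb)⟩

lemma Conn.comp {B : Set V} {x : V} (hx : x ∈ B) : Conn G {y | Reach G B x y} := by
  refine Conn.of_root (x := x) (Reach.refl hx) ?_
  rintro y ⟨p, hp⟩
  classical
  refine ⟨p, fun z hz => ?_⟩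
  exact ⟨p.takeUntil z hz, fun w hw => hp w (p.support_takeUntil_subset_support hz hw)⟩

lemma comp_closed {B : Set V} {x a b : V} (ha : Reach G B x a) (hb : b ∈ B) (h : G.Adj a b) :
    Reach G B x b := ha.trans (Reach.of_adj ha.mem_right hb h)

/-- sum of `k v` along a walk -/
def walkSum (k : V → Sym2 V → ZMod 2) (v : V) {a b : V} (p : G.Walk a b) : ZMod 2 :=
  (p.edges.map (k v)).sum

lemma two_zero : (2 : ZMod 2) = 0 := rfl

lemma walk_eq1 (σ : V → V → ZMod 2) (k : V → Sym2 V → ZMod 2)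
    (hk : ∀ a b c d, G.Adj a b → G.Adj c d → a ≠ c → a ≠ d → b ≠ c → b ≠ d →
      k a s(c, d) + k b s(c, d) + k c s(a, b) + k d s(a, b) = σ a c + σ a d + σ b c + σ b d)
    {c d : V} (hcd : G.Adj c d) {a b : V} (p : G.Walk a b) (h1 : c ∉ p.support) (h2 : d ∉ p.support) :
    k a s(c, d) + k b s(c, d) + walkSum k c p + walkSum k d p = σ a c + σ a d + σ b c + σ b d := by
  induction p with
  | nil =>
    simp only [walkSum, SimpleGraph.Walk.edges_nil, List.map_nil, List.sum_nil]
    rename_i u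
    linear_combination (k u s(c,d) - σ u c - σ u d) * two_zero
  | @cons u v w h q ih =>
    simp only [SimpleGraph.Walk.support_cons, List.mem_cons, not_or] at h1 h2
    have := ih h1.2 h2.2
    have h3 : ∀ z, z ∉ q.support → v ≠ z := fun z hz h => hz (h ▸ q.start_mem_support)
    have e := hk u v c d h hcd (Ne.symm h1.1) (Ne.symm h2.1) (h3 _ h1.2) (h3 _ h2.2)
    simp only [walkSum, SimpleGraph.Walk.edges_cons, List.map_cons, List.sum_cons] at this ⊢
    linear_combination this + e - (k v s(c,d) - σ v c - σ v d) * two_zero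

lemma walk_eq2 (σ : V → V → ZMod 2) (k : V → Sym2 V → ZMod 2)
    (hk : ∀ a b c d, G.Adj a b → G.Adj c d → a ≠ c → a ≠ d → b ≠ c → b ≠ d →
      k a s(c, d) + k b s(c, d) + k c s(a, b) + k d s(a, b) = σ a c + σ a d + σ b c + σ b d)
    {a b : V} (p : G.Walk a b) {c d : V} (q : G.Walk c d) (h : ∀ z ∈ q.support, z ∉ p.support) :
    walkSum k a q + walkSum k b q + walkSum k c p + walkSum k d p =
      σ a c + σ a d + σ b c + σ b d := by
  induction q with
  | nil =>
    rename_i u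
    simp only [walkSum, SimpleGraph.Walk.edges_nil, List.map_nil, List.sum_nil]
    linear_combination ((List.map (k u) p.edges).sum - σ a u - σ b u) * two_zero
  | @cons u v w hh q ih =>
    simp only [SimpleGraph.Walk.support_cons, List.mem_cons] at h
    have := ih (fun z hz => h z (Or.inr hz))
    have e := walk_eq1 σ k hk hh p (h u (Or.inl rfl)) (h v (Or.inr q.start_mem_support))
    simp only [walkSum, SimpleGraph.Walk.edges_cons, List.map_cons, List.sum_cons] at this e ⊢
    linear_combination this + e - ((List.map (k v) p.edges).sum - σ a v - σ b v) * two_zero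

lemma VK.of_walks (hG : VK G) {W : Type*} (M : SimpleGraph W) (r : W → V)
    (hr : Function.Injective r) (p : ∀ w w', M.Adj w w' → G.Walk (r w) (r w'))
    (hp : ∀ a b c d (hab : M.Adj a b) (hcd : M.Adj c d), a ≠ c → a ≠ d → b ≠ c → b ≠ d →
      ∀ z ∈ (p c d hcd).support, z ∉ (p a b hab).support) : VK M := by
  classical
  obtain ⟨σ, k, hσ, hk⟩ := hG
  refine ⟨fun a b => σ (r a) (r b), fun w e => if h : M.Adj e.out.1 e.out.2 then
    walkSum k (r w) (p _ _ h) else 0, fun a b hab => hσ _ _ (fun h => hab (hr h)), ?_⟩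
  intro a b c d hab hcd h1 h2 h3 h4
  have out : ∀ a b : W, ((s(a, b)).out.1 = a ∧ (s(a, b)).out.2 = b) ∨
      ((s(a, b)).out.1 = b ∧ (s(a, b)).out.2 = a) := by
    intro a b
    have : s((s(a, b)).out.1, (s(a, b)).out.2) = s(a, b) := Quot.out_eq _
    exact Sym2.eq_iff.1 this
  have hab' : M.Adj (s(a, b)).out.1 (s(a, b)).out.2 := by
    rcases out a b with ⟨h, h'⟩ | ⟨h, h'⟩ <;> rw [h, h']
    · exact hab
    · exact hab.symm
  have hcd' : M.Adj (s(c, d)).out.1 (s(c, d)).out.2 := by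
    rcases out c d with ⟨h, h'⟩ | ⟨h, h'⟩ <;> rw [h, h']
    · exact hcd
    · exact hcd.symm
  simp only [dif_pos hab', dif_pos hcd']
  have key := walk_eq2 σ k hk (p _ _ hab') (p _ _ hcd') (hp _ _ _ _ hab' hcd'
    (by rcases out a b with ⟨h, h'⟩ | ⟨h, h'⟩ <;> rcases out c d with ⟨g, g'⟩ | ⟨g, g'⟩ <;>
          rw [h, g] <;> assumption)
    (by rcases out a b with ⟨h, h'⟩ | ⟨h, h'⟩ <;> rcases out c d with ⟨g, g'⟩ | ⟨g, g'⟩ <;>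
          rw [h, g'] <;> assumption)
    (by rcases out a b with ⟨h, h'⟩ | ⟨h, h'⟩ <;> rcases out c d with ⟨g, g'⟩ | ⟨g, g'⟩ <;>
          rw [h', g] <;> assumption)
    (by rcases out a b with ⟨h, h'⟩ | ⟨h, h'⟩ <;> rcases out c d with ⟨g, g'⟩ | ⟨g, g'⟩ <;>
          rw [h', g'] <;> assumption))
  generalize p _ _ hab' = P at key ⊢
  generalize p _ _ hcd' = Q at key ⊢
  obtain ⟨KP, hKP⟩ : ∃ KP : V → ZMod 2, ∀ v, walkSum k v P = KP v := ⟨_, fun _ => rfl⟩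
  obtain ⟨KQ, hKQ⟩ : ∃ KQ : V → ZMod 2, ∀ v, walkSum k v Q = KQ v := ⟨_, fun _ => rfl⟩
  simp only [hKP, hKQ] at key ⊢
  rcases out a b with ⟨h, h'⟩ | ⟨h, h'⟩ <;> rcases out c d with ⟨g, g'⟩ | ⟨g, g'⟩ <;>
    (rw [h, h', g, g'] at key; linear_combination key)

lemma VK.of_minor (hG : VK G) {W : Type*} (M : SimpleGraph W) (B : W → Set V)
    (hB : ∀ w, Conn G (B w)) (hd : ∀ w w', w ≠ w' → Disjoint (B w) (B w'))
    (hM : ∀ w w', M.Adj w w' → ∃ x ∈ B w, ∃ y ∈ B w', G.Adj x y) : VK M := by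
  choose r hr using fun w => (hB w).1
  have hw : ∀ w w', M.Adj w w' → Reach G (B w ∪ B w') (r w) (r w') := by
    intro w w' h
    obtain ⟨x, hx, y, hy, hxy⟩ := hM w w' h
    exact ((hB w).union (hB w') hx hy hxy).2 _ (Or.inl (hr w)) _ (Or.inr (hr w'))
  choose p hp using hw
  have hne : ∀ w w' x, x ∈ B w → x ∈ B w' → w = w' := by
    intro w w' x h h'
    by_contra hne
    exact Set.disjoint_left.1 (hd w w' hne) h h'
  refine VK.of_walks hG M r (fun w w' h => hne w w' (r w) (hr w) (h ▸ hr w')) p ?_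
  intro a b c d hab hcd h1 h2 h3 h4 z hz hz'
  rcases hp _ _ hab z hz' with h | h <;> rcases hp _ _ hcd z hz with h' | h'
  · exact h1 (hne _ _ z h h')
  · exact h2 (hne _ _ z h h')
  · exact h3 (hne _ _ z h h')
  · exact h4 (hne _ _ z h h')

lemma VK.mono {H : SimpleGraph V} (hG : VK G) (h : H ≤ G) : VK H := by
  obtain ⟨σ, k, hσ, hk⟩ := hG
  exact ⟨σ, k, hσ, fun a b c d hab hcd => hk a b c d (h hab) (h hcd)⟩

lemma VK.induce (hG : VK G) {W : Type*} (f : W → V) (hf : Function.Injective f) :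
    VK (G.comap f) := by
  refine hG.of_minor _ (fun w => {f w}) (fun w => Conn.singleton _) ?_ ?_
  · intro w w' h
    simpa using fun h' => h (hf h')
  · intro w w' h
    exact ⟨_, rfl, _, rfl, h⟩

lemma not_VK_K33 : ¬ VK (completeBipartiteGraph (Fin 3) (Fin 3)) := by
  rintro ⟨σ, k, hσ, hk⟩
  have key : ∀ i i' j j' : Fin 3, i ≠ i' → j ≠ j' →
    k (.inl i) s(.inl i', .inr j') + k (.inr j) s(.inl i', .inr j') + k (.inl i') s(.inl i, .inr j)
      + k (.inr j') s(.inl i, .inr j) = σ (.inl i) (.inl i') + σ (.inl i) (.inr j') +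
        σ (.inr j) (.inl i') + σ (.inr j) (.inr j') := by
    intro i i' j j' hi hj
    exact hk _ _ _ _ (by simp) (by simp) (by simpa using hi) (by simp) (by simp) (by simpa using hj)
  have d01 : (0 : Fin 3) ≠ 1 := by decide
  have d02 : (0 : Fin 3) ≠ 2 := by decide
  have d12 : (1 : Fin 3) ≠ 2 := by decide
  have S : ∀ a b : Fin 3 ⊕ Fin 3, a ≠ b → σ b a = 1 + σ a b := by
    intro a b hab
    linear_combination hσ a b hab - σ a b * two_zero
  have s1 : ∀ i j : Fin 3, σ (.inr j) (.inl i) = 1 + σ (.inl i) (.inr j) := fun i j =>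
    S _ _ (by simp)
  have s2 : ∀ i j : Fin 3, i ≠ j → σ (.inr j) (.inr i) = 1 + σ (.inr i) (.inr j) := fun i j h =>
    S _ _ (by simpa using h)
  have fin : ∀ i i' : Fin 3, i ≠ i' → True := fun _ _ _ => trivial
  have e1 := key 0 1 0 1 d01 d01
  have e2 := key 0 1 0 2 d01 d02
  have e3 := key 0 1 1 2 d01 d12
  have e4 := key 0 1 1 0 d01 d01.symm
  have e5 := key 0 1 2 0 d01 d02.symm
  have e6 := key 0 1 2 1 d01 d12.symm
  have f1 := key 0 2 0 1 d02 d01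
  have f2 := key 0 2 0 2 d02 d02
  have f3 := key 0 2 1 2 d02 d12
  have f4 := key 0 2 1 0 d02 d01.symm
  have f5 := key 0 2 2 0 d02 d02.symm
  have f6 := key 0 2 2 1 d02 d12.symm
  have g1 := key 1 2 0 1 d12 d01
  have g2 := key 1 2 0 2 d12 d02
  have g3 := key 1 2 1 2 d12 d12
  have g4 := key 1 2 1 0 d12 d01.symm
  have g5 := key 1 2 2 0 d12 d02.symm
  have g6 := key 1 2 2 1 d12 d12.symm
  simp only [s1, s2 0 1 d01, s2 0 2 d02, s2 1 2 d12] at e1 e2 e3 e4 e5 e6 f1 f2 f3 f4 f5 f6 g1 g2 g3 g4 g5 g6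
  have : (1 : ZMod 2) = 0 := by
    linear_combination (norm := (ring_nf; reduce_mod_char)) e1 + e2 + e3 + e4 + e5 + e6 + f1 + f2 + f3 + f4 + f5 + f6 + g1 + g2 + g3 + g4 + g5 + g6
  exact one_ne_zero this

lemma not_VK_K5 : ¬ VK (⊤ : SimpleGraph (Fin 5)) := by
  rintro ⟨σ, k, hσ, hk⟩
  have key : ∀ a b c d : Fin 5, a ≠ b → c ≠ d → a ≠ c → a ≠ d → b ≠ c → b ≠ d → _ :=
    fun a b c d hab hcd => hk a b c d hab hcd
  have S : ∀ a b : Fin 5, a ≠ b → σ b a = 1 + σ a b := by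
    intro a b hab
    linear_combination hσ a b hab - σ a b * two_zero
  have a1 := key 0 1 2 3 (by decide) (by decide) (by decide) (by decide) (by decide) (by decide)
  have a2 := key 0 2 1 3 (by decide) (by decide) (by decide) (by decide) (by decide) (by decide)
  have a3 := key 0 3 1 2 (by decide) (by decide) (by decide) (by decide) (by decide) (by decide)
  have b1 := key 0 1 2 4 (by decide) (by decide) (by decide) (by decide) (by decide) (by decide)
  have b2 := key 0 2 1 4 (by decide) (by decide) (by decide) (by decide) (by decide) (by decide)
  have b3 := key 0 4 1 2 (by decide) (by decide) (by decide) (by decide) (by decide) (by decide)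
  have c1 := key 0 1 3 4 (by decide) (by decide) (by decide) (by decide) (by decide) (by decide)
  have c2 := key 0 3 1 4 (by decide) (by decide) (by decide) (by decide) (by decide) (by decide)
  have c3 := key 0 4 1 3 (by decide) (by decide) (by decide) (by decide) (by decide) (by decide)
  have d1 := key 0 2 3 4 (by decide) (by decide) (by decide) (by decide) (by decide) (by decide)
  have d2 := key 0 3 2 4 (by decide) (by decide) (by decide) (by decide) (by decide) (by decide)
  have d3 := key 0 4 2 3 (by decide) (by decide) (by decide) (by decide) (by decide) (by decide)
  have e1 := key 1 2 3 4 (by decide) (by decide) (by decide) (by decide) (by decide) (by decide)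
  have e2 := key 1 3 2 4 (by decide) (by decide) (by decide) (by decide) (by decide) (by decide)
  have e3 := key 1 4 2 3 (by decide) (by decide) (by decide) (by decide) (by decide) (by decide)
  simp only [S 0 1 (by decide), S 0 2 (by decide), S 0 3 (by decide), S 0 4 (by decide),
    S 1 2 (by decide), S 1 3 (by decide), S 1 4 (by decide), S 2 3 (by decide), S 2 4 (by decide),
    S 3 4 (by decide)] at a1 a2 a3 b1 b2 b3 c1 c2 c3 d1 d2 d3 e1 e2 e3
  have : (1 : ZMod 2) = 0 := by
    linear_combination (norm := (ring_nf; reduce_mod_char)) a1 + a2 + a3 + b1 + b2 + b3 + c1 + c2 + c3 + d1 + d2 + d3 + e1 + e2 + e3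
  exact one_ne_zero this

end Minor


section Minor2
variable {V : Type*} {G : SimpleGraph V}

/-- two sets are joined by an edge -/
def Tch (G : SimpleGraph V) (A B : Set V) : Prop := ∃ x ∈ A, ∃ y ∈ B, G.Adj x y

lemma Tch.symm {A B : Set V} (h : Tch G A B) : Tch G B A := by
  obtain ⟨x, hx, y, hy, h⟩ := h
  exact ⟨y, hy, x, hx, h.symm⟩

lemma VK.noK33_fun (hG : VK G) (X Y : Fin 3 → Set V) (cX : ∀ i, Conn G (X i))
    (cY : ∀ i, Conn G (Y i)) (dX : ∀ i j, i ≠ j → Disjoint (X i) (X j))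
    (dY : ∀ i j, i ≠ j → Disjoint (Y i) (Y j)) (dXY : ∀ i j, Disjoint (X i) (Y j))
    (h : ∀ i j, Tch G (X i) (Y j)) : False := by
  refine not_VK_K33 (hG.of_minor _ (Sum.elim X Y) ?_ ?_ ?_)
  · rintro (i | i)
    · exact cX i
    · exact cY i
  · rintro (i | i) (j | j) hij
    · exact dX i j (by simpa using hij)
    · exact dXY i j
    · exact (dXY j i).symm
    · exact dY i j (by simpa using hij)
  · rintro (i | i) (j | j) hij
    · simp at hij
    · exact h i j
    · exact (h j i).symm
    · simp at hij

lemma VK.noK33 (hG : VK G) {A B C D E F : Set V} (cA : Conn G A) (cB : Conn G B) (cC : Conn G C)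
    (cD : Conn G D) (cE : Conn G E) (cF : Conn G F)
    (hd : List.Pairwise Disjoint [A, B, C, D, E, F])
    (hAD : Tch G A D) (hAE : Tch G A E) (hAF : Tch G A F)
    (hBD : Tch G B D) (hBE : Tch G B E) (hBF : Tch G B F)
    (hCD : Tch G C D) (hCE : Tch G C E) (hCF : Tch G C F) : False := by
  simp only [List.pairwise_cons, List.mem_cons, forall_eq_or_imp, List.not_mem_nil,
    false_imp_iff, implies_true, and_true] at hd
  obtain ⟨⟨h1, h2, h3, h4, h5⟩, ⟨h6, h7, h8, h9⟩, ⟨h10, h11, h12⟩, ⟨h13, h14⟩, h15, -⟩ := hd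
  apply hG.noK33_fun ![A, B, C] ![D, E, F]
  · intro i; fin_cases i <;> assumption
  · intro i; fin_cases i <;> assumption
  · intro i j hij
    fin_cases i <;> fin_cases j <;> simp at hij ⊢ <;> first | assumption | (apply Disjoint.symm; assumption)
  · intro i j hij
    fin_cases i <;> fin_cases j <;> simp at hij ⊢ <;> first | assumption | (apply Disjoint.symm; assumption)
  · intro i j
    fin_cases i <;> fin_cases j <;> assumption
  · intro i j
    fin_cases i <;> fin_cases j <;> assumption

/-- `K33` with two single vertices on the left -/
lemma VK.noK33_two (hG : VK G) {x y : V} {Z O₁ O₂ O₃ : Set V} (hxy : x ≠ y)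
    (cZ : Conn G Z) (c1 : Conn G O₁) (c2 : Conn G O₂) (c3 : Conn G O₃)
    (xZ : x ∉ Z) (yZ : y ∉ Z) (x1 : x ∉ O₁) (x2 : x ∉ O₂) (x3 : x ∉ O₃)
    (y1 : y ∉ O₁) (y2 : y ∉ O₂) (y3 : y ∉ O₃)
    (dz1 : Disjoint Z O₁) (dz2 : Disjoint Z O₂) (dz3 : Disjoint Z O₃)
    (d12 : Disjoint O₁ O₂) (d13 : Disjoint O₁ O₃) (d23 : Disjoint O₂ O₃)
    (ax1 : ∃ o ∈ O₁, G.Adj x o) (ax2 : ∃ o ∈ O₂, G.Adj x o) (ax3 : ∃ o ∈ O₃, G.Adj x o)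
    (ay1 : ∃ o ∈ O₁, G.Adj y o) (ay2 : ∃ o ∈ O₂, G.Adj y o) (ay3 : ∃ o ∈ O₃, G.Adj y o)
    (az1 : Tch G Z O₁) (az2 : Tch G Z O₂) (az3 : Tch G Z O₃) : False := by
  have T : ∀ {x : V} {O : Set V}, (∃ o ∈ O, G.Adj x o) → Tch G {x} O := by
    rintro x O ⟨o, ho, h⟩
    exact ⟨x, rfl, o, ho, h⟩
  refine hG.noK33 (Conn.singleton x) (Conn.singleton y) cZ c1 c2 c3 ?_ (T ax1) (T ax2) (T ax3)
    (T ay1) (T ay2) (T ay3) az1 az2 az3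
  simp [*]

/-- `K33` with three single vertices on the left -/
lemma VK.noK33_three (hG : VK G) {x y z : V} {O₁ O₂ O₃ : Set V} (hxy : x ≠ y) (hxz : x ≠ z)
    (hyz : y ≠ z)
    (c1 : Conn G O₁) (c2 : Conn G O₂) (c3 : Conn G O₃)
    (x1 : x ∉ O₁) (x2 : x ∉ O₂) (x3 : x ∉ O₃)
    (y1 : y ∉ O₁) (y2 : y ∉ O₂) (y3 : y ∉ O₃)
    (z1 : z ∉ O₁) (z2 : z ∉ O₂) (z3 : z ∉ O₃)
    (d12 : Disjoint O₁ O₂) (d13 : Disjoint O₁ O₃) (d23 : Disjoint O₂ O₃)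
    (ax1 : ∃ o ∈ O₁, G.Adj x o) (ax2 : ∃ o ∈ O₂, G.Adj x o) (ax3 : ∃ o ∈ O₃, G.Adj x o)
    (ay1 : ∃ o ∈ O₁, G.Adj y o) (ay2 : ∃ o ∈ O₂, G.Adj y o) (ay3 : ∃ o ∈ O₃, G.Adj y o)
    (az1 : ∃ o ∈ O₁, G.Adj z o) (az2 : ∃ o ∈ O₂, G.Adj z o) (az3 : ∃ o ∈ O₃, G.Adj z o) :
    False := by
  have T : ∀ {x : V} {O : Set V}, (∃ o ∈ O, G.Adj x o) → Tch G {x} O := by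
    rintro x O ⟨o, ho, h⟩
    exact ⟨x, rfl, o, ho, h⟩
  exact hG.noK33_two hxy (Conn.singleton z) c1 c2 c3 (by simpa) (by simpa) x1 x2 x3 y1 y2 y3
    (by simpa) (by simpa) (by simpa) d12 d13 d23 ax1 ax2 ax3 ay1 ay2 ay3 (T az1) (T az2) (T az3)

/-- `K33` on six vertices -/
lemma VK.noK33_vert (hG : VK G) {x y z p q r : V} (hxy : x ≠ y) (hxz : x ≠ z)
    (hyz : y ≠ z) (hpq : p ≠ q) (hpr : p ≠ r) (hqr : q ≠ r)
    (xp : G.Adj x p) (xq : G.Adj x q) (xr : G.Adj x r)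
    (yp : G.Adj y p) (yq : G.Adj y q) (yr : G.Adj y r)
    (zp : G.Adj z p) (zq : G.Adj z q) (zr : G.Adj z r) : False := by
  refine hG.noK33_three hxy hxz hyz (Conn.singleton p) (Conn.singleton q) (Conn.singleton r)
    xp.ne xq.ne xr.ne yp.ne yq.ne yr.ne zp.ne zq.ne zr.ne (by simpa) (by simpa) (by simpa)
    ⟨_, rfl, xp⟩ ⟨_, rfl, xq⟩ ⟨_, rfl, xr⟩ ⟨_, rfl, yp⟩ ⟨_, rfl, yq⟩ ⟨_, rfl, yr⟩
    ⟨_, rfl, zp⟩ ⟨_, rfl, zq⟩ ⟨_, rfl, zr⟩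

/-- four pairwise adjacent vertices plus a connected set adjacent to all. -/
lemma VK.noK5 (hG : VK G) {a b c d : V} {Z : Set V} (cZ : Conn G Z)
    (ha : a ∉ Z) (hb : b ∉ Z) (hc : c ∉ Z) (hd : d ∉ Z)
    (ab : G.Adj a b) (ac : G.Adj a c) (ad : G.Adj a d) (bc : G.Adj b c) (bd : G.Adj b d)
    (cd : G.Adj c d) (za : ∃ o ∈ Z, G.Adj a o) (zb : ∃ o ∈ Z, G.Adj b o)
    (zc : ∃ o ∈ Z, G.Adj c o) (zd : ∃ o ∈ Z, G.Adj d o) : False := by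
  have T : ∀ {x : V} {O : Set V}, (∃ o ∈ O, G.Adj x o) → Tch G {x} O := by
    rintro x O ⟨o, ho, h⟩
    exact ⟨x, rfl, o, ho, h⟩
  have T' : ∀ {x y : V}, G.Adj x y → Tch G {x} {y} := by
    intro x y h
    exact ⟨x, rfl, y, rfl, h⟩
  refine not_VK_K5 (hG.of_minor _ ![{a}, {b}, {c}, {d}, Z] ?_ ?_ ?_)
  · intro i; fin_cases i
    · exact Conn.singleton a
    · exact Conn.singleton b
    · exact Conn.singleton c
    · exact Conn.singleton d
    · exact cZ
  · intro i j hij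
    fin_cases i <;> fin_cases j <;> simp at hij ⊢ <;> try assumption
    all_goals first | exact ab.ne | exact ac.ne | exact ad.ne | exact bc.ne | exact bd.ne | exact cd.ne | skip
    all_goals first | exact ab.ne' | exact ac.ne' | exact ad.ne' | exact bc.ne' | exact bd.ne' | exact cd.ne'
  · intro i j hij
    change Tch G _ _
    have h1 := T' ab
    have h2 := T' ac
    have h3 := T' ad
    have h4 := T' bc
    have h5 := T' bd
    have h6 := T' cd
    have h7 := T za
    have h8 := T zb
    have h9 := T zc
    have h10 := T zd
    fin_cases i <;> fin_cases j <;>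
      first | (exfalso; simp at hij; done) | assumption | (apply Tch.symm; assumption)

lemma VK.cliqueFree (hG : VK G) : G.CliqueFree 5 := by
  by_contra h
  have f := SimpleGraph.topEmbeddingOfNotCliqueFree h
  have := hG.induce f f.injective
  refine not_VK_K5 (this.mono ?_)
  intro a b hab
  exact f.map_adj_iff.2 hab

end Minor2


section Mader
open Finset

/-- edge finset -/
noncomputable def ES {V : Type*} [Fintype V] (G : SimpleGraph V) : Finset (Sym2 V) := by
  classical exact univ.filter (· ∈ G.edgeSet)

/-- neighbour finset -/
noncomputable def NB {V : Type*} [Fintype V] (G : SimpleGraph V) (v : V) : Finset V := by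
  classical exact univ.filter (G.Adj v)

/-- edges inside a finset -/
noncomputable def EIn {V : Type*} [Fintype V] (G : SimpleGraph V) (X : Finset V) :
    Finset (Sym2 V) := by
  classical exact (ES G).filter (fun e => ∀ v ∈ e, v ∈ X)

variable {V : Type*} [Fintype V] {G : SimpleGraph V}

@[simp] lemma mem_ES {e : Sym2 V} : e ∈ ES G ↔ e ∈ G.edgeSet := by simp [ES]
@[simp] lemma mem_NB {v w : V} : w ∈ NB G v ↔ G.Adj v w := by simp [NB]
lemma mem_EIn {X : Finset V} {e : Sym2 V} : e ∈ EIn G X ↔ e ∈ G.edgeSet ∧ ∀ v ∈ e, v ∈ X := by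
  simp [EIn]
@[simp] lemma mk_mem_EIn {X : Finset V} {a b : V} :
    s(a, b) ∈ EIn G X ↔ G.Adj a b ∧ a ∈ X ∧ b ∈ X := by
  simp [mem_EIn]

lemma ES_card_eq [Fintype G.edgeSet] : (ES G).card = G.edgeFinset.card := by
  congr 1; ext e; simp

lemma NB_card_eq (v : V) [Fintype (G.neighborSet v)] : (NB G v).card = G.degree v := by
  rw [← SimpleGraph.card_neighborFinset_eq_degree]
  congr 1; ext e; simp

lemma ES_mono {H : SimpleGraph V} (h : H ≤ G) : ES H ⊆ ES G := by
  intro e he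
  rw [mem_ES] at *
  exact SimpleGraph.edgeSet_mono h he

lemma ES_induce_card [DecidableEq V] (s : Finset V) : (ES (G.induce (s : Set V))).card = (EIn G s).card := by
  classical
  have := congrArg Finset.card (SimpleGraph.map_edgeFinset_induce (G := G) (s := (s : Set V)))
  rw [card_map] at this
  rw [ES_card_eq]
  refine (Eq.trans ?_ this).trans ?_
  · congr!
  congr 1
  ext e
  simp [mem_EIn, Finset.mem_sym2_iff]

lemma card_VK_small (h : Fintype.card V ≤ 4) (h3 : 3 ≤ Fintype.card V) :
    (ES G).card ≤ 3 * Fintype.card V - 6 := by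
  classical
  rw [ES_card_eq]
  have := G.card_edgeFinset_le_card_choose_two
  have h' : Fintype.card V = 3 ∨ Fintype.card V = 4 := by omega
  rcases h' with h | h <;> rw [h] at this ⊢ <;> simpa [Nat.choose] using this

theorem mader (m : ℕ) : ∀ (V : Type) [Fintype V] (G : SimpleGraph V), VK G →
    Fintype.card V = m → 3 ≤ m → (ES G).card ≤ 3 * m - 6 := by
  induction m using Nat.strong_induction_on with
  | _ m IH =>
  intro V _ G0 hG0 hm h3
  classical
  by_cases h4 : m ≤ 4
  · subst hm; exact card_VK_small h4 h3
  by_contra hlt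
  -- exact number of edges
  obtain ⟨T, hT, hTc⟩ := Finset.exists_subset_card_eq (s := ES G0) (n := 3 * m - 5) (by omega)
  let G : SimpleGraph V := SimpleGraph.fromEdgeSet (T : Set (Sym2 V))
  have hGG : G ≤ G0 := by
    intro a b hab
    have : s(a, b) ∈ T := by
      have := (SimpleGraph.fromEdgeSet_adj _).1 hab
      exact_mod_cast this.1
    have := hT this
    rwa [mem_ES] at this
  have hG : VK G := hG0.mono hGG
  have hcard : (ES G).card = 3 * m - 5 := by
    rw [← hTc]
    congr 1
    ext e
    rw [mem_ES, SimpleGraph.edgeSet_fromEdgeSet]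
    constructor
    · rintro ⟨h, -⟩; exact_mod_cast h
    · intro h
      refine ⟨by exact_mod_cast h, ?_⟩
      have := hT h
      rw [mem_ES] at this
      exact G0.not_isDiag_of_mem_edgeSet this
  clear_value G
  clear hlt hTc hT hGG
  -- induction step on graphs avoiding v
  have step : ∀ (v : V) (M : SimpleGraph V), (∀ w, ¬ M.Adj v w) → 
      VK (M.comap (Subtype.val : {x : V // x ≠ v} → V)) → (ES M).card ≤ 3 * m - 9 := by
    intro v M hMv hM
    have h1 := IH (m - 1) (by omega) {x : V // x ≠ v} _ hM (by
      rw [Fintype.card_subtype_compl]; simp [hm]) (by omega)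
    have h2 : (ES (M.comap (Subtype.val : {x : V // x ≠ v} → V))).card = (ES M).card := by
      have := SimpleGraph.card_edgeFinset_induce_of_support_subset (G := M) (s := {x | x ≠ v}) (by
        intro x hx hxv
        rw [SimpleGraph.mem_support] at hx
        obtain ⟨w, hw⟩ := hx
        subst hxv
        exact hMv w hw)
      rw [ES_card_eq, ES_card_eq, ← this]
      rfl
    omega
  -- degree
  have hdeg : ∃ v, (NB G v).card ≤ 5 := by
    by_contra hcon
    push Not at hcon
    have := G.sum_degrees_eq_twice_card_edges
    rw [← ES_card_eq, hcard] at this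
    have h2 : ∑ v : V, 6 ≤ ∑ v, G.degree v := Finset.sum_le_sum (fun v _ => by
      rw [← NB_card_eq]; exact hcon v)
    simp [hm] at h2
    omega
  obtain ⟨v, hv⟩ := hdeg
  have hdel : (ES (G.deleteIncidenceSet v)).card = (ES G).card - (NB G v).card := by
    rw [NB_card_eq, ES_card_eq, ES_card_eq, G.card_edgeFinset_deleteIncidenceSet]
  have hdv : ∀ w, ¬ (G.deleteIncidenceSet v).Adj v w := by
    intro w h
    rw [SimpleGraph.deleteIncidenceSet_adj] at h
    exact h.2.1 rfl
  have hgt3 : 4 ≤ (NB G v).card := by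
    by_contra h
    have := step v _ hdv ((hG.mono (G.deleteIncidenceSet_le v)).induce _ Subtype.val_injective)
    omega
  -- contraction
  have hcom : ∀ u ∈ NB G v, 3 ≤ (NB G v ∩ NB G u).card := by
    intro u hu
    rw [mem_NB] at hu
    by_contra hlt
    let T : Finset V := (NB G v).erase u \ NB G u
    have hTc : T.card + 1 + (NB G v ∩ NB G u).card = (NB G v).card := by
      have h1 := Finset.card_sdiff_add_card_inter ((NB G v).erase u) (NB G u)
      have h2 : (NB G v).erase u ∩ NB G u = NB G v ∩ NB G u := by
        ext x
        simp only [mem_inter, mem_erase, mem_NB]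
        constructor
        · tauto
        · rintro ⟨h, h'⟩; exact ⟨⟨h'.ne', h⟩, h'⟩
      rw [h2, Finset.card_erase_of_mem (by simpa using hu)] at h1
      have : 0 < (NB G v).card := by omega
      simp only [T]
      omega
    let M : SimpleGraph V := G.deleteIncidenceSet v ⊔ SimpleGraph.fromEdgeSet
      ((T.image (fun y => s(u, y)) : Finset (Sym2 V)) : Set (Sym2 V))
    have hMadj : ∀ a b, M.Adj a b ↔ (G.Adj a b ∧ a ≠ v ∧ b ≠ v) ∨
        (a = u ∧ b ∈ T) ∨ (b = u ∧ a ∈ T) := by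
      intro a b
      simp only [M, SimpleGraph.sup_adj, SimpleGraph.deleteIncidenceSet_adj,
        SimpleGraph.fromEdgeSet_adj, Finset.coe_image, Set.mem_image, Finset.mem_coe, Sym2.eq_iff]
      have huT : u ∉ T := by simp [T]
      constructor
      · rintro (h | ⟨⟨y, hy, ⟨rfl, rfl⟩ | ⟨rfl, rfl⟩⟩, h⟩)
        · exact Or.inl h
        · exact Or.inr (Or.inl ⟨rfl, hy⟩)
        · exact Or.inr (Or.inr ⟨rfl, hy⟩)
      · rintro (h | ⟨rfl, h⟩ | ⟨rfl, h⟩)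
        · exact Or.inl h
        · exact Or.inr ⟨⟨b, h, by simp⟩, fun h' => huT (h' ▸ h)⟩
        · exact Or.inr ⟨⟨a, h, by simp⟩, fun h' => huT (h' ▸ h)⟩
    have hTv : ∀ y ∈ T, G.Adj v y ∧ ¬ G.Adj u y ∧ y ≠ u := by
      intro y hy
      simp only [T, mem_sdiff, mem_erase, mem_NB] at hy
      tauto
    have hMc : (ES G).card - (NB G v).card + T.card ≤ (ES M).card := by
      rw [← hdel, ← Finset.card_image_of_injective T (f := fun y => s(u, y))
        (fun a b h => Sym2.congr_right.1 h), ← Finset.card_union_of_disjoint]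
      · apply Finset.card_le_card
        intro e he
        rw [mem_ES]
        induction e with | _ a b =>
        rw [SimpleGraph.mem_edgeSet, hMadj]
        rw [mem_union, mem_ES, SimpleGraph.mem_edgeSet, SimpleGraph.deleteIncidenceSet_adj] at he
        rcases he with he | he
        · exact Or.inl he
        · rw [mem_image] at he
          obtain ⟨y, hy, h⟩ := he
          rcases Sym2.eq_iff.1 h with ⟨rfl, rfl⟩ | ⟨rfl, rfl⟩
          · exact Or.inr (Or.inl ⟨rfl, hy⟩)
          · exact Or.inr (Or.inr ⟨rfl, hy⟩)
      · rw [Finset.disjoint_left]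
        intro e he he'
        rw [mem_image] at he'
        obtain ⟨y, hy, rfl⟩ := he'
        rw [mem_ES, SimpleGraph.mem_edgeSet, SimpleGraph.deleteIncidenceSet_adj] at he
        exact (hTv y hy).2.1 he.1
    have := step v M (by
      intro w hw
      rw [hMadj] at hw
      rcases hw with h | ⟨h, h'⟩ | ⟨h, h'⟩
      · exact h.2.1 rfl
      · exact hu.ne h
      · exact (hTv _ h').1.ne rfl) (by
      refine hG.of_minor _ (fun w => if (w : V) = u then {v, u} else {(w : V)}) ?_ ?_ ?_
      · intro w
        split_ifs
        · exact Conn.pair hu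
        · exact Conn.singleton _
      · rintro ⟨w, hw⟩ ⟨w', hw'⟩ hww
        have hww : w ≠ w' := by simpa using hww
        simp only
        split_ifs with h1 h2 h2
        · exact absurd (h1.trans h2.symm) hww
        · simp [hw'.symm, h2]; tauto
        · simp [hw, h1]
        · simpa using hww
      · rintro ⟨w, hw⟩ ⟨w', hw'⟩ hww
        rw [SimpleGraph.comap_adj, hMadj] at hww
        simp only at hww
        have hmem : ∀ z : V, z ∈ (if z = u then {v, u} else {z} : Set V) := by
          intro z; split_ifs with h <;> simp [h]
        rcases hww with h | ⟨h, h'⟩ | ⟨h, h'⟩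
        · exact ⟨w, hmem w, w', hmem w', h.1⟩
        · refine ⟨v, ?_, w', hmem w', (hTv _ h').1⟩
          simp [h]
        · refine ⟨w, hmem w, v, ?_, (hTv _ h').1.symm⟩
          simp [h])
    omega
  -- now degree 4 or 5
  have hclique := hG.cliqueFree
  have hcap : ∀ u ∈ NB G v, NB G v ∩ NB G u ⊆ (NB G v).erase u := by
    intro u hu x hx
    simp only [mem_inter, mem_NB, mem_erase] at hx ⊢
    exact ⟨hx.2.ne', hx.1⟩
  by_cases h5 : (NB G v).card = 4
  · apply hclique (insert v (NB G v))
    rw [SimpleGraph.isNClique_iff]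
    refine ⟨?_, by rw [card_insert_of_notMem (by simp), h5]⟩
    rw [coe_insert, SimpleGraph.isClique_insert]
    refine ⟨?_, fun b hb _ => by simpa using hb⟩
    intro a ha b hb hab
    have ha' : a ∈ NB G v := ha
    have h1 : NB G v ∩ NB G a = (NB G v).erase a := Finset.eq_of_subset_of_card_le (hcap a ha')
      (by rw [card_erase_of_mem ha', h5]; exact hcom a ha')
    have : b ∈ NB G v ∩ NB G a := by
      rw [h1, mem_erase]; exact ⟨hab.symm, hb⟩
    simp only [mem_inter, mem_NB] at this
    exact this.2
  · have h5 : (NB G v).card = 5 := by omega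
    -- at most one non-neighbour in N
    have hone : ∀ a ∈ NB G v, ∀ b ∈ NB G v, ∀ c ∈ NB G v, b ≠ a → c ≠ a → b ≠ c →
        G.Adj a b ∨ G.Adj a c := by
      intro a ha b hb c hc hba hca hbc
      by_contra hcon
      push Not at hcon
      have : NB G v ∩ NB G a ⊆ (((NB G v).erase a).erase b).erase c := by
        intro x hx
        have h1 := hcap a ha hx
        simp only [mem_inter, mem_NB, mem_erase] at hx h1 ⊢
        refine ⟨?_, ?_, h1.1, hx.1⟩
        · rintro rfl; exact hcon.2 hx.2
        · rintro rfl; exact hcon.1 hx.2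
      have h1 := Finset.card_le_card this
      rw [card_erase_of_mem (by simpa [hca, hbc.symm] using hc), card_erase_of_mem (by simp [hba]; simpa using hb),
        card_erase_of_mem ha, h5] at h1
      have := hcom a ha
      omega
    by_cases hall : ∀ a ∈ NB G v, ∀ b ∈ NB G v, a ≠ b → G.Adj a b
    · exact hclique (NB G v) ((SimpleGraph.isNClique_iff G).2 ⟨fun a ha b hb => hall a ha b hb, h5⟩)
    push Not at hall
    obtain ⟨p, hp, q, hq, hpq, hnpq⟩ := hall
    have hc3 : (((NB G v).erase p).erase q).card = 3 := by
      rw [card_erase_of_mem (by simp [hpq.symm]; simpa using hq), card_erase_of_mem hp, h5]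
    obtain ⟨x, y, z, hxy, hxz, hyz, hxyz⟩ := Finset.card_eq_three.1 hc3
    have key : ∀ x y z, x ∈ ((NB G v).erase p).erase q → y ∈ ((NB G v).erase p).erase q →
        z ∈ ((NB G v).erase p).erase q → y ≠ z → G.Adj x y → G.Adj x z → False := by
      intro x y z hx hy hz hyz hxy hxz
      simp only [mem_erase] at hx hy hz
      have P : ∀ w, w ∈ NB G v → w ≠ p → w ≠ q → G.Adj p w ∧ G.Adj q w := by
        intro w hw hwp hwq
        refine ⟨?_, ?_⟩
        · exact (hone p hp q hq w hw hpq.symm hwp (Ne.symm hwq)).resolve_left hnpq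
        · exact (hone q hq p hp w hw hpq hwq (Ne.symm hwp)).resolve_left (fun h => hnpq h.symm)
      have px := P x hx.2.2 hx.2.1 hx.1
      have py := P y hy.2.2 hy.2.1 hy.1
      have pz := P z hz.2.2 hz.2.1 hz.1
      rw [mem_NB] at hp hq hx hy hz
      refine hG.noK5 (a := v) (b := q) (c := z) (d := x) (Z := {p, y}) (Conn.pair py.1)
        ?_ ?_ ?_ ?_ hq hz.2.2 hx.2.2 pz.2 px.2 hxz.symm ⟨p, by simp, hp⟩ ⟨y, by simp, py.2⟩
        ⟨p, by simp, pz.1.symm⟩ ⟨p, by simp, px.1.symm⟩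
      · simp [hp.ne, hy.2.2.ne]
      · simp [hpq.symm, hy.1.symm]
      · simp [hz.2.1, hyz.symm]
      · simp [hx.2.1, hxy.ne]
    have hx : x ∈ ((NB G v).erase p).erase q := by rw [hxyz]; simp
    have hy : y ∈ ((NB G v).erase p).erase q := by rw [hxyz]; simp
    have hz : z ∈ ((NB G v).erase p).erase q := by rw [hxyz]; simp
    have hx' := mem_of_mem_erase (mem_of_mem_erase hx)
    have hy' := mem_of_mem_erase (mem_of_mem_erase hy)
    have hz' := mem_of_mem_erase (mem_of_mem_erase hz)
    have o1 := hone x hx' y hy' z hz' hxy.symm hxz.symm hyz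
    have o2 := hone y hy' x hx' z hz' hxy hyz.symm hxz
    have o3 := hone z hz' x hx' y hy' hxz hyz hxy
    by_cases c1 : G.Adj x y
    · by_cases c2 : G.Adj x z
      · exact key x y z hx hy hz hyz c1 c2
      · exact key y x z hy hx hz hxz c1.symm (o3.resolve_left (fun h => c2 h.symm)).symm
    · exact key z x y hz hx hy hxy (o1.resolve_left c1).symm (o2.resolve_left (fun h => c1 h.symm)).symm

theorem mader_in {V : Type} [Fintype V] [DecidableEq V] {G : SimpleGraph V} (hG : VK G) (X : Finset V)
    (h3 : 3 ≤ X.card) : (EIn G X).card ≤ 3 * X.card - 6 := by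
  rw [← ES_induce_card]
  exact mader X.card _ _ (hG.induce _ Subtype.val_injective) (by simp) h3

end Mader

set_option linter.unusedSectionVars false

section Conn3
open Finset
variable {V : Type} [Fintype V] [DecidableEq V] {G : SimpleGraph V}

lemma EIn_mono {X Y : Finset V} (h : X ⊆ Y) : EIn G X ⊆ EIn G Y := by
  intro e he
  rw [mem_EIn] at *
  exact ⟨he.1, fun v hv => h (he.2 v hv)⟩

lemma EIn_mono_left {H : SimpleGraph V} (h : H ≤ G) {X : Finset V} : EIn H X ⊆ EIn G X := by
  intro e he
  rw [mem_EIn] at *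
  exact ⟨SimpleGraph.edgeSet_mono h he.1, he.2⟩

lemma EIn_sub_choose (X : Finset V) : (EIn G X).card ≤ X.card.choose 2 := by
  classical
  have := (G.induce (X : Set V)).card_edgeFinset_le_card_choose_two
  rw [← ES_induce_card, ES_card_eq]
  simpa using this

lemma EIn_card_one {X : Finset V} (h : X.card ≤ 1) : (EIn G X).card = 0 := by
  have := EIn_sub_choose (G := G) X
  have h' : X.card = 0 ∨ X.card = 1 := by omega
  rcases h' with h | h <;> rw [h] at this <;> simpa using this

lemma EIn_card_le5 (hG : VK G) {X : Finset V} (h : 2 ≤ X.card) :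
    (EIn G X).card + 5 ≤ 3 * X.card := by
  rcases h.lt_or_eq with h | h
  · have := mader_in hG X h
    omega
  · have := EIn_sub_choose (G := G) X
    rw [← h] at this ⊢
    have h2 : Nat.choose 2 2 = 1 := rfl
    omega

lemma EIn_card_le3 (hG : VK G) {X : Finset V} (h : 1 ≤ X.card) :
    (EIn G X).card + 3 ≤ 3 * X.card := by
  rcases h.lt_or_eq with h | h
  · have := EIn_card_le5 hG h
    omega
  · have := EIn_card_one (G := G) h.symm.le
    omega

lemma EIn_univ : EIn G univ = ES G := by
  ext e; simp [mem_EIn]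

/-- a partition with no crossing edges across a two element set -/
lemma no_two_cut (hG : VK G) (hE : (ES G).card = 3 * Fintype.card V - 6) {x y : V} (hxy : x ≠ y)
    {A B : Finset V} (hA : A.Nonempty) (hB : B.Nonempty) (dAB : Disjoint A B)
    (hxA : x ∉ A) (hxB : x ∉ B) (hyA : y ∉ A) (hyB : y ∉ B)
    (hun : ∀ v, v = x ∨ v = y ∨ v ∈ A ∨ v ∈ B)
    (hno : ∀ a ∈ A, ∀ b ∈ B, ¬ G.Adj a b) : False := by
  classical
  have cA : (insert x (insert y A)).card = A.card + 2 := by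
    rw [card_insert_of_notMem (by simp [hxy, hxA]), card_insert_of_notMem hyA]
  have cB : (insert x (insert y B)).card = B.card + 2 := by
    rw [card_insert_of_notMem (by simp [hxy, hxB]), card_insert_of_notMem hyB]
  have a1 := hA.card_pos
  have b1 := hB.card_pos
  have mA := mader_in hG (insert x (insert y A)) (by omega)
  have mB := mader_in hG (insert x (insert y B)) (by omega)
  have cV : Fintype.card V = A.card + B.card + 2 := by
    have : (univ : Finset V) = insert x (insert y (A ∪ B)) := by
      ext v; simpa using hun v
    rw [← card_univ, this, card_insert_of_notMem (by simp [hxy, hxA, hxB]),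
      card_insert_of_notMem (by simp [hyA, hyB]), card_union_of_disjoint dAB]
  have hsub : ES G ⊆ EIn G (insert x (insert y A)) ∪ EIn G (insert x (insert y B)) := by
    intro e
    induction e with | _ u v
    intro he
    simp only [mem_ES, SimpleGraph.mem_edgeSet] at he
    simp only [mem_union, mk_mem_EIn, mem_insert]
    have h1 := hno u
    have h2 := hno v
    have h3 := hun u
    have h4 := hun v
    have h5 := he.symm
    grind
  have hle := card_le_card hsub
  have hui := card_union_add_card_inter (EIn G (insert x (insert y A))) (EIn G (insert x (insert y B)))
  have hnxy : ¬ G.Adj x y := by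
    intro h
    have : s(x, y) ∈ EIn G (insert x (insert y A)) ∩ EIn G (insert x (insert y B)) := by
      simp [h]
    have := card_pos.2 ⟨_, this⟩
    omega
  have eA : (EIn G (insert x (insert y A))).card = 3 * A.card := by omega
  have eB : (EIn G (insert x (insert y B))).card = 3 * B.card := by omega
  by_cases hK : ∃ b, (∃ u, G.Adj x u ∧ Reach G B b u) ∧ (∃ u, G.Adj y u ∧ Reach G B b u)
  · obtain ⟨b, ⟨u, hu, hbu⟩, w, hw, hbw⟩ := hK
    have hbB : b ∈ (B : Set V) := hbu.mem_left
    set K : Set V := {v | Reach G B b v} with hKdef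
    have KB : K ⊆ (B : Set V) := fun v hv => Reach.mem_right hv
    let X : Finset V := insert x (insert y A)
    let M : SimpleGraph V := G ⊔ SimpleGraph.edge x y
    have hM : VK (M.induce (X : Set V)) := by
      refine hG.of_minor _ (fun v => if v.1 = x then insert x K else {v.1}) ?_ ?_ ?_
      · intro v
        by_cases hv : v.1 = x
        · simp only [hv, if_true]
          have := (Conn.singleton (G := G) x).union (Conn.comp (G := G) hbB) (x := x) (y := u) rfl hbu hu
          rw [Set.insert_eq]; exact this
        · simp only [hv, if_false]
          exact Conn.singleton _
      · have key : ∀ v ∈ X, v ∉ K := by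
          intro v hv hvK
          have := KB hvK
          simp only [X, mem_insert] at hv
          rcases hv with rfl | rfl | hv
          · exact hxB this
          · exact hyB this
          · exact (disjoint_left.1 dAB hv this)
        rintro ⟨v, hv⟩ ⟨w, hw⟩ hvw
        have hv' := key v hv
        have hw' := key w hw
        simp only [ne_eq, Subtype.mk.injEq] at hvw
        by_cases h1 : v = x <;> by_cases h2 : w = x <;> simp [h1, h2] <;> grind
      · rintro ⟨v, hv⟩ ⟨w', hw'⟩ hvw
        simp only [SimpleGraph.induce_adj, M, SimpleGraph.sup_adj, SimpleGraph.edge_adj] at hvw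
        have mem : ∀ v, v ∈ (if v = x then insert x K else {v} : Set V) := by
          intro v; by_cases h : v = x <;> simp [h]
        rcases hvw with h | ⟨⟨rfl, rfl⟩ | ⟨rfl, rfl⟩, -⟩
        · exact ⟨v, mem v, w', mem w', h⟩
        · exact ⟨w, by simp [hbw, K], w', by simp [hxy.symm], hw.symm⟩
        · exact ⟨v, by simp [hxy.symm], w, by simp [hbw, K], hw⟩
    have := mader X.card _ _ hM (by simp) (by simp only [X]; omega)
    rw [ES_induce_card] at this
    have hlt : EIn G X ⊂ EIn M X := by
      refine Finset.ssubset_iff_subset_ne.2 ⟨EIn_mono_left le_sup_left, fun h => ?_⟩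
      have : s(x, y) ∈ EIn M X := by simp [M, SimpleGraph.edge_adj, hxy, X]
      rw [← h] at this
      simp [hnxy] at this
    have := card_lt_card hlt
    have : X.card = A.card + 2 := cA
    have : (EIn G X).card = 3 * A.card := eA
    omega
  · push Not at hK
    obtain ⟨R, hR⟩ : ∃ R : V → Prop, ∀ b, R b ↔ ∃ u, G.Adj x u ∧ Reach G B b u := ⟨_, fun b => Iff.rfl⟩
    let Bx := B.filter (fun b => R b)
    let By := B.filter (fun b => ¬ R b)
    have hsubB : EIn G (insert x (insert y B)) ⊆ EIn G (insert x Bx) ∪ EIn G (insert y By) := by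
      intro e
      induction e with | _ u v
      have h2 : ∀ u v, G.Adj u v → u ∈ B → v ∈ B → R u → R v := by
        intro u v huv hu hv h
        obtain ⟨w, hw, hr⟩ := (hR _).1 h
        exact (hR _).2 ⟨w, hw, (Reach.of_adj hv hu huv.symm).trans hr⟩
      have h3 : ∀ v, G.Adj x v → v ∈ B → R v := by
        intro v hv hvB
        exact (hR _).2 ⟨v, hv, Reach.refl hvB⟩
      have h4 : ∀ v, G.Adj y v → v ∈ B → ¬ R v := by
        intro v hv hvB h
        exact hK v ((hR _).1 h) v hv (Reach.refl hvB)
      simp only [mem_union, mk_mem_EIn, mem_insert, Bx, By, mem_filter]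
      rintro ⟨h, hu, hv⟩
      have h5 := h.symm
      have h6 := h2 u v h
      have h7 := h2 v u h5
      have h8 := h3 u
      have h9 := h3 v
      have h10 := h4 u
      have h11 := h4 v
      have : ¬ G.Adj y x := fun h => hnxy h.symm
      have : ¬ G.Adj x x := G.irrefl
      have : ¬ G.Adj y y := G.irrefl
      clear h2 h3 h4 hR hK
      grind
    have hle := card_le_card hsubB
    have hle2 := card_union_le (EIn G (insert x Bx)) (EIn G (insert y By))
    have hsum : Bx.card + By.card = B.card := card_filter_add_card_filter_not _
    have f : ∀ (z : V) (T : Finset V), T ⊆ B → z ∉ B → (EIn G (insert z T)).card + (if T.card = 0 then 0 else 2) ≤ 3 * T.card := by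
      intro z T hT hz
      have c : (insert z T).card = T.card + 1 := card_insert_of_notMem (fun h => hz (hT h))
      split_ifs with h
      · have := EIn_card_one (G := G) (X := insert z T) (by omega)
        omega
      · have := EIn_card_le5 hG (X := insert z T) (by omega)
        omega
    have f1 := f x Bx (filter_subset _ _) hxB
    have f2 := f y By (filter_subset _ _) hyB
    split_ifs at f1 f2 <;> omega

lemma conn2 (hG : VK G) (hE : (ES G).card = 3 * Fintype.card V - 6) {x y : V} (hxy : x ≠ y)
    {p q : V} (hp : p ≠ x ∧ p ≠ y) (hq : q ≠ x ∧ q ≠ y) : Reach G {x, y}ᶜ p q := by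
  classical
  by_contra hcon
  have hp' : p ∈ ({x, y}ᶜ : Set V) := by simp [hp]
  have hq' : q ∈ ({x, y}ᶜ : Set V) := by simp [hq]
  refine no_two_cut hG hE hxy (A := univ.filter (fun v => Reach G {x, y}ᶜ p v))
    (B := univ.filter (fun v => v ≠ x ∧ v ≠ y ∧ ¬ Reach G {x, y}ᶜ p v))
    ⟨p, by simpa using Reach.refl hp'⟩ ⟨q, by simp [hq, hcon]⟩ ?_ ?_ ?_ ?_ ?_ ?_ ?_
  · rw [disjoint_left]; intro a; simp; tauto
  · simp; intro h; simpa using h.mem_right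
  · simp
  · simp; intro h; simpa using h.mem_right
  · simp
  · intro v; simp; tauto
  · intro a ha b hb hab
    simp at ha hb
    exact hb.2.2 (comp_closed ha (by simp [hb]) hab)

/-- if `G - S` (`|S| = 3`) is disconnected, then each component touches all of `S` -/
lemma comp_touch (hG : VK G) (hE : (ES G).card = 3 * Fintype.card V - 6) {x y z : V}
    (hxy : x ≠ y) (hxz : x ≠ z) (hyz : y ≠ z) {p q : V} (hp : p ∈ ({x, y, z}ᶜ : Set V))
    (hq : q ∈ ({x, y, z}ᶜ : Set V)) (hpq : ¬ Reach G {x, y, z}ᶜ p q) :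
    ∃ o, Reach G {x, y, z}ᶜ p o ∧ G.Adj z o := by
  by_contra hcon
  push Not at hcon
  simp at hp hq
  have h := conn2 hG hE hxy (p := p) (q := q) ⟨by tauto, by tauto⟩ ⟨by tauto, by tauto⟩
  apply hpq
  refine h.closed (fun v => Reach G {x, y, z}ᶜ p v) ?_ (Reach.refl (by simp [hp]))
  intro a b ha hb hab h
  by_cases hbz : b = z
  · subst hbz
    exact absurd hab.symm (hcon a h)
  · exact comp_closed h (by simp at hb ⊢; tauto) hab

lemma comp_touch' (hG : VK G) (hE : (ES G).card = 3 * Fintype.card V - 6) {S : Finset V}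
    (hS : S.card = 3) {p q : V} (hp : p ∉ S) (hq : q ∉ S) (hpq : ¬ Reach G (↑S)ᶜ p q)
    {w : V} (hw : w ∈ S) : ∃ o ∈ {v | Reach G (↑S)ᶜ p v}, G.Adj w o := by
  obtain ⟨x, y, hxy, h⟩ := Finset.card_eq_two.1 (show (S.erase w).card = 2 by
    rw [card_erase_of_mem hw, hS])
  have hx : x ∈ S.erase w := by rw [h]; simp
  have hy : y ∈ S.erase w := by rw [h]; simp
  have e : (S : Set V) = {x, y, w} := by
    ext v
    have := Finset.ext_iff.1 h v
    simp only [mem_erase, mem_insert, mem_singleton] at this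
    simp only [mem_coe, Set.mem_insert_iff, Set.mem_singleton_iff]
    by_cases hv : v = w
    · simp [hv, hw]
    · tauto
  rw [mem_erase] at hx hy
  have hp' : p ∈ (S : Set V)ᶜ := by simpa using hp
  have hq' : q ∈ (S : Set V)ᶜ := by simpa using hq
  rw [e] at hp' hq' hpq ⊢
  exact comp_touch hG hE hxy hx.1 hy.1 hp' hq' hpq

/-- `G - S` has at most two components -/
lemma three_comps (hG : VK G) (hE : (ES G).card = 3 * Fintype.card V - 6) {S : Finset V}
    (hS : S.card = 3) {p q r : V} (hp : p ∉ S) (hq : q ∉ S) (hr : r ∉ S)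
    (hpq : ¬ Reach G (↑S)ᶜ p q) (hpr : ¬ Reach G (↑S)ᶜ p r)
    (hqr : ¬ Reach G (↑S)ᶜ q r) : False := by
  have N : ∀ {p w}, w ∈ S → w ∉ {v | Reach G (↑S)ᶜ p v} :=
    fun hw h => (Reach.mem_right h) hw
  have D : ∀ {p q}, ¬ Reach G (↑S)ᶜ p q →
      Disjoint {v | Reach G (↑S)ᶜ p v} {v | Reach G (↑S)ᶜ q v} := by
    intro p q h
    rw [Set.disjoint_left]
    intro a h1 h2
    exact h (Reach.trans h1 (Reach.symm h2))
  have hqp : ¬ Reach G (↑S)ᶜ q p := fun h => hpq h.symm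
  have hrp : ¬ Reach G (↑S)ᶜ r p := fun h => hpr h.symm
  have T := @comp_touch' V _ _ G hG hE S hS
  obtain ⟨x, y, z, hxy, hxz, hyz, h⟩ := Finset.card_eq_three.1 hS
  have mx : x ∈ S := by simp [h]
  have my : y ∈ S := by simp [h]
  have mz : z ∈ S := by simp [h]
  exact hG.noK33_three hxy hxz hyz (Conn.comp (by simpa using hp)) (Conn.comp (by simpa using hq))
    (Conn.comp (by simpa using hr))
    (N mx) (N mx) (N mx) (N my) (N my) (N my) (N mz) (N mz) (N mz) (D hpq) (D hpr) (D hqr)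
    (T hp hq hpq mx) (T hq hp hqp mx) (T hr hp hrp mx)
    (T hp hq hpq my) (T hq hp hqp my) (T hr hp hrp my)
    (T hp hq hpq mz) (T hq hp hqp mz) (T hr hp hrp mz)
end Conn3

set_option linter.unusedSectionVars false

section TB
open Finset
variable {V : Type} [Fintype V] [DecidableEq V] 

/-- a matching with five edges -/
def M5 (H : SimpleGraph V) : Prop :=
  ∃ (A : Finset V) (f : V → V), A.card = 5 ∧ (∀ a ∈ A, H.Adj a (f a)) ∧ (∀ a ∈ A, f a ∉ A) ∧
    Set.InjOn f A

lemma M5_of_perfect {H : SimpleGraph V} {r : ℕ} (hr : r + 10 ≤ Fintype.card V)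
    (f : V ⊕ Fin r → V ⊕ Fin r) (hf : ∀ v, f (f v) = v)
    (hadj : ∀ v w, f (Sum.inl v) = Sum.inl w → H.Adj v w) : M5 H := by
  classical
  let e := Fintype.equivFin V
  have hinj : Function.Injective f := fun a b h => by rw [← hf a, h, hf b]
  let g : V → V := fun v => (f (Sum.inl v)).elim id (fun _ => v)
  let W : Finset V := univ.filter (fun v => ∃ w, f (Sum.inl v) = Sum.inl w)
  have hg : ∀ v ∈ W, f (Sum.inl v) = Sum.inl (g v) := by
    intro v hv
    simp only [W, mem_filter, mem_univ, true_and] at hv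
    obtain ⟨w, hw⟩ := hv
    simp [g, hw]
  have hgW : ∀ v ∈ W, g v ∈ W := by
    intro v hv
    have := hg v hv
    simp only [W, mem_filter, mem_univ, true_and]
    exact ⟨v, by rw [← this, hf]⟩
  have hgg : ∀ v ∈ W, g (g v) = v := by
    intro v hv
    have h1 := hg _ (hgW v hv)
    rw [← hg v hv, hf] at h1
    simpa using h1.symm
  have hne : ∀ v ∈ W, g v ≠ v := fun v hv h => (hadj v (g v) (hg v hv)).ne h.symm
  have hWc : (univ.filter (fun v : V => ¬ ∃ w, f (Sum.inl v) = Sum.inl w)).card ≤ r := by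
    have : (univ.filter (fun v : V => ¬ ∃ w, f (Sum.inl v) = Sum.inl w)).card ≤
        ((univ : Finset (Fin r)).image (Sum.inr : Fin r → V ⊕ Fin r)).card := by
      refine card_le_card_of_injOn (fun v => f (Sum.inl v)) ?_ ?_
      · intro v hv
        simp only [coe_filter, mem_univ, true_and, Set.mem_ofPred_eq] at hv
        cases h : f (Sum.inl v) with
        | inl w => exact absurd ⟨w, h⟩ hv
        | inr i => simp [h]
      · intro a _ b _ h
        simpa using hinj h
    exact this.trans (card_image_le.trans (by simp))
  have hW : 10 ≤ W.card := by
    have : W.card + _ = _ := card_filter_add_card_filter_not (s := (univ : Finset V)) (fun v : V => ∃ w, f (Sum.inl v) = Sum.inl w)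
    rw [card_univ] at this
    omega
  let A0 := W.filter (fun v => e v < e (g v))
  let A1 := W.filter (fun v => ¬ e v < e (g v))
  have h01 : A0.card + A1.card = W.card := card_filter_add_card_filter_not _
  have hle : A1.card ≤ A0.card := by
    refine card_le_card_of_injOn g ?_ ?_
    · intro v hv
      simp only [A1, A0, coe_filter, mem_filter, Set.mem_ofPred_eq] at hv ⊢
      refine ⟨hgW v hv.1, ?_⟩
      rw [hgg v hv.1]
      exact lt_of_le_of_ne (not_lt.1 hv.2) (fun h => hne v hv.1 (e.injective h))
    · intro a ha b hb h
      simp only [A1, coe_filter, Set.mem_ofPred_eq] at ha hb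
      rw [← hgg a ha.1, h, hgg b hb.1]
  obtain ⟨A, hA, hA5⟩ := exists_subset_card_eq (show 5 ≤ A0.card by omega)
  refine ⟨A, g, hA5, ?_, ?_, ?_⟩
  · intro a ha
    exact hadj _ _ (hg a (mem_filter.1 (hA ha)).1)
  · intro a ha h
    have h1 := mem_filter.1 (hA ha)
    have h2 := (mem_filter.1 (hA h)).2
    rw [hgg a h1.1] at h2
    exact lt_asymm h1.2 h2
  · intro a ha b hb h
    rw [← hgg a (mem_filter.1 (hA ha)).1, h, hgg b (mem_filter.1 (hA hb)).1]

theorem tutteBerge {H : SimpleGraph V} (hn : 11 ≤ Fintype.card V) (hM : ¬ M5 H) :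
    ∃ (S : Finset V) (β : Type) (_ : DecidableEq β) (L : V → β),
      (∀ u v, u ∉ S → v ∉ S → H.Adj u v → L u = L v) ∧
      Fintype.card V + S.card ≤ 8 +
        ((Sᶜ.image L).filter (fun l => Odd (Sᶜ.filter (fun v => L v = l)).card)).card := by
  classical
  obtain ⟨r, hr⟩ : ∃ r, Fintype.card V = r + 10 := ⟨Fintype.card V - 10, by omega⟩
  let J : SimpleGraph (V ⊕ Fin r) := SimpleGraph.fromRel (fun a b => ∀ u v, a = Sum.inl u → b = Sum.inl v → H.Adj u v)
  have hJ1 : ∀ u v, J.Adj (Sum.inl u) (Sum.inl v) ↔ H.Adj u v := by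
    intro u v
    simp only [J, SimpleGraph.fromRel_adj]
    constructor
    · rintro ⟨-, h | h⟩
      · exact h u v rfl rfl
      · exact (h v u rfl rfl).symm
    · intro h
      refine ⟨by simpa using h.ne, Or.inl ?_⟩
      rintro u' v' h1 h2
      simp at h1 h2
      subst h1 h2
      exact h
  have hJ2 : ∀ i b, b ≠ Sum.inr i → J.Adj (Sum.inr i) b := by
    intro i b hb
    simp [J, SimpleGraph.fromRel_adj, hb.symm]
  have hnoP : ¬ ∃ M : J.Subgraph, M.IsPerfectMatching := by
    rintro ⟨M, hM'⟩
    rw [SimpleGraph.Subgraph.isPerfectMatching_iff] at hM'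
    choose f hf hfu using hM'
    refine hM (M5_of_perfect (r := r) (by omega) f ?_ ?_)
    · intro v
      exact (hfu (f v) v (hf v).symm).symm
    · intro v w h
      have := (hf (Sum.inl v)).adj_sub
      rw [h] at this
      exact (hJ1 _ _).1 this
  rw [SimpleGraph.tutte] at hnoP
  push Not at hnoP
  obtain ⟨u, hu⟩ := hnoP
  rw [SimpleGraph.IsTutteViolator] at hu
  set K := ((⊤ : J.Subgraph).deleteVerts u).coe with hK
  have hvert : ∀ x : V ⊕ Fin r, x ∈ ((⊤ : J.Subgraph).deleteVerts u).verts ↔ x ∉ u := by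
    intro x; simp
  have hKadj : ∀ x y (hx : x ∉ u) (hy : y ∉ u), J.Adj x y → K.Adj ⟨x, (hvert x).2 hx⟩ ⟨y, (hvert y).2 hy⟩ := by
    intro x y hx hy h
    simp [hK, hx, hy, h]
  have hodd := SimpleGraph.odd_ncard_oddComponents K
  have hcard : Nat.card ((⊤ : J.Subgraph).deleteVerts u).verts + u.ncard = 2 * r + 10 := by
    have h1 : Nat.card ((⊤ : J.Subgraph).deleteVerts u).verts = (uᶜ).ncard := by
      rw [← Nat.card_coe_set_eq]
      congr! 2
      simp [Set.compl_eq_univ_diff]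
    rw [h1, add_comm, Set.ncard_add_ncard_compl]
    simp [hr]; ring
  by_cases hall : ∀ i, Sum.inr i ∈ u
  · let S : Finset V := univ.filter (fun v => Sum.inl v ∈ u)
    have hS : ∀ v, v ∈ S ↔ Sum.inl v ∈ u := by simp [S]
    have hucard : u.ncard = S.card + r := by
      have : u = ((S.disjSum (univ : Finset (Fin r)) : Finset (V ⊕ Fin r)) : Set (V ⊕ Fin r)) := by
        ext x
        cases x with
        | inl v => simp [hS]
        | inr i => simp [hall]
      rw [this, Set.ncard_coe_finset, card_disjSum]
      simp
    let L : V → Option K.ConnectedComponent := fun v =>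
      if h : Sum.inl v ∈ u then none else some (K.connectedComponentMk ⟨Sum.inl v, (hvert _).2 h⟩)
    refine ⟨S, _, inferInstance, L, ?_, ?_⟩
    · intro a b ha hb hab
      rw [hS] at ha hb
      simp only [L, ha, hb, dif_neg, not_false_eq_true, Option.some.injEq, SimpleGraph.ConnectedComponent.eq]
      exact (hKadj _ _ ha hb ((hJ1 _ _).2 hab)).reachable
    · have hle : K.oddComponents.ncard ≤ ((Sᶜ.image L).filter (fun l => Odd (Sᶜ.filter (fun v => L v = l)).card)).card := by
        rw [← Set.ncard_coe_finset]
        refine Set.ncard_le_ncard_of_injOn some ?_ (fun a _ b _ h => by simpa using h) (Set.toFinite _)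
        intro c hc
        have hcc : Odd c.supp.ncard := hc
        have hcardc : c.supp.ncard = (Sᶜ.filter (fun v => L v = some c)).card := by
          rw [← Set.ncard_coe_finset]
          symm
          refine Set.ncard_congr (fun v hv => ⟨Sum.inl v, (hvert _).2 (by
              simpa [hS] using (mem_filter.1 hv).1)⟩) ?_ ?_ ?_
          · intro v hv
            have h1 := (mem_filter.1 hv)
            have h2 : Sum.inl v ∉ u := by simpa [hS] using h1.1
            simpa [L, h2] using h1.2
          · intro a b _ _ h
            simpa using h
          · rintro ⟨x, hx⟩ hxc
            cases x with
            | inr i => exact absurd (hall i) ((hvert _).1 hx)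
            | inl v =>
              have h2 := (hvert _).1 hx
              refine ⟨v, ?_, rfl⟩
              simp only [coe_filter, mem_compl, hS, Set.mem_ofPred_eq, h2, not_false_eq_true, true_and]
              simpa [L, h2] using hxc
        rw [hcardc] at hcc
        obtain ⟨v, hv⟩ := card_pos.1 hcc.pos
        simp only [coe_filter, Set.mem_ofPred_eq, hcc, and_true]
        exact mem_image.2 ⟨v, (mem_filter.1 hv).1, (mem_filter.1 hv).2⟩
      have h2 : u.ncard + 2 ≤ K.oddComponents.ncard := by
        by_contra hcon
        have h3 : K.oddComponents.ncard = u.ncard + 1 := by omega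
        rw [h3, Nat.odd_iff, Nat.odd_iff] at hodd
        omega
      omega
  · push Not at hall
    obtain ⟨i, hi⟩ := hall
    have hsub : K.oddComponents.ncard ≤ 1 := by
      rw [Set.ncard_le_one_iff]
      have key : ∀ c : K.ConnectedComponent, c = K.connectedComponentMk ⟨Sum.inr i, (hvert _).2 hi⟩ := by
        intro c
        induction c using SimpleGraph.ConnectedComponent.ind with | _ x
        obtain ⟨x, hx⟩ := x
        rw [SimpleGraph.ConnectedComponent.eq]
        by_cases h : x = Sum.inr i
        · subst h; rfl
        · exact (hKadj _ _ hi ((hvert _).1 hx) (hJ2 i x h)).symm.reachable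
      intro a b _ _
      rw [key a, key b]
    have h1 : K.oddComponents.ncard = 1 := by omega
    rw [h1, Nat.odd_iff, Nat.odd_iff] at hodd
    omega
end TB

set_option linter.unusedSectionVars false

section Covers
open Finset
variable {V : Type} [Fintype V] [DecidableEq V]

/-- vertex cover with two exceptional sets -/
def Cov (H : SimpleGraph V) (S X Y : Finset V) : Prop :=
  ∀ u v, H.Adj u v → u ∈ S ∨ v ∈ S ∨ (u ∈ X ∧ v ∈ X) ∨ (u ∈ Y ∧ v ∈ Y)

/-- cover by labels with deficiency at most `k` -/
def LC (H : SimpleGraph V) (S : Finset V) (k : ℕ) : Prop :=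
  ∃ (β : Type) (_ : DecidableEq β) (L : V → β),
    (∀ u v, u ∉ S → v ∉ S → H.Adj u v → L u = L v) ∧
    Fintype.card V ≤ S.card + (Sᶜ.image L).card + k

lemma Cov.toLC {H : SimpleGraph V} {S X Y : Finset V} (h : Cov H S X Y) (h1 : Disjoint S X)
    (h2 : Disjoint S Y) (h3 : Disjoint X Y) {k : ℕ} (hk : (X.card - 1) + (Y.card - 1) ≤ k) :
    LC H S k := by
  classical
  refine ⟨Bool ⊕ V, inferInstance, fun v => if v ∈ X then Sum.inl true else if v ∈ Y then Sum.inl false else Sum.inr v, ?_, ?_⟩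
  · intro u v hu hv huv
    have := h u v huv
    have a1 : u ∈ X → u ∉ Y := fun h => disjoint_left.1 h3 h
    have a2 : v ∈ X → v ∉ Y := fun h => disjoint_left.1 h3 h
    by_cases u ∈ X <;> by_cases v ∈ X <;> by_cases u ∈ Y <;> by_cases v ∈ Y <;> simp_all
  · set L : V → Bool ⊕ V := fun v => if v ∈ X then Sum.inl true else if v ∈ Y then Sum.inl false else Sum.inr v with hL
    have hsub : (univ.filter (fun b : Bool => (b = true ∧ X.Nonempty) ∨ (b = false ∧ Y.Nonempty))).disjSum
        (Sᶜ \ (X ∪ Y)) ⊆ Sᶜ.image L := by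
      intro x hx
      rcases x with b | v
      · simp only [inl_mem_disjSum, mem_filter, mem_univ, true_and] at hx
        rcases hx with ⟨rfl, v, hv⟩ | ⟨rfl, v, hv⟩
        · exact mem_image.2 ⟨v, by simpa using disjoint_right.1 h1 hv, by simp [hL, hv]⟩
        · exact mem_image.2 ⟨v, by simpa using disjoint_right.1 h2 hv, by
            simp [hL, hv, disjoint_right.1 h3 hv]⟩
      · simp only [inr_mem_disjSum, mem_sdiff, mem_union, not_or] at hx
        exact mem_image.2 ⟨v, hx.1, by simp [hL, hx.2.1, hx.2.2]⟩
    have hc := card_le_card hsub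
    rw [card_disjSum] at hc
    have e1 : (Sᶜ \ (X ∪ Y)).card + (X.card + Y.card) = Sᶜ.card := by
      rw [← card_union_of_disjoint h3]
      apply card_sdiff_add_card_eq_card
      intro v hv
      rw [mem_compl]
      intro hs
      rcases mem_union.1 hv with hv | hv
      · exact disjoint_left.1 h1 hs hv
      · exact disjoint_left.1 h2 hs hv
    have e2 : S.card + Sᶜ.card = Fintype.card V := card_add_card_compl S
    have e3 : X.card + Y.card ≤ (X.card - 1) + (Y.card - 1) +
       (univ.filter (fun b : Bool => (b = true ∧ X.Nonempty) ∨ (b = false ∧ Y.Nonempty))).card := by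
      rcases X.eq_empty_or_nonempty with rfl | hX <;> rcases Y.eq_empty_or_nonempty with rfl | hY
      · simp
      · have := hY.card_pos
        simp [hY, filter_eq']
        try omega
      · have := hX.card_pos
        simp [hX, filter_eq']
        try omega
      · have := hX.card_pos
        have := hY.card_pos
        simp [hX, hY]; omega
    omega

theorem tb_cases {H : SimpleGraph V} (hn : 11 ≤ Fintype.card V) (hM : ¬ M5 H) :
    (∃ S, S.card ≤ 1 ∧ LC H S (8 - 2 * S.card)) ∨
    (∃ S X, S.card = 2 ∧ X.card = 5 ∧ Disjoint S X ∧ Cov H S X ∅) ∨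
    (∃ S X Y, S.card = 2 ∧ X.card = 3 ∧ Y.card = 3 ∧ Disjoint S X ∧ Disjoint S Y ∧ Disjoint X Y ∧
      Cov H S X Y) ∨
    (∃ S X, S.card = 3 ∧ X.card = 3 ∧ Disjoint S X ∧ Cov H S X ∅) ∨
    (∃ S, S.card = 4 ∧ Cov H S ∅ ∅) := by
  classical
  obtain ⟨S, β, hβ, L, hL, hq⟩ := tutteBerge hn hM
  set I := Sᶜ.image L with hI
  set cl : β → Finset V := fun l => Sᶜ.filter (fun v => L v = l) with hcl
  have hsum : ∑ l ∈ I, (cl l).card = Sᶜ.card := (card_eq_sum_card_image L Sᶜ).symm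
  have e2 : S.card + Sᶜ.card = Fintype.card V := card_add_card_compl S
  have hq' : Fintype.card V + S.card ≤ 8 + (I.filter (fun l => Odd (cl l).card)).card := by
    convert hq
  clear hq
  have hII : (Sᶜ.image L).card = I.card := by congr!
  let contr : β → ℕ := fun l => (cl l).card - (if Odd (cl l).card then 1 else 0)
  have hsum2 : ∑ l ∈ I, contr l + (I.filter (fun l => Odd (cl l).card)).card = Sᶜ.card := by
    rw [card_filter, ← sum_add_distrib, ← hsum]
    refine sum_congr rfl fun l hl => ?_
    simp only [contr]
    split_ifs with h
    · have := h.pos; omega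
    · omega
  have hqI : (I.filter (fun l => Odd (cl l).card)).card ≤ I.card := card_filter_le _ _
  let T := I.filter (fun l => 2 ≤ (cl l).card)
  have hT2 : ∀ l ∈ T, 2 ≤ contr l ∧ (cl l).card ≤ contr l + 1 := by
    intro l hl
    have := (mem_filter.1 hl).2
    simp only [contr]
    split_ifs with h
    · have := Nat.odd_iff.1 h; omega
    · omega
  have hTsum : ∑ l ∈ T, contr l ≤ ∑ l ∈ I, contr l :=
    sum_le_sum_of_subset (filter_subset _ _)
  have hTc : T.card * 2 ≤ ∑ l ∈ T, contr l := by
    have := card_nsmul_le_sum T contr 2 (fun l hl => (hT2 l hl).1)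
    simpa using this
  have hedge : ∀ u v, H.Adj u v → u ∈ S ∨ v ∈ S ∨ (L u ∈ T ∧ u ∈ cl (L u) ∧ v ∈ cl (L u)) := by
    intro u v huv
    by_cases hu : u ∈ S
    · exact Or.inl hu
    by_cases hv : v ∈ S
    · exact Or.inr (Or.inl hv)
    have h := hL u v hu hv huv
    have mu : u ∈ cl (L u) := by simp [hcl, hu]
    have mv : v ∈ cl (L u) := by simp [hcl, hv, h]
    refine Or.inr (Or.inr ⟨?_, mu, mv⟩)
    refine mem_filter.2 ⟨mem_image.2 ⟨u, by simpa using hu, rfl⟩, ?_⟩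
    exact one_lt_card.2 ⟨u, mu, v, mv, huv.ne⟩
  have hclS : ∀ l, cl l ⊆ Sᶜ := fun l => filter_subset _ _
  have disjS : ∀ {X : Finset V}, X ⊆ Sᶜ → Disjoint S X := by
    intro X hX
    rw [disjoint_right]
    intro a ha
    simpa using hX ha
  have hs : S.card ≤ 1 ∨ S.card = 2 ∨ S.card = 3 ∨ S.card = 4 := by omega
  rcases hs with hs | hs | hs | hs
  · left
    exact ⟨S, hs, β, hβ, L, hL, by omega⟩
  · have hTle : T.card ≤ 2 := by omega
    have : T.card = 0 ∨ T.card = 1 ∨ T.card = 2 := by omega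
    rcases this with h | h | h
    · right; left
      obtain ⟨X, hX, hX5⟩ := exists_subset_card_eq (show 5 ≤ Sᶜ.card by omega)
      refine ⟨S, X, hs, hX5, disjS hX, ?_⟩
      intro u v huv
      have := hedge u v huv
      rw [card_eq_zero.1 h] at this
      simp at this; tauto
    · right; left
      obtain ⟨l, hl⟩ := card_eq_one.1 h
      have hlT : l ∈ T := by simp [hl]
      rw [hl, sum_singleton] at hTsum
      have := hT2 l hlT
      obtain ⟨X, hX, hXS, hX5⟩ := exists_subsuperset_card_eq (hclS l) (show _ ≤ 5 by omega)
        (show 5 ≤ Sᶜ.card by omega)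
      refine ⟨S, X, hs, hX5, disjS hXS, ?_⟩
      intro u v huv
      have := hedge u v huv
      rw [hl, mem_singleton] at this
      rcases this with h | h | ⟨h, h1, h2⟩
      · simp [h]
      · simp [h]
      · rw [h] at h1 h2
        simp [hX h1, hX h2]
    · right; right; left
      obtain ⟨l, m, hlm, hl⟩ := card_eq_two.1 h
      have hlT : l ∈ T := by simp [hl]
      have hmT : m ∈ T := by simp [hl]
      rw [hl, sum_pair hlm] at hTsum
      have := hT2 l hlT
      have := hT2 m hmT
      have hdis : Disjoint (cl l) (cl m) := by
        rw [disjoint_left]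
        intro a h1 h2
        exact hlm ((mem_filter.1 h1).2.symm.trans (mem_filter.1 h2).2)
      have c1 : (Sᶜ \ cl m).card + (cl m).card = Sᶜ.card := card_sdiff_add_card_eq_card (hclS m)
      obtain ⟨X, hX, hXS, hX3⟩ := exists_subsuperset_card_eq (n := 3) (s := cl l) (t := Sᶜ \ cl m)
        (by intro a ha; exact mem_sdiff.2 ⟨hclS l ha, disjoint_left.1 hdis ha⟩) (by omega) (by omega)
      have hXS' : X ⊆ Sᶜ := hXS.trans sdiff_subset
      have c2 : (Sᶜ \ X).card + X.card = Sᶜ.card := card_sdiff_add_card_eq_card hXS'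
      obtain ⟨Y, hY, hYS, hY3⟩ := exists_subsuperset_card_eq (n := 3) (s := cl m) (t := Sᶜ \ X)
        (by
          intro a ha
          exact mem_sdiff.2 ⟨hclS m ha, fun h => (mem_sdiff.1 (hXS h)).2 ha⟩) (by omega) (by omega)
      refine ⟨S, X, Y, hs, hX3, hY3, disjS hXS', disjS (hYS.trans sdiff_subset), ?_, ?_⟩
      · rw [disjoint_right]
        intro a ha
        exact (mem_sdiff.1 (hYS ha)).2
      · intro u v huv
        have := hedge u v huv
        rw [hl, mem_insert, mem_singleton] at this
        rcases this with h | h | ⟨h | h, h1, h2⟩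
        · simp [h]
        · simp [h]
        · rw [h] at h1 h2
          simp [hX h1, hX h2]
        · rw [h] at h1 h2
          simp [hY h1, hY h2]
  · have hTle : T.card ≤ 1 := by omega
    right; right; right; left
    have : T.card = 0 ∨ T.card = 1 := by omega
    rcases this with h | h
    · obtain ⟨X, hX, hX5⟩ := exists_subset_card_eq (show 3 ≤ Sᶜ.card by omega)
      refine ⟨S, X, hs, hX5, disjS hX, ?_⟩
      intro u v huv
      have := hedge u v huv
      rw [card_eq_zero.1 h] at this
      simp at this; tauto
    · obtain ⟨l, hl⟩ := card_eq_one.1 h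
      have hlT : l ∈ T := by simp [hl]
      rw [hl, sum_singleton] at hTsum
      have := hT2 l hlT
      obtain ⟨X, hX, hXS, hX5⟩ := exists_subsuperset_card_eq (hclS l) (show _ ≤ 3 by omega)
        (show 3 ≤ Sᶜ.card by omega)
      refine ⟨S, X, hs, hX5, disjS hXS, ?_⟩
      intro u v huv
      have := hedge u v huv
      rw [hl, mem_singleton] at this
      rcases this with h | h | ⟨h, h1, h2⟩
      · simp [h]
      · simp [h]
      · rw [h] at h1 h2
        simp [hX h1, hX h2]
  · right; right; right; right
    refine ⟨S, hs, ?_⟩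
    intro u v huv
    have hTle : T.card = 0 := by omega
    have := hedge u v huv
    rw [card_eq_zero.1 hTle] at this
    simp at this; tauto
end Covers

set_option linter.unusedSectionVars false

section Basic
open Finset
variable {V : Type} [Fintype V] [DecidableEq V]

/-- the standing assumptions -/
structure Ctx (G : SimpleGraph V) (c : Sym2 V → ℕ) : Prop where
  vk : VK G
  n11 : 11 ≤ Fintype.card V
  hE : (ES G).card = 3 * Fintype.card V - 6
  hc : 2 * Fintype.card V + 1 ≤ ((ES G).image c).card
  noR : ∀ H : SimpleGraph V, H ≤ G → Set.InjOn c H.edgeSet → ¬ M5 H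

/-- a rainbow spanning subgraph containing every colour -/
structure Hyp (G : SimpleGraph V) (c : Sym2 V → ℕ) (H : SimpleGraph V) : Prop where
  le : H ≤ G
  inj : Set.InjOn c H.edgeSet
  all : ∀ e ∈ G.edgeSet, ∃ h ∈ H.edgeSet, c h = c e

variable {G H : SimpleGraph V} {c : Sym2 V → ℕ}

lemma Hyp.noM5 (hC : Ctx G c) (hH : Hyp G c H) : ¬ M5 H := hC.noR H hH.le hH.inj

lemma Hyp.card_ge (hC : Ctx G c) (hH : Hyp G c H) : 2 * Fintype.card V + 1 ≤ (ES H).card := by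
  refine hC.hc.trans ((card_le_card ?_).trans (card_image_le (s := ES H) (f := c)))
  intro k hk
  obtain ⟨e, he, rfl⟩ := mem_image.1 hk
  obtain ⟨h, hh, hce⟩ := hH.all e (mem_ES.1 he)
  exact mem_image.2 ⟨h, mem_ES.2 hh, hce⟩

/-- exchange an edge `h` by `g` -/
def swp (H : SimpleGraph V) (h g : Sym2 V) : SimpleGraph V :=
  H.deleteEdges {h} ⊔ SimpleGraph.fromEdgeSet {g}

lemma swp_adj {h g : Sym2 V} {u v : V} :
    (swp H h g).Adj u v ↔ (H.Adj u v ∧ s(u, v) ≠ h) ∨ (s(u, v) = g ∧ u ≠ v) := by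
  simp [swp, SimpleGraph.deleteEdges_adj]

lemma mem_swp {h g e : Sym2 V} (hg : ¬ g.IsDiag) :
    e ∈ (swp H h g).edgeSet ↔ (e ∈ H.edgeSet ∧ e ≠ h) ∨ e = g := by
  induction e with | _ u v
  simp only [SimpleGraph.mem_edgeSet, swp_adj]
  constructor
  · tauto
  · rintro (h | rfl)
    · exact Or.inl h
    · right; exact ⟨rfl, by simpa using hg⟩

lemma Hyp.swap (hH : Hyp G c H) {h g : Sym2 V} (hg : g ∈ G.edgeSet) (hh : h ∈ H.edgeSet)
    (hc : c h = c g) : Hyp G c (swp H h g) := by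
  have hd : ¬ g.IsDiag := G.not_isDiag_of_mem_edgeSet hg
  refine ⟨?_, ?_, ?_⟩
  · rw [← SimpleGraph.edgeSet_subset_edgeSet]
    intro e he
    rcases (mem_swp hd).1 he with h | rfl
    · exact SimpleGraph.edgeSet_mono hH.le h.1
    · exact hg
  · intro a ha b hb hab
    rcases (mem_swp hd).1 ha with ⟨ha1, ha2⟩ | rfl <;> rcases (mem_swp hd).1 hb with ⟨hb1, hb2⟩ | rfl
    · exact hH.inj ha1 hb1 hab
    · exact absurd (hH.inj ha1 hh (hab.trans hc.symm)) ha2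
    · exact absurd (hH.inj hb1 hh (hab.symm.trans hc.symm)) hb2
    · rfl
  · intro e he
    obtain ⟨k, hk, hke⟩ := hH.all e he
    by_cases hkh : k = h
    · subst hkh
      exact ⟨g, (mem_swp hd).2 (Or.inr rfl), hc.symm.trans hke⟩
    · exact ⟨k, (mem_swp hd).2 (Or.inl ⟨hk, hkh⟩), hke⟩

/-- partial matching data -/
def PM (H : SimpleGraph V) (A : Finset V) (f : V → V) : Prop :=
  (∀ a ∈ A, H.Adj a (f a)) ∧ (∀ a ∈ A, f a ∉ A) ∧ Set.InjOn f A

lemma PM.ins {A : Finset V} {f : V → V} (h : PM H A f) {u v : V} (huv : H.Adj u v)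
    (hu : u ∉ A) (hv : v ∉ A) (hu' : ∀ a ∈ A, f a ≠ u) (hv' : ∀ a ∈ A, f a ≠ v) :
    PM H (insert u A) (Function.update f u v) := by
  obtain ⟨h1, h2, h3⟩ := h
  have e : ∀ a ∈ A, Function.update f u v a = f a := by
    intro a ha
    exact Function.update_of_ne (by rintro rfl; exact hu ha) _ _
  refine ⟨?_, ?_, ?_⟩
  · intro a ha
    rcases mem_insert.1 ha with rfl | ha
    · simpa using huv
    · rw [e a ha]; exact h1 a ha
  · intro a ha
    rcases mem_insert.1 ha with rfl | ha
    · simp [hv, huv.ne']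
    · rw [e a ha]; simp [h2 a ha, hu' a ha]
  · intro a ha b hb hab
    rcases mem_insert.1 ha with ha2 | ha2 <;> rcases mem_insert.1 hb with hb2 | hb2
    · rw [ha2, hb2]
    · rw [e b hb2, ha2] at hab; simp at hab; exact absurd hab.symm (hv' b hb2)
    · rw [e a ha2, hb2] at hab; simp at hab; exact absurd hab (hv' a ha2)
    · rw [e a ha2, e b hb2] at hab
      exact h3 ha2 hb2 hab

lemma PM.mono {H' : SimpleGraph V} {A : Finset V} {f : V → V} (h : PM H A f)
    (hH : ∀ a ∈ A, H.Adj a (f a) → H'.Adj a (f a)) : PM H' A f :=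
  ⟨fun a ha => hH a ha (h.1 a ha), h.2.1, h.2.2⟩

lemma PM.empty (f : V → V) : PM H ∅ f := ⟨by simp, by simp, by simp⟩

/-- ten distinct vertices, five edges -/
lemma M5_of_list {a b c d e a' b' c' d' e' : V}
    (hnd : [a, b, c, d, e, a', b', c', d', e'].Nodup)
    (h1 : H.Adj a a') (h2 : H.Adj b b') (h3 : H.Adj c c') (h4 : H.Adj d d') (h5 : H.Adj e e') :
    M5 H := by
  simp only [List.nodup_cons, List.mem_cons, not_or, List.not_mem_nil, not_false_eq_true, and_true] at hnd
  have p1 : PM H _ _ := (PM.empty (H := H) id).ins h1 (by simp) (by simp) (by simp) (by simp)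
  have q : ∀ {A : Finset V} {f : V → V} {u v x : V}, (∀ a ∈ A, f a ≠ x) → u ∉ A → v ≠ x →
      (∀ a ∈ insert u A, Function.update f u v a ≠ x) := by
    intro A f u v x h hu hv a ha
    rcases mem_insert.1 ha with rfl | ha2
    · simpa using hv
    · have hau : a ≠ u := fun he => hu (he ▸ ha2)
      rw [Function.update_of_ne hau]; exact h a ha2
  have p2 := p1.ins h2 (by grind) (by grind) (q (by simp) (by simp) (by grind)) (q (by simp) (by simp) (by grind))
  have p3 := p2.ins h3 (by grind) (by grind) 
    (q (q (by simp) (by simp) (by grind)) (by grind) (by grind))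
    (q (q (by simp) (by simp) (by grind)) (by grind) (by grind))
  have p4 := p3.ins h4 (by grind) (by grind) 
    (q (q (q (by simp) (by simp) (by grind)) (by grind) (by grind)) (by grind) (by grind))
    (q (q (q (by simp) (by simp) (by grind)) (by grind) (by grind)) (by grind) (by grind))
  have p5 := p4.ins h5 (by grind) (by grind) 
    (q (q (q (q (by simp) (by simp) (by grind)) (by grind) (by grind)) (by grind) (by grind)) (by grind) (by grind))
    (q (q (q (q (by simp) (by simp) (by grind)) (by grind) (by grind)) (by grind) (by grind)) (by grind) (by grind))
  refine ⟨_, _, ?_, p5⟩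
  rw [card_insert_of_notMem (by grind), card_insert_of_notMem (by grind), card_insert_of_notMem (by grind),
    card_insert_of_notMem (by grind), card_insert_of_notMem (by grind)]
  rfl

/-- Hall's theorem for a relation -/
lemma hall_rel {β : Type} [DecidableEq β] [Nonempty β] (S : Finset V) (t : V → Finset β) :
    (∃ f : V → β, (∀ a ∈ S, f a ∈ t a) ∧ Set.InjOn f S) ∨
    ∃ A ⊆ S, A.Nonempty ∧ (A.biUnion t).card < A.card := by
  classical
  by_cases h : ∀ A ⊆ S, A.card ≤ (A.biUnion t).card
  · left
    rcases S.eq_empty_or_nonempty with rfl | ⟨s0, hs0⟩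
    · exact ⟨fun _ => Classical.arbitrary β, by simp, by simp⟩
    have := (Finset.all_card_le_biUnion_card_iff_exists_injective (fun a : S => t a)).1 (by
      intro A
      have h1 := h (A.image Subtype.val) (by intro x hx; obtain ⟨y, -, rfl⟩ := mem_image.1 hx; exact y.2)
      rw [card_image_of_injective _ Subtype.val_injective, image_biUnion] at h1
      exact h1)
    obtain ⟨f, hf, hft⟩ := this
    refine ⟨fun v => if hv : v ∈ S then f ⟨v, hv⟩ else f ⟨s0, hs0⟩, ?_, ?_⟩
    · intro a ha
      simpa [ha] using hft ⟨a, ha⟩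
    · intro a ha b hb hab
      have ha' : a ∈ S := ha
      have hb' : b ∈ S := hb
      simp only [ha', hb', dif_pos] at hab
      simpa using hf hab
  · right
    push Not at h
    obtain ⟨A, hA, hlt⟩ := h
    exact ⟨A, hA, card_pos.1 (by omega), hlt⟩

/-- counting edges with respect to `S` -/
lemma edge_count (H : SimpleGraph V) (S : Finset V) :
    (ES H).card = (EIn H S).card + ∑ v ∈ Sᶜ, (NB H v ∩ S).card + (EIn H Sᶜ).card := by
  classical
  let cr : Finset (Sym2 V) := (Sᶜ.sigma (fun v => NB H v ∩ S)).image (fun p => s(p.1, p.2))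
  have hcr : cr.card = ∑ v ∈ Sᶜ, (NB H v ∩ S).card := by
    rw [card_image_of_injOn, card_sigma]
    rintro ⟨a, b⟩ hab ⟨a', b'⟩ hab' h
    simp only [coe_sigma, Set.mem_sigma_iff, mem_coe, mem_compl, mem_inter] at hab hab'
    simp only [Sym2.eq_iff] at h
    rcases h with ⟨rfl, rfl⟩ | ⟨rfl, rfl⟩
    · rfl
    · exact absurd hab.2.2 hab'.1
  have hmem : ∀ u v, s(u, v) ∈ cr ↔ H.Adj u v ∧ ((u ∉ S ∧ v ∈ S) ∨ (v ∉ S ∧ u ∈ S)) := by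
    intro u v
    simp only [cr, mem_image, mem_sigma, mem_compl, mem_inter, mem_NB, Sym2.eq_iff, Sigma.exists]
    constructor
    · rintro ⟨a, b, ⟨h1, h2, h3⟩, ⟨rfl, rfl⟩ | ⟨rfl, rfl⟩⟩
      · exact ⟨h2, Or.inl ⟨h1, h3⟩⟩
      · exact ⟨h2.symm, Or.inr ⟨h1, h3⟩⟩
    · rintro ⟨h, ⟨h1, h2⟩ | ⟨h1, h2⟩⟩
      · exact ⟨u, v, ⟨h1, h, h2⟩, by simp⟩
      · exact ⟨v, u, ⟨h1, h.symm, h2⟩, by simp⟩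
  have hES : ES H = (EIn H S ∪ cr) ∪ EIn H Sᶜ := by
    ext e
    induction e with | _ u v
    simp only [mem_ES, SimpleGraph.mem_edgeSet, mem_union, mk_mem_EIn, hmem, mem_compl]
    tauto
  rw [hES, card_union_of_disjoint, card_union_of_disjoint, hcr]
  · rw [disjoint_left]
    intro e
    induction e with | _ u v
    simp only [mk_mem_EIn, hmem]; tauto
  · rw [disjoint_left]
    intro e
    induction e with | _ u v
    simp only [mk_mem_EIn, hmem, mem_union, mem_compl]; tauto

/-- spanning structure count -/
lemma span_count {β : Type} [DecidableEq β] (W : Finset β) (E : Finset (Sym2 β)) (r : β) (hr : r ∈ W)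
    (hcl : ∀ U ⊆ W, r ∈ U → U ≠ W → ∃ a ∈ U, ∃ b ∈ W, b ∉ U ∧ s(a, b) ∈ E) :
    W.card ≤ E.card + 1 := by
  classical
  have key : ∀ k, k + 1 ≤ W.card → ∃ U ⊆ W, r ∈ U ∧ U.card = k + 1 ∧
      k ≤ (E.filter (fun e => ∀ v ∈ e, v ∈ U)).card := by
    intro k
    induction k with
    | zero => intro h; exact ⟨{r}, by simpa using hr, by simp, by simp, by simp⟩
    | succ k ih =>
      intro h
      obtain ⟨U, hU, hrU, hc, hk⟩ := ih (by omega)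
      obtain ⟨a, ha, b, hb, hbU, hab⟩ := hcl U hU hrU (by rintro rfl; omega)
      refine ⟨insert b U, insert_subset hb hU, by simp [hrU], by rw [card_insert_of_notMem hbU, hc], ?_⟩
      have : E.filter (fun e => ∀ v ∈ e, v ∈ U) ⊂ E.filter (fun e => ∀ v ∈ e, v ∈ insert b U) := by
        refine ⟨?_, ?_⟩
        · intro e he
          rw [mem_filter] at he ⊢
          exact ⟨he.1, fun v hv => mem_insert_of_mem (he.2 v hv)⟩
        · intro hsub
          have : s(a, b) ∈ E.filter (fun e => ∀ v ∈ e, v ∈ insert b U) := by simp [hab, ha]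
          have := hsub this
          simp [hbU] at this
      have := card_lt_card this
      omega
  have hW := card_pos.2 ⟨r, hr⟩
  obtain ⟨U, -, -, -, h⟩ := key (W.card - 1) (by omega)
  have := h.trans (card_filter_le _ _)
  omega

/-- edges of `G - S` between different label classes -/
noncomputable def IE {β : Type} (G : SimpleGraph V) (S : Finset V) (L : V → β) : Finset (Sym2 V) := by
  classical exact (EIn G Sᶜ).filter (fun e => ¬ (e.map L).IsDiag)

lemma mem_IE {β : Type} {S : Finset V} {L : V → β} {u v : V} :
    s(u, v) ∈ IE G S L ↔ G.Adj u v ∧ u ∉ S ∧ v ∉ S ∧ L u ≠ L v := by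
  simp [IE, and_assoc]

lemma quot_one {β : Type} [DecidableEq β] (S : Finset V) (L : V → β) {p : V} (hp : p ∉ S)
    (hr : ∀ q, q ∉ S → Reach G (↑S)ᶜ p q) :
    (Sᶜ.image L).card ≤ ((IE G S L).image (Sym2.map L)).card + 1 := by
  classical
  refine span_count _ _ (L p) (mem_image_of_mem _ (by simpa using hp)) ?_
  intro U hU hpU hne
  by_contra hcon
  push Not at hcon
  apply hne
  refine hU.antisymm ?_
  intro w hw
  obtain ⟨q, hq, rfl⟩ := mem_image.1 hw
  rw [mem_compl] at hq
  refine (hr q hq).closed (fun v => L v ∈ U) ?_ hpU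
  intro a b ha hb hab haU
  by_contra hbU
  refine hcon (L a) haU (L b) (mem_image_of_mem _ (by simpa using hb)) hbU ?_
  refine mem_image.2 ⟨s(a, b), mem_IE.2 ⟨hab, by simpa using ha, by simpa using hb, ?_⟩, rfl⟩
  intro h; rw [h] at haU; exact hbU haU

lemma quot_two {β : Type} [DecidableEq β] (S : Finset V) (L : V → β) {p p' : V} (hp : p ∉ S)
    (hp' : p' ∉ S)
    (hr : ∀ q, q ∉ S → Reach G (↑S)ᶜ p q ∨ Reach G (↑S)ᶜ p' q) :
    (Sᶜ.image L).card ≤ ((IE G S L).image (Sym2.map L)).card + 2 := by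
  classical
  have := span_count (Sᶜ.image L) (insert s(L p, L p') ((IE G S L).image (Sym2.map L))) (L p) (mem_image_of_mem _ (by simpa using hp)) ?_
  · have h2 := card_insert_le s(L p, L p') ((IE G S L).image (Sym2.map L))
    omega
  intro U hU hpU hne
  by_contra hcon
  push Not at hcon
  apply hne
  refine hU.antisymm ?_
  intro w hw
  obtain ⟨q, hq, rfl⟩ := mem_image.1 hw
  rw [mem_compl] at hq
  have hp'U : L p' ∈ U := by
    by_contra h
    exact hcon (L p) hpU (L p') (mem_image_of_mem _ (by simpa using hp')) h (by simp)
  have cl : ∀ a b, a ∈ (↑S : Set V)ᶜ → b ∈ (↑S : Set V)ᶜ → G.Adj a b → L a ∈ U → L b ∈ U := by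
    intro a b ha hb hab haU
    by_contra hbU
    refine hcon (L a) haU (L b) (mem_image_of_mem _ (by simpa using hb)) hbU ?_
    refine mem_insert_of_mem (mem_image.2 ⟨s(a, b), mem_IE.2 ⟨hab, by simpa using ha, by simpa using hb, ?_⟩, rfl⟩)
    intro h; rw [h] at haU; exact hbU haU
  rcases hr q hq with h | h
  · exact h.closed (fun v => L v ∈ U) cl hpU
  · exact h.closed (fun v => L v ∈ U) cl hp'U

end Basic

set_option linter.unusedSectionVars false

section StepA
open Finset
variable {V : Type} [Fintype V] [DecidableEq V]
variable {G H : SimpleGraph V} {c : Sym2 V → ℕ}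

lemma Hyp.vk (hC : Ctx G c) (hH : Hyp G c H) : VK H := hC.vk.mono hH.le

lemma LC_cover {β : Type} [DecidableEq β] {S : Finset V} {L : V → β} (hS : S.card ≤ 1)
    (hL : ∀ u v, u ∉ S → v ∉ S → H.Adj u v → L u = L v) :
    (ES H).card ≤ ∑ l ∈ Sᶜ.image L, (EIn H (S ∪ Sᶜ.filter (fun v => L v = l))).card := by
  refine (card_le_card ?_).trans card_biUnion_le
  intro e he
  induction e with | _ u v
  rw [mem_ES, SimpleGraph.mem_edgeSet] at he
  have key : ∀ u v, H.Adj u v → u ∉ S → s(u, v) ∈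
      (Sᶜ.image L).biUnion fun l => EIn H (S ∪ Sᶜ.filter (fun v => L v = l)) := by
    intro u v he hu
    refine mem_biUnion.2 ⟨L u, mem_image_of_mem _ (by simpa using hu), mk_mem_EIn.2 ⟨he, ?_, ?_⟩⟩
    · simp [hu]
    · by_cases hv : v ∈ S
      · simp [hv]
      · simp [hv, (hL u v hu hv he).symm]
  by_cases hu : u ∈ S
  · by_cases hv : v ∈ S
    · exact absurd (card_le_one.1 hS u hu v hv) he.ne
    · rw [Sym2.eq_swap]; exact key v u he.symm hv
  · exact key u v he hu

lemma stepA (hC : Ctx G c) (hH : Hyp G c H) {S : Finset V} (hS : S.card ≤ 1)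
    (h : LC H S (8 - 2 * S.card)) : False := by
  obtain ⟨β, _, L, hL, hN⟩ := h
  have h1 := LC_cover hS hL
  have h2 := hH.card_ge hC
  have hn := hC.n11
  have hvk := hH.vk hC
  have hsum : ∑ l ∈ Sᶜ.image L, (Sᶜ.filter (fun v => L v = l)).card = Sᶜ.card :=
    (card_eq_sum_card_fiberwise (fun x hx => mem_image_of_mem L hx)).symm
  have hcc := card_compl_add_card S
  have hpos : ∀ l ∈ Sᶜ.image L, 1 ≤ (Sᶜ.filter (fun v => L v = l)).card := by
    intro l hl
    obtain ⟨q, hq, rfl⟩ := mem_image.1 hl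
    exact card_pos.2 ⟨q, by simpa using hq⟩
  have hU : ∀ l, (S ∪ Sᶜ.filter (fun v => L v = l)).card = S.card + (Sᶜ.filter (fun v => L v = l)).card := by
    intro l
    apply card_union_of_disjoint
    rw [disjoint_left]; intro a ha; simp [ha]
  rcases (by omega : S.card = 0 ∨ S.card = 1) with h0 | h0
  · by_cases hall : ∀ l ∈ Sᶜ.image L, (Sᶜ.filter (fun v => L v = l)).card ≤ 1
    · rw [sum_eq_zero] at h1
      · omega
      intro l hl
      exact EIn_card_one (by rw [hU]; have := hall l hl; omega)
    · push Not at hall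
      obtain ⟨l0, hl0, hl0'⟩ := hall
      have : ∑ l ∈ Sᶜ.image L, ((EIn H (S ∪ Sᶜ.filter (fun v => L v = l))).card + 3 + if l = l0 then 2 else 0)
          ≤ ∑ l ∈ Sᶜ.image L, 3 * (Sᶜ.filter (fun v => L v = l)).card := by
        apply sum_le_sum
        intro l hl
        have := hU l
        split_ifs with hll
        · subst hll
          have := EIn_card_le5 hvk (X := S ∪ Sᶜ.filter (fun v => L v = l)) (by omega)
          omega
        · have h3 := hpos l hl
          have := EIn_card_le3 hvk (X := S ∪ Sᶜ.filter (fun v => L v = l)) (by omega)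
          omega
      rw [← mul_sum, hsum, sum_add_distrib, sum_add_distrib, sum_const, sum_ite_eq' , if_pos hl0, smul_eq_mul] at this
      omega
  · have : ∑ l ∈ Sᶜ.image L, ((EIn H (S ∪ Sᶜ.filter (fun v => L v = l))).card + 2)
          ≤ ∑ l ∈ Sᶜ.image L, 3 * (Sᶜ.filter (fun v => L v = l)).card := by
        apply sum_le_sum
        intro l hl
        have := hU l
        have h3 := hpos l hl
        have := EIn_card_le5 hvk (X := S ∪ Sᶜ.filter (fun v => L v = l)) (by omega)
        omega
    rw [← mul_sum, hsum, sum_add_distrib, sum_const, smul_eq_mul] at this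
    omega

/-- the labelling attached to a cover -/
def lab (X Y : Finset V) (v : V) : Bool ⊕ V :=
  if v ∈ X then Sum.inl true else if v ∈ Y then Sum.inl false else Sum.inr v

lemma lab_eq {X Y : Finset V} (hXY : Disjoint X Y) {u v : V} :
    lab X Y u = lab X Y v ↔ u = v ∨ (u ∈ X ∧ v ∈ X) ∨ (u ∈ Y ∧ v ∈ Y) := by
  have h1 := disjoint_left.1 hXY
  unfold lab
  split_ifs <;> grind

lemma lab_card {S X Y : Finset V} (h1 : Disjoint S X) (h2 : Disjoint S Y) (h3 : Disjoint X Y) :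
    Fintype.card V ≤ S.card + (Sᶜ.image (lab X Y)).card + ((X.card - 1) + (Y.card - 1)) := by
  have hm := card_compl_add_card S
  have : Sᶜ.card ≤ (Sᶜ.image (lab X Y)).card + ((X.card - 1) + (Y.card - 1)) := by
    have hh : (Sᶜ \ (X ∪ Y)).image Sum.inr ∪ (if X.Nonempty then {Sum.inl true} else ∅) ∪ (if Y.Nonempty then {Sum.inl false} else ∅)
       ⊆ Sᶜ.image (lab X Y) := by
      intro l hl
      simp only [mem_union, mem_image, mem_sdiff, mem_compl] at hl ⊢
      rcases hl with (⟨a, ⟨ha, hb⟩, rfl⟩ | hl) | hl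
      · exact ⟨a, ha, by unfold lab; grind⟩
      · split_ifs at hl with hx
        · obtain ⟨a, ha⟩ := hx
          rw [mem_singleton.1 hl]
          exact ⟨a, disjoint_right.1 h1 ha, by simp [lab, ha]⟩
        · simp at hl
      · split_ifs at hl with hx
        · obtain ⟨a, ha⟩ := hx
          rw [mem_singleton.1 hl]
          exact ⟨a, disjoint_right.1 h2 ha, by simp [lab, ha, disjoint_right.1 h3 ha]⟩
        · simp at hl
    have hc := card_le_card hh
    rw [card_union_of_disjoint, card_union_of_disjoint, card_image_of_injective _ Sum.inr_injective] at hc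
    · have := card_le_card_sdiff_add_card (s := Sᶜ) (t := X ∪ Y)
      have hu := card_union_le X Y
      have e1 : (if X.Nonempty then ({Sum.inl true} : Finset (Bool ⊕ V)) else ∅).card = if X.Nonempty then 1 else 0 := by split_ifs <;> rfl
      have e2 : (if Y.Nonempty then ({Sum.inl false} : Finset (Bool ⊕ V)) else ∅).card = if Y.Nonempty then 1 else 0 := by split_ifs <;> rfl
      rw [e1, e2] at hc
      simp only [← card_pos] at hc
      split_ifs at hc <;> omega
    · split_ifs <;> simp
    · split_ifs <;> simp
  omega

end StepA

set_option linter.unusedSectionVars false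

section Tight
open Finset
variable {V : Type} [Fintype V] [DecidableEq V]
variable {G H : SimpleGraph V} {c : Sym2 V → ℕ}

structure Tight (G H : SimpleGraph V) (S X Y : Finset V) : Prop where
  card : (ES H).card = 2 * Fintype.card V + 1
  edge : ∀ u v, G.Adj u v → (H.Adj u v ↔ (u ∈ S ∨ v ∈ S ∨ (u ∈ X ∧ v ∈ X) ∨ (u ∈ Y ∧ v ∈ Y)))
  ie : (IE G S (lab X Y)).card + 7 = Fintype.card V
  inj : Set.InjOn (Sym2.map (lab X Y)) (IE G S (lab X Y))

lemma IE_disj {β : Type} {S : Finset V} {L : V → β}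
    (hL : ∀ u v, u ∉ S → v ∉ S → H.Adj u v → L u = L v) : Disjoint (IE G S L) (ES H) := by
  rw [disjoint_left]
  intro e
  induction e with | _ u v
  rw [mem_IE, mem_ES, SimpleGraph.mem_edgeSet]
  rintro ⟨h1, h2, h3, h4⟩ h5
  exact h4 (hL u v h2 h3 h5)

lemma IE_sub {β : Type} {S : Finset V} {L : V → β} : IE G S L ⊆ ES G := by
  intro e
  induction e with | _ u v
  rw [mem_IE, mem_ES, SimpleGraph.mem_edgeSet]
  exact fun h => h.1

lemma IE_bound (hC : Ctx G c) (hH : Hyp G c H) {β : Type} {S : Finset V} {L : V → β}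
    (hL : ∀ u v, u ∉ S → v ∉ S → H.Adj u v → L u = L v) :
    (IE G S L).card + (ES H).card ≤ 3 * Fintype.card V - 6 := by
  rw [← hC.hE, ← card_union_of_disjoint (IE_disj hL)]
  exact card_le_card (union_subset IE_sub (ES_mono hH.le))

lemma Cov.resp {S X Y : Finset V} (h : Cov H S X Y) (h3 : Disjoint X Y) :
    ∀ u v, u ∉ S → v ∉ S → H.Adj u v → lab X Y u = lab X Y v := by
  intro u v hu hv hadj
  rw [lab_eq h3]
  rcases h u v hadj with h | h | h | h <;> tauto

/-- core of tightness -/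
lemma tight_core (hC : Ctx G c) (hH : Hyp G c H) {S X Y : Finset V} (h : Cov H S X Y)
    (h3 : Disjoint X Y)
    (hN : Fintype.card V ≤ ((IE G S (lab X Y)).image (Sym2.map (lab X Y))).card + 7) :
    Tight G H S X Y := by
  have hr := h.resp h3
  have hb := IE_bound hC hH hr
  have hn := hC.n11
  have hge := hH.card_ge hC
  have hi := card_image_le (s := IE G S (lab X Y)) (f := Sym2.map (lab X Y))
  refine ⟨by omega, ?_, by omega, ?_⟩
  · intro u v huv
    constructor
    · intro hh; exact h u v hh
    · intro hcl
      by_contra hnh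
      have hmem : s(u, v) ∉ IE G S (lab X Y) ∪ ES H := by
        rw [mem_union, mem_IE, mem_ES, SimpleGraph.mem_edgeSet, Ne, lab_eq h3]
        tauto
      have : insert s(u, v) (IE G S (lab X Y) ∪ ES H) ⊆ ES G :=
        insert_subset (by simpa using huv) (union_subset IE_sub (ES_mono hH.le))
      have := card_le_card this
      rw [card_insert_of_notMem hmem, card_union_of_disjoint (IE_disj hr), hC.hE] at this
      omega
  · apply card_image_iff.1
    omega

lemma tight2 (hC : Ctx G c) (hH : Hyp G c H) {S X Y : Finset V} (h : Cov H S X Y)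
    (h1 : Disjoint S X) (h2 : Disjoint S Y)
    (h3 : Disjoint X Y) (hS : S.card = 2) (hk : (X.card - 1) + (Y.card - 1) ≤ 4) :
    Tight G H S X Y := by
  apply tight_core hC hH h h3
  have hl := lab_card h1 h2 h3
  have hn := hC.n11
  have hcc := card_compl_add_card S
  obtain ⟨x, y, hxy, rfl⟩ := card_eq_two.1 hS
  obtain ⟨p, hp⟩ := card_pos.1 (show 0 < ({x, y} : Finset V)ᶜ.card by omega)
  rw [mem_compl] at hp
  have := quot_one (G := G) {x, y} (lab X Y) hp (by
    intro q hq
    have := conn2 hC.vk hC.hE hxy (p := p) (q := q) (by simpa using hp) (by simpa using hq)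
    simpa using this)
  omega

lemma tight3 (hC : Ctx G c) (hH : Hyp G c H) {S X Y : Finset V} (h : Cov H S X Y)
    (h1 : Disjoint S X) (h2 : Disjoint S Y)
    (h3 : Disjoint X Y) (hS : S.card = 3) (hk : (X.card - 1) + (Y.card - 1) ≤ 2) :
    Tight G H S X Y ∧ ∀ p, p ∉ S → ∃ q, q ∉ S ∧ ¬ Reach G (↑S)ᶜ p q := by
  have hl := lab_card h1 h2 h3
  have hn := hC.n11
  have hcc := card_compl_add_card S
  have hr := h.resp h3
  have hb := IE_bound hC hH hr
  have hge := hH.card_ge hC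
  have hi := card_image_le (s := IE G S (lab X Y)) (f := Sym2.map (lab X Y))
  have hdis : ∀ p, p ∉ S → ∃ q, q ∉ S ∧ ¬ Reach G (↑S)ᶜ p q := by
    intro p hp
    by_contra hcon
    push Not at hcon
    have := quot_one (G := G) S (lab X Y) hp hcon
    omega
  refine ⟨?_, hdis⟩
  apply tight_core hC hH h h3
  obtain ⟨p, hp⟩ := card_pos.1 (show 0 < Sᶜ.card by omega)
  rw [mem_compl] at hp
  obtain ⟨q, hq, hpq⟩ := hdis p hp
  have := quot_two (G := G) S (lab X Y) hp hq (by
    intro r hr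
    by_contra hcon
    push Not at hcon
    exact three_comps hC.vk hC.hE hS hp hq hr hpq hcon.1 hcon.2)
  omega

end Tight

set_option linter.unusedSectionVars false

section StepBa
open Finset
variable {V : Type} [Fintype V] [DecidableEq V]
variable {G H : SimpleGraph V} {c : Sym2 V → ℕ}

/-- pairwise intersecting edges form a star or a triangle -/
lemma inter_edges [Nonempty V] (F : SimpleGraph V)
    (h : ∀ a b c d, F.Adj a b → F.Adj c d → a = c ∨ a = d ∨ b = c ∨ b = d) :
    (∃ m, ∀ a b, F.Adj a b → a = m ∨ b = m) ∨
    ∃ a b d, F.Adj a b ∧ F.Adj a d ∧ F.Adj b d ∧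
      ∀ u v, F.Adj u v → u ∈ ({a, b, d} : Finset V) ∧ v ∈ ({a, b, d} : Finset V) := by
  by_cases h0 : ∃ a b, F.Adj a b
  swap
  · left
    push Not at h0
    exact ⟨Classical.arbitrary V, fun a b hab => absurd hab (h0 a b)⟩
  obtain ⟨a, b, hab⟩ := h0
  by_cases h1 : ∀ u v, F.Adj u v → u = a ∨ v = a
  · exact Or.inl ⟨a, h1⟩
  by_cases h2 : ∀ u v, F.Adj u v → u = b ∨ v = b
  · exact Or.inl ⟨b, h2⟩
  push Not at h1 h2
  right
  obtain ⟨d, hbd, hda⟩ : ∃ d, F.Adj b d ∧ d ≠ a := by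
    obtain ⟨u, v, huv, hu, hv⟩ := h1
    rcases h a b u v hab huv with h | h | h | h
    · exact absurd h.symm hu
    · exact absurd h.symm hv
    · subst h; exact ⟨v, huv, hv⟩
    · subst h; exact ⟨u, huv.symm, hu⟩
  have had : F.Adj a d := by
    obtain ⟨u, v, huv, hu, hv⟩ := h2
    have e1 := h a b u v hab huv
    have e2 := h b d u v hbd huv
    have e3 := hab.ne
    rcases e1 with e | e | e | e
    · rcases e2 with e' | e' | e' | e'
      · exact absurd e'.symm hu
      · exact absurd e'.symm hv
      · exact absurd (e'.trans e.symm) hda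
      · rw [e, e']; exact huv
    · rcases e2 with e' | e' | e' | e'
      · exact absurd e'.symm hu
      · exact absurd e'.symm hv
      · rw [e, e']; exact huv.symm
      · exact absurd (e'.trans e.symm) hda
    · exact absurd e.symm hu
    · exact absurd e.symm hv
  refine ⟨a, b, d, hab, had, hbd, ?_⟩
  intro u v huv
  have e1 := h a b u v hab huv
  have e2 := h b d u v hbd huv
  have e3 := h a d u v had huv
  have n1 := hab.ne
  have n2 := hbd.ne
  have n3 := huv.ne
  simp only [mem_insert, mem_singleton]
  grind

/-- at most two vertices see all of a 3-set -/
lemma full3 (hG : VK G) {S R : Finset V} (hS : S.card = 3)  :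
    (R.filter (fun v => S ⊆ NB G v)).card ≤ 2 := by
  by_contra hcon
  push Not at hcon
  obtain ⟨p, hp, q, hq, r, hr, hpq, hpr, hqr⟩ := two_lt_card.1 hcon
  obtain ⟨x, y, z, hxy, hxz, hyz, rfl⟩ := Finset.card_eq_three.1 hS
  simp only [mem_filter, insert_subset_iff, singleton_subset_iff, mem_NB] at hp hq hr
  exact hG.noK33_vert hxy hxz hyz hpq hpr hqr hp.2.1.symm hq.2.1.symm hr.2.1.symm
    hp.2.2.1.symm hq.2.2.1.symm hr.2.2.1.symm hp.2.2.2.symm hq.2.2.2.symm hr.2.2.2.symm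

lemma sum3 (hG : VK G) {S R : Finset V} (hS : S.card = 3) :
    ∑ v ∈ R, (NB G v ∩ S).card ≤ 2 * R.card + 2 := by
  have h1 : ∀ v ∈ R, (NB G v ∩ S).card ≤ 2 + if S ⊆ NB G v then 1 else 0 := by
    intro v _
    split_ifs with h
    · have := card_le_card (inter_subset_right : NB G v ∩ S ⊆ S); omega
    · have : NB G v ∩ S ⊂ S := ⟨inter_subset_right, fun h' => h fun a ha => (mem_inter.1 (h' ha)).1⟩
      have := card_lt_card this; omega
  refine (sum_le_sum h1).trans ?_
  rw [sum_add_distrib, sum_const, ← card_filter, smul_eq_mul]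
  have := full3 hG (R := R) hS
  omega

/-- counting inside `X` -/
lemma edge_count_in (H : SimpleGraph V) {S X : Finset V} (hSX : S ⊆ X) :
    (EIn H X).card ≤ (EIn H S).card + ∑ v ∈ X \ S, (NB H v ∩ S).card + (EIn H (X \ S)).card := by
  classical
  let cr : Finset (Sym2 V) := ((X \ S).sigma (fun v => NB H v ∩ S)).image (fun p => s(p.1, p.2))
  have hcr : cr.card ≤ ∑ v ∈ X \ S, (NB H v ∩ S).card := by
    refine card_image_le.trans ?_
    rw [card_sigma]
  have hmem : ∀ u v, H.Adj u v → u ∈ X → u ∉ S → v ∈ S → s(u, v) ∈ cr := by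
    intro u v h1 h2 h3 h4
    exact mem_image.2 ⟨⟨u, v⟩, by simp [h1, h2, h3, h4], rfl⟩
  have hES : EIn H X ⊆ (EIn H S ∪ cr) ∪ EIn H (X \ S) := by
    intro e
    induction e with | _ u v
    intro he
    obtain ⟨h1, h2, h3⟩ := mk_mem_EIn.1 he
    simp only [mem_union, mk_mem_EIn, mem_sdiff]
    by_cases hu : u ∈ S <;> by_cases hv : v ∈ S
    · tauto
    · left; right; rw [Sym2.eq_swap]; exact hmem _ _ h1.symm h3 hv hu
    · left; right; exact hmem _ _ h1 h2 hu hv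
    · tauto
  have := card_le_card hES
  have := card_union_le (EIn H S ∪ cr) (EIn H (X \ S))
  have := card_union_le (EIn H S) cr
  omega

/-- a five-set `C` attached to a pair `S` with 15 edges contains a 2-matching avoiding `h` -/
lemma two_match (hG : VK H) {S C : Finset V} (hS : S.card = 2) (hC : C.card = 5)
    (hd : Disjoint S C) (hE : 15 ≤ (EIn H (S ∪ C)).card) (h : Sym2 V) :
    ∃ a ∈ C, ∃ b ∈ C, ∃ p ∈ C, ∃ q ∈ C, H.Adj a b ∧ H.Adj p q ∧ s(a, b) ≠ h ∧ s(p, q) ≠ h ∧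
      a ≠ p ∧ a ≠ q ∧ b ≠ p ∧ b ≠ q := by
  classical
  by_contra hcon
  push Not at hcon
  let F : SimpleGraph V := 
    { Adj := fun a b => H.Adj a b ∧ a ∈ C ∧ b ∈ C ∧ s(a, b) ≠ h
      symm := ⟨fun a b ⟨h1, h2, h3, h4⟩ => ⟨h1.symm, h3, h2, by rwa [Sym2.eq_swap]⟩⟩
      loopless := ⟨fun a ha => ha.1.ne rfl⟩ }
  have hF : ∀ a b, F.Adj a b ↔ H.Adj a b ∧ a ∈ C ∧ b ∈ C ∧ s(a, b) ≠ h := fun _ _ => Iff.rfl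
  obtain ⟨m0, hm0⟩ := card_pos.1 (show 0 < C.card by omega)
  have : Nonempty V := ⟨m0⟩
  rcases inter_edges F (by
    intro a b c d hab hcd
    rw [hF] at hab hcd
    have := hcon a hab.2.1 b hab.2.2.1 c hcd.2.1 d hcd.2.2.1 hab.1 hcd.1 hab.2.2.2 hcd.2.2.2
    tauto) with ⟨m, hm⟩ | ⟨a, b, d, hab, had, hbd, htri⟩
  · -- star
    obtain ⟨m, hmC, hm⟩ : ∃ m ∈ C, ∀ a b, F.Adj a b → a = m ∨ b = m := by
      by_cases hmC : m ∈ C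
      · exact ⟨m, hmC, hm⟩
      · refine ⟨m0, hm0, fun a b hab => ?_⟩
        rcases hm a b hab with rfl | rfl
        · exact absurd hab.2.1 hmC
        · exact absurd hab.2.2.1 hmC
    have hmS : m ∉ S := disjoint_right.1 hd hmC
    have h3 : (insert m S).card = 3 := by rw [card_insert_of_notMem hmS, hS]
    have hsub : insert m S ⊆ S ∪ C := by
      intro v hv; rcases mem_insert.1 hv with rfl | hv <;> simp [*]
    have e1 := edge_count_in H hsub
    have e2 := sum3 hG (R := (S ∪ C) \ insert m S) h3
    have e3 := EIn_sub_choose (G := H) (insert m S)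
    rw [h3] at e3
    have e4 : EIn H ((S ∪ C) \ insert m S) ⊆ {h} := by
      intro e
      induction e with | _ u v
      intro he
      obtain ⟨h1, h2, h3⟩ := mk_mem_EIn.1 he
      simp only [mem_sdiff, mem_union, mem_insert, not_or] at h2 h3
      rw [mem_singleton]
      by_contra hne
      have := hm u v ⟨h1, by tauto, by tauto, hne⟩
      tauto
    have e5 := card_le_card e4
    have e6 := card_sdiff_add_card_eq_card hsub
    rw [card_union_of_disjoint hd] at e6
    have : Nat.choose 3 2 = 3 := rfl
    rw [card_singleton] at e5
    omega
  · have hT : ({a, b, d} : Finset V) ⊆ C := by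
      simp only [insert_subset_iff, singleton_subset_iff]
      exact ⟨hab.2.1, hab.2.2.1, had.2.2.1⟩
    have hT3 : ({a, b, d} : Finset V).card = 3 := by
      rw [card_eq_three]; exact ⟨a, b, d, hab.1.ne, had.1.ne, hbd.1.ne, rfl⟩
    generalize ({a, b, d} : Finset V) = T at *
    -- X = S ∪ C, split along S ∪ T
    have hdT : Disjoint S T := disjoint_of_subset_right hT hd
    have hsub : S ∪ T ⊆ S ∪ C := union_subset_union_right hT
    have e1 : EIn H (S ∪ C) ⊆ (EIn H (S ∪ T) ∪ {h}) ∪ ((C \ T).sigma (fun v => NB H v ∩ S)).image (fun p => s(p.1, p.2)) := by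
      intro e
      induction e with | _ u v
      intro he
      obtain ⟨h1, h2, h3⟩ := mk_mem_EIn.1 he
      have cl : ∀ u v, H.Adj u v → u ∈ C → u ∉ T → v ∈ S → s(u, v) ∈ ((C \ T).sigma (fun v => NB H v ∩ S)).image (fun p => s(p.1, p.2)) := by
        intro u v h1 h2 h3 h4
        exact mem_image.2 ⟨⟨u, v⟩, by simp [h1, h2, h3, h4], rfl⟩
      by_cases hh : s(u, v) = h
      · simp [hh]
      by_cases hu : u ∈ S <;> by_cases hv : v ∈ S
      · simp [h1, hu, hv]
      · by_cases hvT : v ∈ T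
        · simp [h1, hu, hvT]
        · refine mem_union_right _ ?_
          rw [Sym2.eq_swap]
          refine cl v u h1.symm ?_ hvT hu
          rcases mem_union.1 h3 with h | h
          · exact absurd h hv
          · exact h
      · by_cases huT : u ∈ T
        · simp [h1, hv, huT]
        · refine mem_union_right _ ?_
          refine cl u v h1 ?_ huT hv
          rcases mem_union.1 h2 with h | h
          · exact absurd h hu
          · exact h
      · have := htri u v ⟨h1, (mem_union.1 h2).resolve_left hu, (mem_union.1 h3).resolve_left hv, hh⟩
        simp [h1, this]
    have e2 := card_le_card e1
    have e3 := card_union_le (EIn H (S ∪ T) ∪ {h}) (((C \ T).sigma (fun v => NB H v ∩ S)).image (fun p => s(p.1, p.2)))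
    have e4 := card_union_le (EIn H (S ∪ T)) {h}
    have e5 := card_image_le (s := (C \ T).sigma (fun v => NB H v ∩ S)) (f := fun p => s(p.1, p.2))
    rw [card_sigma] at e5
    have e6 : ∑ v ∈ C \ T, (NB H v ∩ S).card ≤ ∑ v ∈ C \ T, 2 :=
      sum_le_sum fun v _ => by rw [← hS]; exact card_le_card inter_subset_right
    rw [sum_const, smul_eq_mul] at e6
    have e7 := card_sdiff_add_card_eq_card hT
    have e8 := mader_in hG (S ∪ T) (by rw [card_union_of_disjoint hdT]; omega)
    rw [card_union_of_disjoint hdT] at e8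
    rw [card_singleton] at e4
    omega

end StepBa

set_option linter.unusedSectionVars false

section StepBa2
open Finset
variable {V : Type} [Fintype V] [DecidableEq V]
variable {G H : SimpleGraph V} {c : Sym2 V → ℕ}

/-- counting for a cover by a pair -/
lemma cov2_count {S X Y : Finset V} (h : Cov H S X Y) (hS : S.card = 2) (h1 : Disjoint S X)
    (h2 : Disjoint S Y) (h3 : Disjoint X Y) (W : Finset V) (hW : W = S ∪ (X ∪ Y)) :
    (ES H).card ≤ (EIn H W).card + ∑ v ∈ Wᶜ, (NB H v ∩ S).card := by
  rw [edge_count H W]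
  have e0 : (EIn H Wᶜ).card = 0 := by
    rw [card_eq_zero, eq_empty_iff_forall_notMem]
    intro e
    induction e with | _ u v
    rw [mk_mem_EIn, hW]
    simp only [mem_compl, mem_union, not_or]
    intro ⟨a, b, d⟩
    have := h u v a
    tauto
  have e1 : ∑ v ∈ Wᶜ, (NB H v ∩ W).card = ∑ v ∈ Wᶜ, (NB H v ∩ S).card := by
    refine sum_congr rfl fun v hv => ?_
    congr 1
    ext w
    rw [mem_compl, hW] at hv
    simp only [mem_union, not_or] at hv
    simp only [mem_inter, mem_NB, hW, mem_union]
    constructor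
    · rintro ⟨a, b⟩
      have := h v w a
      tauto
    · tauto
  omega

lemma sum_full {S W : Finset V} (hS : S.card = 2) 
    (h : 2 * W.card ≤ ∑ v ∈ W, (NB H v ∩ S).card) : ∀ v ∈ W, ∀ x ∈ S, H.Adj v x := by
  have hle : ∀ v ∈ W, (NB H v ∩ S).card ≤ 2 := fun v _ => by
    rw [← hS]; exact card_le_card inter_subset_right
  have heq : ∑ v ∈ W, (NB H v ∩ S).card = ∑ v ∈ W, 2 := by
    apply le_antisymm (sum_le_sum hle)
    rw [sum_const, smul_eq_mul]; omega
  intro v hv x hx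
  have := (sum_eq_sum_iff_of_le hle).1 heq v hv
  have := eq_of_subset_of_card_le (inter_subset_right : NB H v ∩ S ⊆ S) (by omega)
  rw [← this] at hx
  exact mem_NB.1 (mem_inter.1 hx).1

lemma stepBa (hC : Ctx G c) (hH : Hyp G c H) {S C : Finset V} (hS : S.card = 2) (hX : C.card = 5)
    (hd : Disjoint S C) (h : Cov H S C ∅) : False := by
  have hn := hC.n11
  have hvk := hH.vk hC
  have T := tight2 hC hH h hd (by simp) (by simp) hS (by simp [hX])
  have hcount := cov2_count h hS hd (by simp) (by simp) (S ∪ C) (by simp)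
  have hWc := card_compl_add_card (S ∪ C)
  have hU := card_union_of_disjoint hd
  have hm := mader_in hvk (S ∪ C) (by omega)
  have hsle : ∑ v ∈ (S ∪ C)ᶜ, (NB H v ∩ S).card ≤ ∑ v ∈ (S ∪ C)ᶜ, 2 := sum_le_sum fun v _ => by
    rw [← hS]; exact card_le_card inter_subset_right
  rw [sum_const, smul_eq_mul] at hsle
  have hT := T.card
  have hfull := sum_full (H := H) (W := (S ∪ C)ᶜ) hS (by omega)
  have h15 : 15 ≤ (EIn H (S ∪ C)).card := by omega
  obtain ⟨x, y, hxy, hSe⟩ := card_eq_two.1 hS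
  have hxS : x ∈ S := by simp [hSe]
  have hyS : y ∈ S := by simp [hSe]
  have hxC := disjoint_left.1 hd hxS
  have hyC := disjoint_left.1 hd hyS
  have hfull' : ∀ v, v ∉ S → v ∉ C → H.Adj v x ∧ H.Adj v y := by
    intro v h1 h2
    have hv : v ∈ (S ∪ C)ᶜ := by simp [h1, h2]
    exact ⟨hfull v hv x hxS, hfull v hv y hyS⟩
  have hconn : ∀ p q, p ∉ S → q ∉ S → Reach G (↑S)ᶜ p q := by
    intro p q hp hq
    have := conn2 hC.vk hC.hE hxy (p := p) (q := q) (by simpa [hSe] using hp) (by simpa [hSe] using hq)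
    rw [hSe]; simpa using this
  by_cases hg : ∃ t t', G.Adj t t' ∧ t ∉ S ∧ t' ∉ S ∧ t ∉ C ∧ t' ∉ C
  · obtain ⟨t, t', htt, hts, hts', htC, htC'⟩ := hg
    obtain ⟨k, hk, hck⟩ := hH.all s(t, t') (by simpa using htt)
    have hH' := hH.swap (g := s(t, t')) (by simpa using htt) hk hck
    obtain ⟨a, ha, b, hb, p, hp, q, hq, hab, hpq, hab', hpq', n1, n2, n3, n4⟩ := two_match hvk hS hX hd h15 k
    have : 1 < ((S ∪ C)ᶜ \ {t, t'}).card := by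
      have := le_card_sdiff {t, t'} (S ∪ C)ᶜ
      have := card_le_two (a := t) (b := t')
      omega
    obtain ⟨r, hr, r', hr', hrr⟩ := one_lt_card.1 this
    simp only [mem_sdiff, mem_compl, mem_union, not_or, mem_insert, mem_singleton] at hr hr'
    have key : ∀ r r', r ≠ r' → (r ∉ S ∧ r ∉ C) ∧ r ≠ t ∧ r ≠ t' → (r' ∉ S ∧ r' ∉ C) ∧ r' ≠ t ∧ r' ≠ t' →
        s(x, r) ≠ k → s(y, r') ≠ k → False := by
      intro r r' hrr hr hr' k1 k2
      refine hH'.noM5 hC (M5_of_list (a := t) (b := a) (c := p) (d := x) (e := y) (a' := t') (b' := b) (c' := q) (d' := r)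
        (e' := r') ?_ (swp_adj.2 (Or.inr ⟨rfl, htt.ne⟩)) (swp_adj.2 (Or.inl ⟨hab, hab'⟩)) (swp_adj.2 (Or.inl ⟨hpq, hpq'⟩))
        (swp_adj.2 (Or.inl ⟨(hfull' r hr.1.1 hr.1.2).1.symm, k1⟩)) (swp_adj.2 (Or.inl ⟨(hfull' r' hr'.1.1 hr'.1.2).2.symm, k2⟩)))
      have := htt.ne
      have := hab.ne
      have := hpq.ne
      have hdj := disjoint_left.1 hd
      clear hfull hfull' hconn hcount hm hsle hT T h15 hWc hU
      simp only [List.nodup_cons, List.mem_cons, not_or, List.not_mem_nil, not_false_eq_true, and_true, List.nodup_nil]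
      refine ⟨⟨?_, ?_, ?_, ?_, ?_, ?_, ?_, ?_, ?_⟩, ⟨?_, ?_, ?_, ?_, ?_, ?_, ?_, ?_⟩, ⟨?_, ?_, ?_, ?_, ?_, ?_, ?_⟩, ⟨?_, ?_, ?_, ?_, ?_, ?_⟩,
       ⟨?_, ?_, ?_, ?_, ?_⟩, ⟨?_, ?_, ?_, ?_⟩, ⟨?_, ?_, ?_⟩, ⟨?_, ?_⟩, ?_⟩ <;> first | assumption | (symm; assumption) | (rintro rfl; tauto)
    by_cases b1 : s(x, r) = k
    · refine key r' r hrr.symm hr' hr ?_ ?_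
      · rw [← b1]; intro hh; simp at hh; grind
      · rw [← b1]; intro hh; simp at hh; grind
    · by_cases b2 : s(y, r') = k
      · refine key r' r hrr.symm hr' hr ?_ ?_
        · rw [← b2]; intro hh; simp at hh; grind
        · rw [← b2]; intro hh; simp at hh; grind
      · exact key r r' hrr hr hr' b1 b2
  · push Not at hg
    have hCn : ∀ t t', G.Adj t t' → t ∉ S → t' ∉ S → t ∉ C → t' ∈ C := by
      intro t t' h1 h2 h3 h4; by_contra h5; exact h5 (hg t t' h1 h2 h3 h4)
    have hCS : ∀ v ∈ C, v ∉ S := fun v hv => disjoint_right.1 hd hv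
    obtain ⟨c0, hc0⟩ := card_pos.1 (show 0 < C.card by omega)
    have hatt : ∀ t, t ∉ S → t ∉ C → ∃ o ∈ C, G.Adj t o := by
      intro t h1 h2
      by_contra hcon
      push Not at hcon
      have := (hconn t c0 h1 (hCS c0 hc0)).closed (fun v => v = t) (by
        rintro a b ha hb hab rfl
        exact absurd hab (hcon b (hCn a b hab h1 (by simpa using hb) h2))) rfl
      exact h2 (this ▸ hc0)
    have hCconn : Conn G (C : Set V) := by
      refine Conn.of_root (x := c0) (by simpa using hc0) ?_
      intro d hd'
      have hdC : d ∈ C := by simpa using hd'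
      have := (hconn c0 d (hCS c0 hc0) (hCS d hdC)).closed (fun v => (v ∈ C → Reach G (C : Set V) c0 v) ∧
        (v ∉ C → v ∉ S → ∃ o ∈ C, G.Adj v o ∧ Reach G (C : Set V) c0 o)) ?_ ?_
      · exact this.1 hdC
      · rintro a b ha hb hab ⟨hp1, hp2⟩
        have ha' : a ∉ S := by simpa using ha
        have hb' : b ∉ S := by simpa using hb
        by_cases haC : a ∈ C
        · refine ⟨fun hbC => (hp1 haC).trans (Reach.of_adj haC hbC hab), fun hbC hbS => ⟨a, haC, hab.symm, hp1 haC⟩⟩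
        · have hbC := hCn a b hab ha' hb' haC
          refine ⟨fun _ => ?_, fun hh => absurd hbC hh⟩
          obtain ⟨o, ho, hao, hro⟩ := hp2 haC ha'
          have hne : ∀ o ∈ C, lab C ∅ a ≠ lab C ∅ o := by
            intro o ho hh
            rw [lab_eq (by simp)] at hh
            rcases hh with rfl | hh | hh
            · exact haC ho
            · exact haC hh.1
            · simp at hh
          have := T.inj (mem_IE.2 ⟨hab, ha', hb', hne b hbC⟩) (mem_IE.2 ⟨hao, ha', hCS o ho, hne o ho⟩) (by
            simp only [Sym2.map_mk]
            rw [(lab_eq (by simp)).2 (Or.inr (Or.inl ⟨hbC, ho⟩))])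
          simp only [Sym2.eq_iff] at this
          rcases this with ⟨-, rfl⟩ | ⟨rfl, rfl⟩
          · exact hro
          · exact absurd ho haC
      · exact ⟨fun _ => Reach.refl (by simpa using hc0), fun h => absurd hc0 h⟩
    obtain ⟨t1, ht1, t2, ht2, t3, ht3, h12, h13, h23⟩ := two_lt_card.1 (show 2 < (S ∪ C)ᶜ.card by omega)
    simp only [mem_compl, mem_union, not_or] at ht1 ht2 ht3
    have f1 := hfull' t1 ht1.1 ht1.2
    have f2 := hfull' t2 ht2.1 ht2.2
    have f3 := hfull' t3 ht3.1 ht3.2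
    have A : ∀ t, t ∉ S → t ∉ C → Tch G (C : Set V) {t} := by
      intro t h1 h2
      obtain ⟨o, ho, h⟩ := hatt t h1 h2
      exact ⟨o, by simpa using ho, t, rfl, h.symm⟩
    refine hC.vk.noK33_two hxy hCconn (Conn.singleton t1) (Conn.singleton t2) (Conn.singleton t3)
      (by simpa using hxC) (by simpa using hyC) ?_ ?_ ?_ ?_ ?_ ?_
      (by simpa using ht1.2) (by simpa using ht2.2) (by simpa using ht3.2) (by simpa) (by simpa) (by simpa)
      ⟨_, rfl, hH.le f1.1.symm⟩ ⟨_, rfl, hH.le f2.1.symm⟩ ⟨_, rfl, hH.le f3.1.symm⟩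
      ⟨_, rfl, hH.le f1.2.symm⟩ ⟨_, rfl, hH.le f2.2.symm⟩ ⟨_, rfl, hH.le f3.2.symm⟩
      (A t1 ht1.1 ht1.2) (A t2 ht2.1 ht2.2) (A t3 ht3.1 ht3.2)
    · simpa using f1.1.ne'
    · simpa using f2.1.ne'
    · simpa using f3.1.ne'
    · simpa using f1.2.ne'
    · simpa using f2.2.ne'
    · simpa using f3.2.ne'

end StepBa2

set_option linter.unusedSectionVars false
set_option linter.unusedVariables false

section StepBb
open Finset
variable {V : Type} [Fintype V] [DecidableEq V]
variable {G H : SimpleGraph V} {c : Sym2 V → ℕ}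

def MissOne (H : SimpleGraph V) (X : Finset V) : Prop :=
  ∀ u ∈ X, ∀ v ∈ X, ∀ u' ∈ X, ∀ v' ∈ X, u ≠ v → u' ≠ v' → ¬ H.Adj u v → ¬ H.Adj u' v' → s(u, v) = s(u', v')

lemma missOne_of_card {X : Finset V} (hX : X.card = 5) (h : 9 ≤ (EIn H X).card) : MissOne H X := by
  intro u hu v hv u' hu' v' hv' h1 h2 h3 h4
  by_contra hne
  have hle := EIn_sub_choose (G := (⊤ : SimpleGraph V)) X
  have : insert s(u, v) (insert s(u', v') (EIn H X)) ⊆ EIn ⊤ X := by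
    refine insert_subset (mk_mem_EIn.2 ⟨h1, hu, hv⟩) (insert_subset (mk_mem_EIn.2 ⟨h2, hu', hv'⟩) (EIn_mono_left le_top))
  have := card_le_card this
  rw [card_insert_of_notMem, card_insert_of_notMem] at this
  · rw [hX] at hle
    have : Nat.choose 5 2 = 10 := rfl
    omega
  · intro hh; exact h4 (mk_mem_EIn.1 hh).1
  · rw [mem_insert]; rintro (hh | hh)
    · exact hne hh
    · exact h3 (mk_mem_EIn.1 hh).1

lemma MissOne.tri {X A : Finset V} (h : MissOne H X) (hAX : A ⊆ X) (hA : A.card = 3) (k : Sym2 V) :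
    ∃ u ∈ A, ∃ v ∈ A, H.Adj u v ∧ s(u, v) ≠ k := by
  obtain ⟨a, b, d, hab, had, hbd, rfl⟩ := card_eq_three.1 hA
  simp only [insert_subset_iff, singleton_subset_iff] at hAX
  obtain ⟨ma, mb, md⟩ := hAX
  by_contra hcon
  push Not at hcon
  have i1 := hcon a (by simp) b (by simp)
  have i2 := hcon a (by simp) d (by simp)
  have i3 := hcon b (by simp) d (by simp)
  have n1 : s(a, b) ≠ s(a, d) := by simp; grind
  have n2 : s(a, b) ≠ s(b, d) := by simp; grind
  have n3 : s(a, d) ≠ s(b, d) := by simp; grind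
  have m1 := h a ma b mb a ma d md hab had
  have m2 := h a ma b mb b mb d md hab hbd
  have m3 := h a ma d md b mb d md had hbd
  clear hcon h
  generalize s(a,b) = k4 at *
  generalize s(a,d) = k5 at *
  generalize s(b,d) = k6 at *
  clear hA ma mb md hab had hbd
  by_cases t4 : H.Adj a b <;> by_cases t5 : H.Adj a d <;> by_cases t6 : H.Adj b d <;>
  simp only [t4, t5, t6, true_implies, false_implies, not_true_eq_false, not_false_eq_true] at * <;> grind

lemma MissOne.k4 {X B : Finset V} (h : MissOne H X) (hBX : B ⊆ X) (hB : B.card = 3) {z : V} (hz : z ∈ X)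
    (hzB : z ∉ B) (k : Sym2 V) :
    ∃ b ∈ B, ∃ p ∈ B, ∃ q ∈ B, b ≠ p ∧ b ≠ q ∧ p ≠ q ∧ H.Adj z b ∧ H.Adj p q ∧ s(z, b) ≠ k ∧ s(p, q) ≠ k := by
  obtain ⟨a, b, d, hab, had, hbd, rfl⟩ := card_eq_three.1 hB
  simp only [insert_subset_iff, singleton_subset_iff] at hBX
  obtain ⟨ma, mb, md⟩ := hBX
  simp only [mem_insert, mem_singleton, not_or] at hzB
  obtain ⟨za, zb, zd⟩ := hzB
  by_contra hcon
  push Not at hcon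
  have i1 := hcon a (by simp) b (by simp) d (by simp) hab had hbd
  have i2 := hcon b (by simp) a (by simp) d (by simp) hab.symm hbd had
  have i3 := hcon d (by simp) a (by simp) b (by simp) had.symm hbd.symm hab
  clear hcon
  have m1 := h z hz a ma z hz b mb za zb
  have m2 := h z hz a ma z hz d md za zd
  have m3 := h z hz b mb z hz d md zb zd
  have m4 := h z hz a ma a ma d md za had
  have m5 := h z hz a ma a ma b mb za hab
  have m6 := h z hz b mb b mb d md zb hbd
  have m7 := h z hz b mb a ma b mb zb hab
  have m8 := h z hz d md b mb d md zd hbd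
  have m9 := h z hz d md a ma d md zd had
  have m10 := h a ma b mb a ma d md hab had
  have m11 := h a ma b mb b mb d md hab hbd
  have m12 := h a ma d md b mb d md had hbd
  clear h
  have e1 : s(z,a) ≠ s(z,b) := by simp; grind
  have e2 : s(z,a) ≠ s(z,d) := by simp; grind
  have e3 : s(z,b) ≠ s(z,d) := by simp; grind
  have e4 : s(z,a) ≠ s(a,d) := by simp; grind
  have e5 : s(z,a) ≠ s(a,b) := by simp; grind
  have e6 : s(z,b) ≠ s(b,d) := by simp; grind
  have e7 : s(z,b) ≠ s(a,b) := by simp; grind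
  have e8 : s(z,d) ≠ s(b,d) := by simp; grind
  have e9 : s(z,d) ≠ s(a,d) := by simp; grind
  have e10 : s(a,b) ≠ s(a,d) := by simp; grind
  have e11 : s(a,b) ≠ s(b,d) := by simp; grind
  have e12 : s(a,d) ≠ s(b,d) := by simp; grind
  generalize s(z,a) = k1 at *
  generalize s(z,b) = k2 at *
  generalize s(z,d) = k3 at *
  generalize s(a,b) = k4 at *
  generalize s(a,d) = k5 at *
  generalize s(b,d) = k6 at *
  clear hab had hbd za zb zd hz ma mb md hB
  have i1' : ¬ H.Adj z a ∨ ¬ H.Adj b d ∨ k1 = k ∨ k6 = k := by by_contra hh; push Not at hh; exact hh.2.2.2 (i1 hh.1 hh.2.1 hh.2.2.1)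
  have i2' : ¬ H.Adj z b ∨ ¬ H.Adj a d ∨ k2 = k ∨ k5 = k := by by_contra hh; push Not at hh; exact hh.2.2.2 (i2 hh.1 hh.2.1 hh.2.2.1)
  have i3' : ¬ H.Adj z d ∨ ¬ H.Adj a b ∨ k3 = k ∨ k4 = k := by by_contra hh; push Not at hh; exact hh.2.2.2 (i3 hh.1 hh.2.1 hh.2.2.1)
  clear i1 i2 i3
  rcases i1' with i1 | i1 | i1 | i1 <;> rcases i2' with i2 | i2 | i2 | i2 <;> rcases i3' with i3 | i3 | i3 | i3 <;>
  grind

/-- the final configuration of case (2,3,3) -/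
structure BB (G H : SimpleGraph V) (x y : V) (A B : Finset V) : Prop where
  xy : H.Adj x y
  xA : x ∉ A
  yA : y ∉ A
  xB : x ∉ B
  yB : y ∉ B
  cA : A.card = 3
  cB : B.card = 3
  dj : Disjoint A B
  mA : MissOne H (insert x (insert y A))
  mB : MissOne H (insert x (insert y B))
  full : ∀ t, t ≠ x → t ≠ y → t ∉ A → t ∉ B → H.Adj x t ∧ H.Adj y t

def Sg (x y : V) (A B : Finset V) (t : V) : Prop := t ≠ x ∧ t ≠ y ∧ t ∉ A ∧ t ∉ B

lemma BB.symm {x y : V} {A B : Finset V} (h : BB G H x y A B) : BB G H x y B A :=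
  ⟨h.xy, h.xB, h.yB, h.xA, h.yA, h.cB, h.cA, h.dj.symm, h.mB, h.mA, fun t h1 h2 h3 h4 => h.full t h1 h2 h4 h3⟩

lemma BB.symm' {x y : V} {A B : Finset V} (h : BB G H x y A B) : BB G H y x A B :=
  ⟨h.xy.symm, h.yA, h.xA, h.yB, h.xB, h.cA, h.cB, h.dj, by rw [insert_comm]; exact h.mA, by rw [insert_comm]; exact h.mB,
    fun t h1 h2 h3 h4 => (h.full t h2 h1 h3 h4).symm⟩

lemma BB.many {x y : V} {A B : Finset V} (hC : Ctx G c) (h : BB G H x y A B) (D : Finset V) (m : ℕ) (hD : D.card + m ≤ 3) :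
    ∃ R : Finset V, R.card = m ∧ ∀ r ∈ R, Sg x y A B r ∧ r ∉ D := by
  have := hC.n11
  have e1 := card_compl_add_card (D ∪ (A ∪ (B ∪ {x, y})))
  have e2 := card_union_le D (A ∪ (B ∪ {x, y}))
  have e3 := card_union_le A (B ∪ {x, y})
  have e4 := card_union_le B {x, y}
  have e5 := card_le_two (a := x) (b := y)
  have := h.cA
  have := h.cB
  obtain ⟨R, hR, hRc⟩ := exists_subset_card_eq (s := (D ∪ (A ∪ (B ∪ {x, y})))ᶜ) (n := m) (by omega)
  refine ⟨R, hRc, fun r hr => ?_⟩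
  have := hR hr
  simp only [mem_compl, mem_union, not_or, mem_insert, mem_singleton] at this
  unfold Sg; tauto

/-- no G-edge between two singles -/
lemma BB.noSS {x y : V} {A B : Finset V} (hC : Ctx G c) (hH : Hyp G c H) (h : BB G H x y A B) {t t' : V}
    (ht : Sg x y A B t) (ht' : Sg x y A B t') (hg : G.Adj t t') : False := by
  obtain ⟨k, hk, hck⟩ := hH.all s(t, t') (by simpa using hg)
  have hH' := hH.swap (g := s(t, t')) (by simpa using hg) hk hck
  obtain ⟨R, hR, hR'⟩ := h.many hC {t, t'} 1 (by have := card_le_two (a := t) (b := t'); omega)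
  obtain ⟨r, rfl⟩ := card_eq_one.1 hR
  obtain ⟨hr, hr'⟩ := hR' r (by simp)
  simp only [mem_insert, mem_singleton, not_or] at hr'
  have key : ∀ x y, BB G H x y A B → Sg x y A B t → Sg x y A B t' → Sg x y A B r → s(x, r) ≠ k → False := by
    intro x y h ht ht' hr hk'
    obtain ⟨b, hb, p, hp, q, hq, n1, n2, n3, j1, j2, l1, l2⟩ := h.mB.k4 (B := B) (by intro v hv; simp [hv]) h.cB (z := y) (by simp) h.yB k
    obtain ⟨u, hu, v, hv, j3, l3⟩ := h.mA.tri (A := A) (by intro v hv; simp [hv]) h.cA k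
    refine hH'.noM5 hC (M5_of_list (a := t) (b := x) (c := y) (d := p) (e := u) (a' := t') (b' := r) (c' := b) (d' := q)
        (e' := v) ?_ (swp_adj.2 (Or.inr ⟨rfl, hg.ne⟩)) (swp_adj.2 (Or.inl ⟨(h.full r hr.1 hr.2.1 hr.2.2.1 hr.2.2.2).1, hk'⟩))
        (swp_adj.2 (Or.inl ⟨j1, l1⟩)) (swp_adj.2 (Or.inl ⟨j2, l2⟩)) (swp_adj.2 (Or.inl ⟨j3, l3⟩)))
    have hdj := disjoint_left.1 h.dj
    have := hg.ne
    have := j3.ne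
    have := h.xy.ne
    obtain ⟨-, xA, yA, xB, yB, -⟩ := h
    clear hR' hR hH' hC hH j1 j2 j3 l1 l2 l3 hk hck
    unfold Sg at *
    simp only [List.nodup_cons, List.mem_cons, not_or, List.not_mem_nil, not_false_eq_true, and_true, List.nodup_nil]
    refine ⟨⟨?_, ?_, ?_, ?_, ?_, ?_, ?_, ?_, ?_⟩, ⟨?_, ?_, ?_, ?_, ?_, ?_, ?_, ?_⟩, ⟨?_, ?_, ?_, ?_, ?_, ?_, ?_⟩, ⟨?_, ?_, ?_, ?_, ?_, ?_⟩,
       ⟨?_, ?_, ?_, ?_, ?_⟩, ⟨?_, ?_, ?_, ?_⟩, ⟨?_, ?_, ?_⟩, ⟨?_, ?_⟩, ?_⟩ <;> first | assumption | (rintro rfl; tauto)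
  by_cases b1 : s(x, r) = k
  · refine key y x h.symm' ⟨ht.2.1, ht.1, ht.2.2⟩ ⟨ht'.2.1, ht'.1, ht'.2.2⟩ ⟨hr.2.1, hr.1, hr.2.2⟩ ?_
    rw [← b1]; intro hh; simp at hh; have := h.xy.ne; have := hr.1; grind
  · exact key x y h ht ht' hr b1

end StepBb

set_option linter.unusedSectionVars false
set_option linter.unusedVariables false

section StepBb2
open Finset
variable {V : Type} [Fintype V] [DecidableEq V]
variable {G H : SimpleGraph V} {c : Sym2 V → ℕ}

lemma three_split {A : Finset V} (hA : A.card = 3) {a : V} (ha : a ∈ A) :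
    ∃ p q, a ≠ p ∧ a ≠ q ∧ p ≠ q ∧ A = {a, p, q} := by
  obtain ⟨p, q, hpq, h⟩ := card_eq_two.1 (show (A.erase a).card = 2 by rw [card_erase_of_mem ha, hA])
  have hp : p ∈ A.erase a := by rw [h]; simp
  have hq : q ∈ A.erase a := by rw [h]; simp
  refine ⟨p, q, (ne_of_mem_erase hp).symm, (ne_of_mem_erase hq).symm, hpq, ?_⟩
  rw [← h, insert_erase ha]

lemma BB.AI {x y : V} {A B : Finset V} (hC : Ctx G c) (hH : Hyp G c H) (h : BB G H x y A B) {t a p q : V}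
    (ht : Sg x y A B t) (hA : A = {a, p, q}) (nap : a ≠ p) (naq : a ≠ q) (npq : p ≠ q)
    (hg : G.Adj t a) : H.Adj p q ∧ c s(p, q) = c s(t, a) := by
  have ma : a ∈ A := by simp [hA]
  have mp : p ∈ A := by simp [hA]
  have mq : q ∈ A := by simp [hA]
  have hpq : H.Adj p q := by
    by_contra hno
    have F : ∀ u ∈ insert x (insert y A), ∀ v ∈ insert x (insert y A), u ≠ v → s(p, q) ≠ s(u, v) → H.Adj u v := by
      intro u hu v hv huv hne
      by_contra hh
      exact hne (h.mA p (by simp [mp]) q (by simp [mq]) u hu v hv npq huv hno hh)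
    have xp : x ≠ p := fun e => h.xA (e ▸ mp)
    have xq : x ≠ q := fun e => h.xA (e ▸ mq)
    have yp : y ≠ p := fun e => h.yA (e ▸ mp)
    have yq : y ≠ q := fun e => h.yA (e ▸ mq)
    have xa : x ≠ a := fun e => h.xA (e ▸ ma)
    have ya : y ≠ a := fun e => h.yA (e ▸ ma)
    have tp : t ≠ p := fun e => ht.2.2.1 (e ▸ mp)
    have tq : t ≠ q := fun e => ht.2.2.1 (e ▸ mq)
    have ft := h.full t ht.1 ht.2.1 ht.2.2.1 ht.2.2.2
    refine hC.vk.noK33_vert (x := x) (y := y) (z := a) (p := p) (q := q) (r := t) h.xy.ne xa ya npq tp.symm tq.symm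
      (hH.le (F x (by simp) p (by simp [mp]) xp ?_)) (hH.le (F x (by simp) q (by simp [mq]) xq ?_)) (hH.le ft.1)
      (hH.le (F y (by simp) p (by simp [mp]) yp ?_)) (hH.le (F y (by simp) q (by simp [mq]) yq ?_)) (hH.le ft.2)
      (hH.le (F a (by simp [ma]) p (by simp [mp]) nap ?_)) (hH.le (F a (by simp [ma]) q (by simp [mq]) naq ?_)) hg.symm
    all_goals simp only [ne_eq, Sym2.eq_iff]; grind
  refine ⟨hpq, ?_⟩
  obtain ⟨k, hk, hck⟩ := hH.all s(t, a) (by simpa using hg)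
  by_cases hkp : s(p, q) = k
  · rw [hkp, hck]
  exfalso
  have hH' := hH.swap (g := s(t, a)) (by simpa using hg) hk hck
  obtain ⟨R, hR, hR'⟩ := h.many hC {t} 2 (by simp)
  obtain ⟨r, r', hrr, rfl⟩ := card_eq_two.1 hR
  obtain ⟨hr, hr1⟩ := hR' r (by simp)
  obtain ⟨hr', hr1'⟩ := hR' r' (by simp)
  rw [mem_singleton] at hr1 hr1'
  obtain ⟨u, hu, v, hv, j3, l3⟩ := h.mB.tri (A := B) (by intro v hv; simp [hv]) h.cB k
  have key : ∀ r r', r ≠ r' → Sg x y A B r → Sg x y A B r' → r ≠ t → r' ≠ t → s(x, r) ≠ k → s(y, r') ≠ k → False := by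
    intro r r' hrr hr hr' hr1 hr1' k1 k2
    refine hH'.noM5 hC (M5_of_list (a := t) (b := x) (c := y) (d := p) (e := u) (a' := a) (b' := r) (c' := r') (d' := q)
        (e' := v) ?_ (swp_adj.2 (Or.inr ⟨rfl, hg.ne⟩)) (swp_adj.2 (Or.inl ⟨(h.full r hr.1 hr.2.1 hr.2.2.1 hr.2.2.2).1, k1⟩))
        (swp_adj.2 (Or.inl ⟨(h.full r' hr'.1 hr'.2.1 hr'.2.2.1 hr'.2.2.2).2, k2⟩))
        (swp_adj.2 (Or.inl ⟨hpq, hkp⟩)) (swp_adj.2 (Or.inl ⟨j3, l3⟩)))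
    have hdj := disjoint_left.1 h.dj
    have := hg.ne
    have := j3.ne
    have := h.xy.ne
    obtain ⟨-, xA, yA, xB, yB, -⟩ := h
    clear hR' hR hH' hC hH j3 l3 hk hck hA
    unfold Sg at *
    simp only [List.nodup_cons, List.mem_cons, not_or, List.not_mem_nil, not_false_eq_true, and_true, List.nodup_nil]
    refine ⟨⟨?_, ?_, ?_, ?_, ?_, ?_, ?_, ?_, ?_⟩, ⟨?_, ?_, ?_, ?_, ?_, ?_, ?_, ?_⟩, ⟨?_, ?_, ?_, ?_, ?_, ?_, ?_⟩, ⟨?_, ?_, ?_, ?_, ?_, ?_⟩,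
       ⟨?_, ?_, ?_, ?_, ?_⟩, ⟨?_, ?_, ?_, ?_⟩, ⟨?_, ?_, ?_⟩, ⟨?_, ?_⟩, ?_⟩ <;> first | assumption | (rintro rfl; tauto)
  have nxy := h.xy.ne
  have z1 := hr.1
  have z2 := hr.2.1
  have z3 := hr'.1
  have z4 := hr'.2.1
  by_cases b1 : s(x, r) = k
  · refine key r' r hrr.symm hr' hr hr1' hr1 ?_ ?_ <;>
    · rw [← b1]; intro hh; simp only [Sym2.eq_iff] at hh; grind
  · by_cases b2 : s(y, r') = k
    · refine key r' r hrr.symm hr' hr hr1' hr1 ?_ ?_ <;>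
      · rw [← b2]; intro hh; simp only [Sym2.eq_iff] at hh; grind
    · exact key r r' hrr hr hr' hr1 hr1' b1 b2

set_option maxHeartbeats 2000000 in
lemma BB.AI2 {x y : V} {A B : Finset V} (hC : Ctx G c) (hH : Hyp G c H) (h : BB G H x y A B) {t a t' a' : V}
    (ht : Sg x y A B t) (ht' : Sg x y A B t') (ha : a ∈ A) (ha' : a' ∈ A) (htt : t ≠ t')
    (hg : G.Adj t a) (hg' : G.Adj t' a') : False := by
  have xA := h.xA
  have yA := h.yA
  by_cases haa : a = a'
  · subst haa
    obtain ⟨p, q, h1, h2, h3, hA⟩ := three_split h.cA ha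
    obtain ⟨hpq, -⟩ := h.AI hC hH ht hA h1 h2 h3 hg
    have mp : p ∈ A := by simp [hA]
    have mq : q ∈ A := by simp [hA]
    have F : ∀ z ∈ insert x (insert y A), z ≠ p → z ≠ q → ∃ o ∈ ({p, q} : Set V), G.Adj z o := by
      intro z hz n1 n2
      by_contra hcon
      push Not at hcon
      have w1 : ¬ H.Adj z p := fun e => hcon p (by simp) (hH.le e)
      have w2 : ¬ H.Adj z q := fun e => hcon q (by simp) (hH.le e)
      have := h.mA z hz p (by simp [mp]) z hz q (by simp [mq]) n1 n2 w1 w2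
      simp only [Sym2.eq_iff] at this
      grind
    have xp : x ≠ p := fun e => h.xA (e ▸ mp)
    have xq : x ≠ q := fun e => h.xA (e ▸ mq)
    have yp : y ≠ p := fun e => h.yA (e ▸ mp)
    have yq : y ≠ q := fun e => h.yA (e ▸ mq)
    have xa : x ≠ a := fun e => h.xA (e ▸ ha)
    have ya : y ≠ a := fun e => h.yA (e ▸ ha)
    have tp : ∀ t ∉ A, t ≠ p := fun t ht e => ht (e ▸ mp)
    have tq : ∀ t ∉ A, t ≠ q := fun t ht e => ht (e ▸ mq)
    have ft := h.full t ht.1 ht.2.1 ht.2.2.1 ht.2.2.2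
    have ft' := h.full t' ht'.1 ht'.2.1 ht'.2.2.1 ht'.2.2.2
    refine hC.vk.noK33_three (x := x) (y := y) (z := a) h.xy.ne xa ya (Conn.singleton t) (Conn.singleton t') (Conn.pair (hH.le hpq))
      (by simpa using ht.1.symm) (by simpa using ht'.1.symm) (by simp [xp, xq])
      (by simpa using ht.2.1.symm) (by simpa using ht'.2.1.symm) (by simp [yp, yq])
      (by simpa using hg.ne') (by simpa using hg'.ne') (by simp [h1, h2])
      (by simpa using htt) (by simp [tp t ht.2.2.1, tq t ht.2.2.1]) (by simp [tp t' ht'.2.2.1, tq t' ht'.2.2.1])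
      ⟨_, rfl, hH.le ft.1⟩ ⟨_, rfl, hH.le ft'.1⟩ (F x (by simp) xp xq)
      ⟨_, rfl, hH.le ft.2⟩ ⟨_, rfl, hH.le ft'.2⟩ (F y (by simp) yp yq)
      ⟨_, rfl, hg.symm⟩ ⟨_, rfl, hg'.symm⟩ (F a (by simp [ha]) h1 h2)
  · obtain ⟨p, q, h1, h2, h3, hA⟩ := three_split h.cA ha
    -- third vertex
    obtain ⟨d, nad, nad', hA1⟩ : ∃ d, a ≠ d ∧ a' ≠ d ∧ A = {a, a', d} := by
      rw [hA] at ha'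
      simp only [mem_insert, mem_singleton] at ha'
      rcases ha' with rfl | rfl | rfl
      · exact absurd rfl haa
      · exact ⟨q, h2, h3, hA⟩
      · exact ⟨p, h1, h3.symm, by rw [hA]; congr 1; exact pair_comm _ _⟩
    have hA2 : A = {a', a, d} := by rw [hA1]; exact insert_comm _ _ _
    obtain ⟨e1, c1⟩ := h.AI hC hH ht hA1 haa nad nad' hg
    obtain ⟨e2, c2⟩ := h.AI hC hH ht' hA2 (Ne.symm haa) nad' nad hg'
    have md : d ∈ A := by simp [hA1]
    have hne : s(a, d) ≠ s(a', d) := by simp only [ne_eq, Sym2.eq_iff]; grind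
    have hH1 := hH.swap (g := s(t, a)) (by simpa using hg) (h := s(a', d)) (by simpa using e1) c1
    have hH2 := hH1.swap (g := s(t', a')) (by simpa using hg') (h := s(a, d)) (by
      rw [SimpleGraph.mem_edgeSet]; exact swp_adj.2 (Or.inl ⟨e2, hne⟩)) c2
    have K : ∀ u v, H.Adj u v → ¬ (u ∈ A ∧ v ∈ A) → (swp (swp H s(a', d) s(t, a)) s(a, d) s(t', a')).Adj u v := by
      intro u v huv hn
      refine swp_adj.2 (Or.inl ⟨swp_adj.2 (Or.inl ⟨huv, ?_⟩), ?_⟩)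
      · rw [Ne, Sym2.eq_iff]; rintro (⟨rfl, rfl⟩ | ⟨rfl, rfl⟩) <;> tauto
      · rw [Ne, Sym2.eq_iff]; rintro (⟨rfl, rfl⟩ | ⟨rfl, rfl⟩) <;> tauto
    obtain ⟨R, hR, hR'⟩ := h.many hC {t, t'} 1 (by have := card_le_two (a := t) (b := t'); omega)
    obtain ⟨r, rfl⟩ := card_eq_one.1 hR
    obtain ⟨hr, hr'⟩ := hR' r (by simp)
    simp only [mem_insert, mem_singleton, not_or] at hr'
    have hdj := disjoint_left.1 h.dj
    obtain ⟨u, hu, v, hv, j3, -⟩ := h.mB.tri (A := B) (by intro v hv; simp [hv]) h.cB s(a, a)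
    have key : ∀ x y, BB G H x y A B → Sg x y A B t → Sg x y A B t' → Sg x y A B r → H.Adj x d → False := by
      intro x y h ht ht' hr hxd
      have xA := h.xA
      have yA := h.yA
      refine hH2.noM5 hC (M5_of_list (a := t) (b := t') (c := x) (d := y) (e := u) (a' := a) (b' := a') (c' := d) (d' := r)
        (e' := v) ?_ (swp_adj.2 (Or.inl ⟨swp_adj.2 (Or.inr ⟨rfl, hg.ne⟩), ?_⟩)) (swp_adj.2 (Or.inr ⟨rfl, hg'.ne⟩))
         (K _ _ hxd (by tauto)) (K _ _ (h.full r hr.1 hr.2.1 hr.2.2.1 hr.2.2.2).2 (by tauto)) (K _ _ j3 (fun hh => hdj hh.1 hu)))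
      · have := hg.ne
        have := j3.ne
        have := hg'.ne
        have := h.xy.ne
        obtain ⟨-, xA, yA, xB, yB, -⟩ := h
        clear hR' hR hC hH j3 hA hA1 hA2 hH1 hH2 K
        unfold Sg at *
        simp only [List.nodup_cons, List.mem_cons, not_or, List.not_mem_nil, not_false_eq_true, and_true, List.nodup_nil]
        refine ⟨⟨?_, ?_, ?_, ?_, ?_, ?_, ?_, ?_, ?_⟩, ⟨?_, ?_, ?_, ?_, ?_, ?_, ?_, ?_⟩, ⟨?_, ?_, ?_, ?_, ?_, ?_, ?_⟩, ⟨?_, ?_, ?_, ?_, ?_, ?_⟩,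
         ⟨?_, ?_, ?_, ?_, ?_⟩, ⟨?_, ?_, ?_, ?_⟩, ⟨?_, ?_, ?_⟩, ⟨?_, ?_⟩, ?_⟩ <;> first | assumption | (rintro rfl; tauto)
      · have := ht.2.2.1
        rw [Ne, Sym2.eq_iff]; rintro (⟨e, -⟩ | ⟨e, -⟩)
        · exact this (e ▸ ha)
        · exact this (e ▸ md)
    by_cases hxd : H.Adj x d
    · exact key x y h ht ht' hr hxd
    · have xd : x ≠ d := fun e => h.xA (e ▸ md)
      have yd : y ≠ d := fun e => h.yA (e ▸ md)
      refine key y x h.symm' ⟨ht.2.1, ht.1, ht.2.2⟩ ⟨ht'.2.1, ht'.1, ht'.2.2⟩ ⟨hr.2.1, hr.1, hr.2.2⟩ ?_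
      by_contra hyd
      have := h.mA x (by simp) d (by simp [md]) y (by simp) d (by simp [md]) xd yd hxd hyd
      rw [Sym2.eq_iff] at this
      have := h.xy.ne
      grind

end StepBb2

set_option linter.unusedSectionVars false
set_option linter.unusedVariables false

section StepBb3
open Finset
variable {V : Type} [Fintype V] [DecidableEq V]
variable {G H : SimpleGraph V} {c : Sym2 V → ℕ}

lemma k5minus {S A : Finset V} {x y t : V} (hG : VK H) (hA : A.card = 3) (hxy : x ≠ y) (hS : S = {x, y})
    (hd : Disjoint S A) (h9 : 9 ≤ (EIn H (S ∪ A)).card) (hno : ¬ H.Adj x y) (hx : H.Adj t x) (hy : H.Adj t y)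
    (ht : t ∉ A) : False := by
  have hxA : x ∉ A := disjoint_left.1 hd (by simp [hS])
  have hyA : y ∉ A := disjoint_left.1 hd (by simp [hS])
  have hM := missOne_of_card (H := H) (X := S ∪ A) (by rw [card_union_of_disjoint hd, hA, hS, card_pair hxy]) h9
  have F : ∀ u ∈ S ∪ A, ∀ v ∈ A, u ≠ v → H.Adj u v := by
    intro u hu v hv huv
    by_contra hh
    have := hM x (by simp [hS]) y (by simp [hS]) u hu v (by simp [hv]) hxy huv hno hh
    rw [Sym2.eq_iff] at this
    rcases this with ⟨-, rfl⟩ | ⟨rfl, -⟩ <;> tauto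
  obtain ⟨a, b, d, hab, had, hbd, rfl⟩ := card_eq_three.1 hA
  simp only [mem_insert, mem_singleton, not_or] at hxA hyA ht
  refine hG.noK5 (a := a) (b := b) (c := d) (d := x) (Z := {y, t}) (Conn.pair hy.symm)
    (by simp; grind) (by simp; grind) (by simp; grind) (by simp [hxy, hx.ne'])
    (F a (by simp) b (by simp) hab) (F a (by simp) d (by simp) had) (F x (by simp [hS]) a (by simp) (by tauto)).symm
    (F b (by simp) d (by simp) hbd) (F x (by simp [hS]) b (by simp) (by tauto)).symm (F x (by simp [hS]) d (by simp) (by tauto)).symm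
    ⟨y, by simp, (F y (by simp [hS]) a (by simp) (by tauto)).symm⟩ ⟨y, by simp, (F y (by simp [hS]) b (by simp) (by tauto)).symm⟩
    ⟨y, by simp, (F y (by simp [hS]) d (by simp) (by tauto)).symm⟩ ⟨t, by simp, hx.symm⟩

set_option maxHeartbeats 2000000 in
lemma stepBb (hC : Ctx G c) (hH : Hyp G c H) {S A B : Finset V} (hS : S.card = 2) (hA : A.card = 3)
    (hB : B.card = 3) (h1 : Disjoint S A) (h2 : Disjoint S B) (h3 : Disjoint A B) (h : Cov H S A B) : False := by
  have hn := hC.n11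
  have hvk := hH.vk hC
  have T := tight2 hC hH h h1 h2 h3 hS (by simp [hA, hB])
  obtain ⟨W, hW⟩ : ∃ W, W = S ∪ (A ∪ B) := ⟨_, rfl⟩
  have hcount := cov2_count h hS h1 h2 h3 W hW
  have hWc := card_compl_add_card W
  have hWcard : W.card = 8 := by
    rw [hW, card_union_of_disjoint (disjoint_union_right.2 ⟨h1, h2⟩), card_union_of_disjoint h3]; omega
  have hsle : ∑ v ∈ Wᶜ, (NB H v ∩ S).card ≤ ∑ v ∈ Wᶜ, 2 := sum_le_sum fun v _ => by
    rw [← hS]; exact card_le_card inter_subset_right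
  rw [sum_const, smul_eq_mul] at hsle
  have hT := T.card
  obtain ⟨x, y, hxy, hSe⟩ := card_eq_two.1 hS
  have hxS : x ∈ S := by simp [hSe]
  have hyS : y ∈ S := by simp [hSe]
  have hSS : ∀ v, v ∈ S ↔ v = x ∨ v = y := by simp [hSe]
  have cA := card_union_of_disjoint h1
  have cB := card_union_of_disjoint h2
  have mA := mader_in hvk (S ∪ A) (by omega)
  have mB := mader_in hvk (S ∪ B) (by omega)
  have hsub : EIn H W ⊆ EIn H (S ∪ A) ∪ EIn H (S ∪ B) := by
    intro e
    induction e with | _ u v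
    rw [mem_union, mk_mem_EIn, mk_mem_EIn, mk_mem_EIn, hW]
    simp only [mem_union]
    rintro ⟨a, b, d⟩
    have := h u v a
    tauto
  have hEu : (EIn H W).card + (EIn H (S ∪ A) ∩ EIn H (S ∪ B)).card ≤ (EIn H (S ∪ A)).card + (EIn H (S ∪ B)).card := by
    have e1 := card_union_add_card_inter (EIn H (S ∪ A)) (EIn H (S ∪ B))
    have e2 := card_le_card hsub
    omega
  have hxyH : H.Adj x y := by
    by_contra hno
    have : ∃ t ∈ Wᶜ, H.Adj t x ∧ H.Adj t y := by
      by_contra hcon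
      push Not at hcon
      have hle1 : ∑ v ∈ Wᶜ, (NB H v ∩ S).card ≤ ∑ v ∈ Wᶜ, 1 := sum_le_sum fun v hv => by
        rw [card_le_one]
        intro a ha b hb
        rw [mem_inter, mem_NB, hSS] at ha hb
        have hcv := hcon v hv
        obtain ⟨ha, ea | ea⟩ := ha <;> obtain ⟨hb, eb | eb⟩ := hb
        · rw [ea, eb]
        · rw [ea] at ha; rw [eb] at hb; exact absurd hb (hcv ha)
        · rw [ea] at ha; rw [eb] at hb; exact absurd ha (hcv hb)
        · rw [ea, eb]
      rw [sum_const, smul_eq_mul] at hle1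
      omega
    obtain ⟨t, ht, htx, hty⟩ := this
    rw [mem_compl, hW, mem_union, mem_union, not_or, not_or] at ht
    by_cases h9 : 9 ≤ (EIn H (S ∪ A)).card
    · exact k5minus hvk hA hxy hSe h1 h9 hno htx hty ht.2.1
    · exact k5minus hvk hB hxy hSe h2 (by omega) hno htx hty ht.2.2
  have hin : 1 ≤ (EIn H (S ∪ A) ∩ EIn H (S ∪ B)).card := card_pos.2 ⟨s(x, y), by
    rw [mem_inter, mk_mem_EIn, mk_mem_EIn]; simp [hxyH, hxS, hyS]⟩
  have hfull := sum_full (H := H) (W := Wᶜ) hS (by omega)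
  have eS : ∀ X, insert x (insert y X) = S ∪ X := by intro X; ext v; simp [hSS, or_assoc]
  have hBB : BB G H x y A B := 
    { xy := hxyH
      xA := disjoint_left.1 h1 hxS
      yA := disjoint_left.1 h1 hyS
      xB := disjoint_left.1 h2 hxS
      yB := disjoint_left.1 h2 hyS
      cA := hA
      cB := hB
      dj := h3
      mA := by rw [eS]; exact missOne_of_card (by omega) (by omega)
      mB := by rw [eS]; exact missOne_of_card (by omega) (by omega)
      full := by
        intro t n1 n2 n3 n4
        have ht : t ∈ Wᶜ := by rw [mem_compl, hW]; simp [hSS, n1, n2, n3, n4]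
        exact ⟨(hfull t ht x hxS).symm, (hfull t ht y hyS).symm⟩ }
  -- count the edges between classes
  have hIE := T.ie
  have inj := T.inj
  classical
  let D := IE G S (lab A B)
  have sg : ∀ v, v ∉ S → v ∉ A → v ∉ B → Sg x y A B v := by
    intro v a b d; rw [hSS] at a; unfold Sg; tauto
  have hone : ∀ A' B' : Finset V, A' ⊆ A → BB G H x y A' B' ∨ BB G H x y B' A' → True := fun _ _ _ _ => trivial
  have cIA : (D.filter (fun e => ∃ t a, e = s(t, a) ∧ t ∉ A ∧ t ∉ B ∧ a ∈ A)).card ≤ 1 := by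
    rw [card_le_one]
    rintro e he e' he'
    rw [mem_filter] at he he'
    obtain ⟨he, t, a, rfl, t1, t2, t3⟩ := he
    obtain ⟨he', t', a', rfl, t1', t2', t3'⟩ := he'
    have i1 := mem_IE.1 he
    have i2 := mem_IE.1 he'
    by_contra hne
    by_cases htt : t = t'
    · subst htt
      refine hne (inj he he' ?_)
      simp only [Sym2.map_mk]
      rw [(lab_eq h3 (u := a) (v := a')).2 (by tauto)]
    · exact hBB.AI2 hC hH (sg t i1.2.1 t1 t2) (sg t' i2.2.1 t1' t2') t3 t3' htt i1.1 i2.1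
  have cIB : (D.filter (fun e => ∃ t a, e = s(t, a) ∧ t ∉ A ∧ t ∉ B ∧ a ∈ B)).card ≤ 1 := by
    rw [card_le_one]
    rintro e he e' he'
    rw [mem_filter] at he he'
    obtain ⟨he, t, a, rfl, t1, t2, t3⟩ := he
    obtain ⟨he', t', a', rfl, t1', t2', t3'⟩ := he'
    have i1 := mem_IE.1 he
    have i2 := mem_IE.1 he'
    by_contra hne
    by_cases htt : t = t'
    · subst htt
      refine hne (inj he he' ?_)
      simp only [Sym2.map_mk]
      rw [(lab_eq h3 (u := a) (v := a')).2 (by tauto)]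
    · have s1 := sg t i1.2.1 t1 t2
      have s2 := sg t' i2.2.1 t1' t2'
      exact hBB.symm.AI2 hC hH ⟨s1.1, s1.2.1, s1.2.2.2, s1.2.2.1⟩ ⟨s2.1, s2.2.1, s2.2.2.2, s2.2.2.1⟩ t3 t3' htt i1.1 i2.1
  have cAB : (D.filter (fun e => ∃ t a, e = s(t, a) ∧ t ∈ A ∧ a ∈ B)).card ≤ 1 := by
    rw [card_le_one]
    rintro e he e' he'
    rw [mem_filter] at he he'
    obtain ⟨he, t, a, rfl, t1, t2⟩ := he
    obtain ⟨he', t', a', rfl, t1', t2'⟩ := he'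
    refine inj he he' ?_
    simp only [Sym2.map_mk]
    rw [(lab_eq h3 (u := a) (v := a')).2 (by tauto), (lab_eq h3 (u := t) (v := t')).2 (by tauto)]
  have hcov : D ⊆ (D.filter (fun e => ∃ t a, e = s(t, a) ∧ t ∉ A ∧ t ∉ B ∧ a ∈ A)) ∪
      (D.filter (fun e => ∃ t a, e = s(t, a) ∧ t ∉ A ∧ t ∉ B ∧ a ∈ B)) ∪
      (D.filter (fun e => ∃ t a, e = s(t, a) ∧ t ∈ A ∧ a ∈ B)) := by
    intro e
    induction e with | _ u v
    intro he
    obtain ⟨i1, i2, i3, i4⟩ := mem_IE.1 he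
    have i4' : ¬ _ := fun hh => i4 ((lab_eq h3 (u := u) (v := v)).2 hh)
    have hsw : s(u, v) = s(v, u) := Sym2.eq_swap
    simp only [mem_union, mem_filter, he, true_and]
    have hd := disjoint_left.1 h3
    by_cases uA : u ∈ A
    · by_cases vB : v ∈ B
      · exact Or.inr ⟨u, v, rfl, uA, vB⟩
      · exact Or.inl (Or.inl ⟨v, u, hsw, by tauto, vB, uA⟩)
    · by_cases uB : u ∈ B
      · by_cases vA : v ∈ A
        · exact Or.inr ⟨v, u, hsw, vA, uB⟩
        · exact Or.inl (Or.inr ⟨v, u, hsw, vA, by tauto, uB⟩)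
      · by_cases vA : v ∈ A
        · exact Or.inl (Or.inl ⟨u, v, rfl, uA, uB, vA⟩)
        · by_cases vB : v ∈ B
          · exact Or.inl (Or.inr ⟨u, v, rfl, uA, uB, vB⟩)
          · exact (hBB.noSS hC hH (sg u i2 uA uB) (sg v i3 vA vB) i1).elim
  have c1 := card_le_card hcov
  have c2 := card_union_le ((D.filter (fun e => ∃ t a, e = s(t, a) ∧ t ∉ A ∧ t ∉ B ∧ a ∈ A)) ∪
      (D.filter (fun e => ∃ t a, e = s(t, a) ∧ t ∉ A ∧ t ∉ B ∧ a ∈ B))) (D.filter (fun e => ∃ t a, e = s(t, a) ∧ t ∈ A ∧ a ∈ B))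
  have c3 := card_union_le (D.filter (fun e => ∃ t a, e = s(t, a) ∧ t ∉ A ∧ t ∉ B ∧ a ∈ A))
      (D.filter (fun e => ∃ t a, e = s(t, a) ∧ t ∉ A ∧ t ∉ B ∧ a ∈ B))
  have : D.card + 7 = Fintype.card V := hIE
  omega

/-- enlarging covers -/
lemma Cov.mono {S X Y S' X' Y' : Finset V} (h : Cov H S X Y) (hS : S ⊆ S') (hX : X ⊆ X') (hY : Y ⊆ Y') : Cov H S' X' Y' := by
  intro u v huv
  rcases h u v huv with h | h | h | h
  · exact Or.inl (hS h)
  · exact Or.inr (Or.inl (hS h))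
  · exact Or.inr (Or.inr (Or.inl ⟨hX h.1, hX h.2⟩))
  · exact Or.inr (Or.inr (Or.inr ⟨hY h.1, hY h.2⟩))

lemma enlarge {X S : Finset V} (m : ℕ) (hX : X.card ≤ m) (hd : Disjoint S X) (hm : m + S.card ≤ Fintype.card V) :
    ∃ X', X ⊆ X' ∧ X'.card = m ∧ Disjoint S X' := by
  have hc := card_compl_add_card S
  obtain ⟨X', h1, h2, h3⟩ := exists_subsuperset_card_eq (s := X) (t := Sᶜ) (n := m)
    (fun v hv => by rw [mem_compl]; exact disjoint_right.1 hd hv) hX (by omega)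
  exact ⟨X', h1, h3, disjoint_right.2 fun v hv => by have := h2 hv; rwa [mem_compl] at this⟩

/-- unified exclusion -/
lemma Ex (hC : Ctx G c) (hH : Hyp G c H) {S X Y : Finset V} (h : Cov H S X Y) (h1 : Disjoint S X) (h2 : Disjoint S Y)
    (h3 : Disjoint X Y) (hS : S.card ≤ 2)
    (hk : (Y = ∅ ∧ X.card + 2 * S.card ≤ 9) ∨ (X.card + 2 * S.card ≤ 7 ∧ Y.card ≤ 3)) : False := by
  have hn := hC.n11
  by_cases hS1 : S.card ≤ 1
  · apply stepA hC hH hS1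
    apply h.toLC h1 h2 h3
    rcases hk with ⟨rfl, hk⟩ | hk
    · simp; omega
    · omega
  · have hS2 : S.card = 2 := by omega
    rcases hk with ⟨rfl, hk⟩ | ⟨hk, hk'⟩
    · obtain ⟨X', a, b, d⟩ := enlarge 5 (by omega) h1 (by omega)
      exact stepBa hC hH hS2 b d (h.mono subset_rfl a subset_rfl)
    · obtain ⟨X', a, b, d⟩ := enlarge (S := S ∪ Y) (X := X) 3 (by omega) (disjoint_union_left.2 ⟨h1, h3.symm⟩) (by
        have := card_union_le S Y; omega)
      rw [disjoint_union_left] at d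
      obtain ⟨Y', a', b', d'⟩ := enlarge (S := S ∪ X') (X := Y) 3 (by omega) (disjoint_union_left.2 ⟨h2, d.2.symm⟩) (by
        have := card_union_le S X'; omega)
      rw [disjoint_union_left] at d'
      exact stepBb hC hH hS2 b b' d.1 d'.1 d'.2 (h.mono subset_rfl a a')

end StepBb3

set_option linter.unusedSectionVars false
set_option linter.unusedVariables false

section StepC1
open Finset
variable {V : Type} [Fintype V] [DecidableEq V]
variable {G H : SimpleGraph V} {c : Sym2 V → ℕ}

/-- a connected object adjacent to `o` and to all of `S` but `m` -/
structure Ob (G : SimpleGraph V) (o : V) (S : Finset V) (K O : Set V) (m : V) : Prop where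
  conn : Conn G O
  oO : o ∉ O
  sO : ∀ w ∈ S, w ∉ O
  kO : Disjoint O K
  ac : ∃ p ∈ O, G.Adj o p
  mS : m ∈ S
  ad : ∀ w ∈ S, w ≠ m → ∃ p ∈ O, G.Adj w p

lemma Ob.share (hG : VK G) {o : V} {S : Finset V} {K O1 O2 O3 : Set V} {m m3 : V} (hS : S.card = 3)
    (hK : Conn G K) (oK : o ∉ K) (sK : ∀ w ∈ S, w ∉ K) (aK : ∀ w ∈ S, ∃ p ∈ K, G.Adj w p) (oS : o ∉ S)
    (h1 : Ob G o S K O1 m) (h2 : Ob G o S K O2 m) (h3 : Ob G o S K O3 m3)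
    (d12 : Disjoint O1 O2) (d13 : Disjoint O1 O3) (d23 : Disjoint O2 O3) : False := by
  obtain ⟨x, y, hmx, hmy, hxy, hSe⟩ := three_split hS h1.mS
  have hx : x ∈ S := by simp [hSe]
  have hy : y ∈ S := by simp [hSe]
  have hm := h1.mS
  have ox : o ≠ x := fun h => oS (h ▸ hx)
  have oy : o ≠ y := fun h => oS (h ▸ hy)
  have om : o ≠ m := fun h => oS (h ▸ hm)
  by_cases hz : ∃ p ∈ O3, G.Adj m p
  · obtain ⟨p, hp, hmp⟩ := hz
    obtain ⟨q, hq, hmq⟩ := aK m hm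
    have cc : Conn G ((O3 ∪ {m}) ∪ K) :=
      (h3.conn.union (Conn.singleton m) hp rfl hmp.symm).union hK (Or.inr rfl) hq hmq
    obtain ⟨px, hpx, kx⟩ := aK x hx
    obtain ⟨py, hpy, ky⟩ := aK y hy
    obtain ⟨po, hpo, ko⟩ := h3.ac
    refine hG.noK33_three ox oy hxy h1.conn h2.conn cc h1.oO h2.oO ?_ (h1.sO x hx) (h2.sO x hx) ?_
      (h1.sO y hy) (h2.sO y hy) ?_ d12 ?_ ?_ h1.ac h2.ac ⟨po, Or.inl (Or.inl hpo), ko⟩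
      (h1.ad x hx hmx.symm) (h2.ad x hx hmx.symm) ⟨px, Or.inr hpx, kx⟩
      (h1.ad y hy hmy.symm) (h2.ad y hy hmy.symm) ⟨py, Or.inr hpy, ky⟩
    · rintro ((h | h) | h)
      · exact h3.oO h
      · exact om h
      · exact oK h
    · rintro ((h | h) | h)
      · exact h3.sO x hx h
      · exact hmx h.symm
      · exact sK x hx h
    · rintro ((h | h) | h)
      · exact h3.sO y hy h
      · exact hmy h.symm
      · exact sK y hy h
    · refine Set.disjoint_union_right.2 ⟨Set.disjoint_union_right.2 ⟨d13, ?_⟩, h1.kO⟩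
      simpa using h1.sO m hm
    · refine Set.disjoint_union_right.2 ⟨Set.disjoint_union_right.2 ⟨d23, ?_⟩, h2.kO⟩
      simpa using h2.sO m hm
  · have e3 : m3 = m := by
      by_contra hne
      exact hz (h3.ad m hm (Ne.symm hne))
    subst e3
    exact hG.noK33_three ox oy hxy h1.conn h2.conn h3.conn h1.oO h2.oO h3.oO (h1.sO x hx) (h2.sO x hx) (h3.sO x hx)
      (h1.sO y hy) (h2.sO y hy) (h3.sO y hy) d12 d13 d23 h1.ac h2.ac h3.ac
      (h1.ad x hx hmx.symm) (h2.ad x hx hmx.symm) (h3.ad x hx hmx.symm)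
      (h1.ad y hy hmy.symm) (h2.ad y hy hmy.symm) (h3.ad y hy hmy.symm)

lemma Ob.four (hG : VK G) {o : V} {S : Finset V} {K O1 O2 O3 O4 : Set V} {m1 m2 m3 m4 : V} (hS : S.card = 3)
    (hK : Conn G K) (oK : o ∉ K) (sK : ∀ w ∈ S, w ∉ K) (aK : ∀ w ∈ S, ∃ p ∈ K, G.Adj w p) (oS : o ∉ S)
    (h1 : Ob G o S K O1 m1) (h2 : Ob G o S K O2 m2) (h3 : Ob G o S K O3 m3) (h4 : Ob G o S K O4 m4)
    (d12 : Disjoint O1 O2) (d13 : Disjoint O1 O3) (d14 : Disjoint O1 O4) (d23 : Disjoint O2 O3)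
    (d24 : Disjoint O2 O4) (d34 : Disjoint O3 O4) : False := by
  have e12 : m1 ≠ m2 := by rintro rfl; exact Ob.share hG hS hK oK sK aK oS h1 h2 h3 d12 d13 d23
  have e13 : m1 ≠ m3 := by rintro rfl; exact Ob.share hG hS hK oK sK aK oS h1 h3 h2 d13 d12 d23.symm
  have e14 : m1 ≠ m4 := by rintro rfl; exact Ob.share hG hS hK oK sK aK oS h1 h4 h2 d14 d12 d24.symm
  have e23 : m2 ≠ m3 := by rintro rfl; exact Ob.share hG hS hK oK sK aK oS h2 h3 h1 d23 d12.symm d13.symm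
  have e24 : m2 ≠ m4 := by rintro rfl; exact Ob.share hG hS hK oK sK aK oS h2 h4 h1 d24 d12.symm d14.symm
  have e34 : m3 ≠ m4 := by rintro rfl; exact Ob.share hG hS hK oK sK aK oS h3 h4 h1 d34 d13.symm d14.symm
  have hsub : ({m1, m2, m3, m4} : Finset V) ⊆ S := by
    intro v hv
    simp only [mem_insert, mem_singleton] at hv
    rcases hv with rfl | rfl | rfl | rfl
    exacts [h1.mS, h2.mS, h3.mS, h4.mS]
  have := card_le_card hsub
  rw [card_insert_of_notMem (by simp [e12, e13, e14]), card_insert_of_notMem (by simp [e23, e24]),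
    card_insert_of_notMem (by simp [e34]), card_singleton] at this
  omega

lemma Ob.three (hG : VK G) {o : V} {S : Finset V} {K O1 O2 O3 : Set V} {m1 m2 m3 : V} (hS : S.card = 3)
    (hK : Conn G K) (oK : o ∉ K) (sK : ∀ w ∈ S, w ∉ K) (aK : ∀ w ∈ S, ∃ p ∈ K, G.Adj w p) (oS : o ∉ S)
    (h1 : Ob G o S K O1 m1) (h2 : Ob G o S K O2 m2) (h3 : Ob G o S K O3 m3)
    (d12 : Disjoint O1 O2) (d13 : Disjoint O1 O3) (d23 : Disjoint O2 O3) {w : V} (hw : w ∈ S) :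
    ∃ p q, p ≠ q ∧ p ∈ O1 ∪ O2 ∪ O3 ∧ q ∈ O1 ∪ O2 ∪ O3 ∧ G.Adj w p ∧ G.Adj w q := by
  have e12 : m1 ≠ m2 := by rintro rfl; exact Ob.share hG hS hK oK sK aK oS h1 h2 h3 d12 d13 d23
  have e13 : m1 ≠ m3 := by rintro rfl; exact Ob.share hG hS hK oK sK aK oS h1 h3 h2 d13 d12 d23.symm
  have e23 : m2 ≠ m3 := by rintro rfl; exact Ob.share hG hS hK oK sK aK oS h2 h3 h1 d23 d12.symm d13.symm
  have nd : ∀ {A B : Set V} {p q : V}, Disjoint A B → p ∈ A → q ∈ B → p ≠ q := by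
    rintro A B p q hd hp hq rfl
    exact Set.disjoint_left.1 hd hp hq
  by_cases w1 : w = m1
  · obtain ⟨p, hp, ap⟩ := h2.ad w hw (by rw [w1]; exact e12)
    obtain ⟨q, hq, aq⟩ := h3.ad w hw (by rw [w1]; exact e13)
    exact ⟨p, q, nd d23 hp hq, Or.inl (Or.inr hp), Or.inr hq, ap, aq⟩
  · obtain ⟨p, hp, ap⟩ := h1.ad w hw w1
    by_cases w2 : w = m2
    · obtain ⟨q, hq, aq⟩ := h3.ad w hw (by rw [w2]; exact e23)
      exact ⟨p, q, nd d13 hp hq, Or.inl (Or.inl hp), Or.inr hq, ap, aq⟩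
    · obtain ⟨q, hq, aq⟩ := h2.ad w hw w2
      exact ⟨p, q, nd d12 hp hq, Or.inl (Or.inl hp), Or.inl (Or.inr hq), ap, aq⟩

lemma PM.toM5 {A : Finset V} {f : V → V} (h : PM H A f) (hA : A.card = 5) : M5 H := ⟨A, f, hA, h⟩

lemma upd_ne {A : Finset V} {f : V → V} {u v x : V} (h : ∀ a ∈ A, f a ≠ x) (hu : u ∉ A) (hv : v ≠ x) :
    ∀ a ∈ insert u A, Function.update f u v a ≠ x := by
  intro a ha
  rcases mem_insert.1 ha with rfl | ha2
  · simpa using hv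
  · have hau : a ≠ u := fun he => hu (he ▸ ha2)
    rw [Function.update_of_ne hau]; exact h a ha2

lemma hall_fail (hM : ¬ M5 H) [Nonempty V] {S F : Finset V} 
    (ext : ∀ f, PM H S f → (∀ a ∈ S, f a ∉ F) → M5 H) :
    ∃ A ⊆ S, A.Nonempty ∧ ∃ N : Finset V, N.card < A.card ∧ Disjoint N S ∧ Disjoint N F ∧
      ∀ a ∈ A, ∀ v, H.Adj a v → v ∈ S ∨ v ∈ F ∨ v ∈ N := by
  rcases hall_rel S (fun a => NB H a \ (S ∪ F)) with ⟨f, hf, hi⟩ | ⟨A, hA, hne, hc⟩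
  · exfalso
    simp only [mem_sdiff, mem_NB, mem_union, not_or] at hf
    exact hM (ext f ⟨fun a ha => (hf a ha).1, fun a ha => (hf a ha).2.1, hi⟩ fun a ha => (hf a ha).2.2)
  · refine ⟨A, hA, hne, _, hc, ?_, ?_, ?_⟩
    · rw [disjoint_left]; intro v hv
      obtain ⟨a, -, h⟩ := mem_biUnion.1 hv
      simp only [mem_sdiff, mem_NB, mem_union, not_or] at h
      exact h.2.1
    · rw [disjoint_left]; intro v hv
      obtain ⟨a, -, h⟩ := mem_biUnion.1 hv
      simp only [mem_sdiff, mem_NB, mem_union, not_or] at h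
      exact h.2.2
    · intro a ha v hav
      rw [mem_biUnion]
      by_cases h1 : v ∈ S
      · exact Or.inl h1
      by_cases h2 : v ∈ F
      · exact Or.inr (Or.inl h2)
      exact Or.inr (Or.inr ⟨a, ha, by simp [hav, h1, h2]⟩)

lemma PM.ext2 {S : Finset V} {f : V → V} (h : PM H S f) (hS : S.card = 3) {a b d e : V} (hab : H.Adj a b)
    (hde : H.Adj d e) (ad : a ≠ d) (ae : a ≠ e) (bd : b ≠ d) (be : b ≠ e)
    (aS : a ∉ S) (bS : b ∉ S) (dS : d ∉ S) (eS : e ∉ S)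
    (fa : ∀ v ∈ S, f v ≠ a) (fb : ∀ v ∈ S, f v ≠ b) (fd : ∀ v ∈ S, f v ≠ d) (fe : ∀ v ∈ S, f v ≠ e) : M5 H := by
  have p1 := h.ins hab aS bS fa fb
  have p2 := p1.ins hde (by simp [dS, ad.symm]) (by simp [eS, ae.symm]) (upd_ne fd aS bd) (upd_ne fe aS be)
  apply p2.toM5
  rw [card_insert_of_notMem (by simp [dS, ad.symm]), card_insert_of_notMem aS, hS]

lemma PM.ext1 {S : Finset V} {f : V → V} (h : PM H S f) (hS : S.card = 4) {a b : V} (hab : H.Adj a b)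
    (aS : a ∉ S) (bS : b ∉ S)
    (fa : ∀ v ∈ S, f v ≠ a) (fb : ∀ v ∈ S, f v ≠ b) : M5 H := by
  apply (h.ins hab aS bS fa fb).toM5
  rw [card_insert_of_notMem aS, hS]

lemma Cov.fail {S F Y A N : Finset V} (hcov : Cov H S F Y) (h : ∀ a ∈ A, ∀ v, H.Adj a v → v ∈ S ∨ v ∈ F ∨ v ∈ N) :
    Cov H (S \ A) (A ∪ N ∪ F) Y := by
  intro u v huv
  have key : ∀ u v, H.Adj u v → u ∈ A → u ∈ S \ A ∨ v ∈ S \ A ∨ (u ∈ A ∪ N ∪ F ∧ v ∈ A ∪ N ∪ F) ∨ (u ∈ Y ∧ v ∈ Y) := by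
    intro u v huv uA
    have := h u uA v huv
    clear h hcov
    by_cases vA : v ∈ A
    · simp [uA, vA]
    · simp only [mem_sdiff, mem_union]
      tauto
  by_cases uA : u ∈ A
  · exact key u v huv uA
  by_cases vA : v ∈ A
  · have := key v u huv.symm vA
    clear h hcov key
    tauto
  have e3 := hcov u v huv
  simp only [mem_sdiff, mem_union, uA, vA, not_false_eq_true, and_true, false_or]
  clear h hcov key
  tauto

/-- Hall failure with two fixed edges and three matched vertices is impossible if the rest of the graph lies in `F` -/
lemma fail4 (hC : Ctx G c) (hH : Hyp G c H) {S F : Finset V} (hS : S.card = 3) (hF : F.card ≤ 4) (hd : Disjoint S F)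
    (hcov : Cov H S F ∅) {a b d e : V} (hab : H.Adj a b)
    (hde : H.Adj d e) (ad : a ≠ d) (ae : a ≠ e) (bd : b ≠ d) (be : b ≠ e)
    (aF : a ∈ F) (bF : b ∈ F) (dF : d ∈ F) (eF : e ∈ F) : False := by
  have : Nonempty V := ⟨a⟩
  have nS : ∀ v, v ∈ F → v ∉ S := fun v hv => disjoint_right.1 hd hv
  obtain ⟨A, hA, hne, N, hN, NS, NF, h⟩ := hall_fail (F := F) (S := S) (hH.noM5 hC) (by
    intro f hf hF'
    have hh : ∀ w ∈ F, ∀ v ∈ S, f v ≠ w := by rintro w hw v hv rfl; exact hF' v hv hw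
    exact hf.ext2 hS hab hde ad ae bd be (nS a aF) (nS b bF) (nS d dF) (nS e eF) (hh a aF) (hh b bF) (hh d dF) (hh e eF))
  have hc1 := card_sdiff_add_card_eq_card hA
  have hp := hne.card_pos
  have c1 := card_union_le (A ∪ N) F
  have c2 := card_union_le A N
  refine Ex hC hH (S := S \ A) (X := A ∪ N ∪ F) (Y := ∅) ?_ ?_ (by simp) (by simp) (by omega) (Or.inl ⟨rfl, by omega⟩)
  · exact hcov.fail h
  · rw [disjoint_right]
    intro v hv
    simp only [mem_union, mem_sdiff, not_and_not_right] at hv ⊢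
    have h1 : v ∈ N → v ∉ S := fun h => disjoint_left.1 NS h
    have h2 := nS v
    clear * - hv h1 h2
    tauto

end StepC1

set_option linter.unusedSectionVars false
set_option linter.unusedVariables false

section StepC2
open Finset
variable {V : Type} [Fintype V] [DecidableEq V]
variable {G H : SimpleGraph V} {c : Sym2 V → ℕ}

structure C3 (H : SimpleGraph V) (S C : Finset V) : Prop where
  hS : S.card = 3
  hX : C.card = 3
  dj : Disjoint S C
  cov : Cov H S C ∅
  tri : ∀ u ∈ C, ∀ v ∈ C, u ≠ v → H.Adj u v

lemma hallC (hM : ¬ M5 H) {S C F : Finset V} (hS : S.card = 3) (hd : Disjoint S C) {t t' : V}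
    (htt : H.Adj t t') (tS : t ∉ S) (tS' : t' ∉ S) (tC : t ∉ C) (tC' : t' ∉ C) (tF : t ∈ F) (tF' : t' ∈ F)
    (tok : ∀ w ∈ C, w ∉ F → ∃ p ∈ C, ∃ q ∈ C, H.Adj p q ∧ p ≠ w ∧ q ≠ w)
    (tok0 : ∃ p ∈ C, ∃ q ∈ C, H.Adj p q) :
    ∃ A ⊆ S, A.Nonempty ∧ ∃ N : Finset V, ((Disjoint N C ∧ N.card < A.card) ∨ (N \ C).card + 2 ≤ A.card) ∧
      Disjoint N S ∧ Disjoint N F ∧ ∀ a ∈ A, ∀ v, H.Adj a v → v ∈ S ∨ v ∈ F ∨ v ∈ N := by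
  classical
  have : Nonempty V := ⟨t⟩
  have L : ∀ u v, lab C ∅ u = lab C ∅ v ↔ u = v ∨ (u ∈ C ∧ v ∈ C) := by
    intro u v; rw [lab_eq (by simp)]; simp
  have nS : ∀ v, v ∈ C → v ∉ S := fun v hv => disjoint_right.1 hd hv
  rcases hall_rel S (fun a => (NB H a \ (S ∪ F)).image (lab C ∅)) with ⟨f, hf, hi⟩ | ⟨A, hA, hne, hc⟩
  · exfalso
    have hf' : ∀ a, ∃ v, a ∈ S → (H.Adj a v ∧ v ∉ S ∧ v ∉ F ∧ lab C ∅ v = f a) := by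
      intro a
      by_cases ha : a ∈ S
      · obtain ⟨v, hv, e⟩ := mem_image.1 (hf a ha)
        simp only [mem_sdiff, mem_NB, mem_union, not_or] at hv
        exact ⟨v, fun _ => ⟨hv.1, hv.2.1, hv.2.2, e⟩⟩
      · exact ⟨a, fun h => absurd h ha⟩
    choose r hr using hf'
    have key : ∀ a ∈ S, ∀ b ∈ S, lab C ∅ (r a) = lab C ∅ (r b) → a = b := by
      intro a ha b hb hab
      exact hi ha hb (by rw [← (hr a ha).2.2.2, ← (hr b hb).2.2.2, hab])
    have hPM : PM H S r := ⟨fun a ha => (hr a ha).1, fun a ha => (hr a ha).2.1, fun a ha b hb hab => key a ha b hb (by rw [hab])⟩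
    have rF : ∀ w ∈ F, ∀ a ∈ S, r a ≠ w := by rintro w hw a ha rfl; exact (hr a ha).2.2.1 hw
    have : ∃ p ∈ C, ∃ q ∈ C, H.Adj p q ∧ (∀ a ∈ S, r a ≠ p) ∧ (∀ a ∈ S, r a ≠ q) := by
      by_cases hex : ∃ a ∈ S, r a ∈ C
      · obtain ⟨a, ha, hra⟩ := hex
        obtain ⟨p, hp, q, hq, h1, h2, h3⟩ := tok (r a) hra (hr a ha).2.2.1
        refine ⟨p, hp, q, hq, h1, ?_, ?_⟩
        · rintro b hb rfl
          exact h2 (by rw [key a ha b hb ((L _ _).2 (Or.inr ⟨hra, hp⟩))])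
        · rintro b hb rfl
          exact h3 (by rw [key a ha b hb ((L _ _).2 (Or.inr ⟨hra, hq⟩))])
      · push Not at hex
        obtain ⟨p, hp, q, hq, h1⟩ := tok0
        refine ⟨p, hp, q, hq, h1, ?_, ?_⟩
        · rintro b hb rfl; exact hex b hb hp
        · rintro b hb rfl; exact hex b hb hq
    obtain ⟨p, hp, q, hq, hpq, rp, rq⟩ := this
    have ne : ∀ {u v}, u ∉ C → v ∈ C → u ≠ v := by rintro u v h1 h2 rfl; exact h1 h2
    exact hM (hPM.ext2 hS htt hpq (ne tC hp) (ne tC hq) (ne tC' hp) (ne tC' hq) tS tS' (nS p hp) (nS q hq)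
      (rF t tF) (rF t' tF') rp rq)
  · refine ⟨A, hA, hne, A.biUnion (fun a => NB H a \ (S ∪ F)), ?_, ?_, ?_, ?_⟩
    · have hm : A.biUnion (fun a => (NB H a \ (S ∪ F)).image (lab C ∅)) =
          (A.biUnion (fun a => NB H a \ (S ∪ F))).image (lab C ∅) := by
        ext; simp only [mem_biUnion, mem_image]; tauto
      rw [hm] at hc
      generalize A.biUnion (fun a => NB H a \ (S ∪ F)) = N at hc ⊢
      by_cases hNC : Disjoint N C
      · refine Or.inl ⟨hNC, ?_⟩
        rwa [card_image_of_injOn] at hc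
        intro u hu v hv huv
        have := (L u v).1 huv
        rcases this with h | h
        · exact h
        · exact absurd h.1 (disjoint_left.1 hNC hu)
      · right
        rw [not_disjoint_iff] at hNC
        obtain ⟨w, hw, hwC⟩ := hNC
        have hsub : insert (lab C ∅ w) ((N \ C).image (lab C ∅)) ⊆ N.image (lab C ∅) :=
          insert_subset (mem_image_of_mem _ hw) (image_subset_image sdiff_subset)
        have := card_le_card hsub
        rw [card_insert_of_notMem, card_image_of_injOn] at this
        · omega
        · intro u hu v hv huv
          rcases (L u v).1 huv with h | h
          · exact h
          · simp only [coe_sdiff, Set.mem_diff, mem_coe] at hu; exact absurd h.1 hu.2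
        · intro hm
          obtain ⟨v, hv, e⟩ := mem_image.1 hm
          rw [mem_sdiff] at hv
          rcases (L _ _).1 e with rfl | h
          · exact hv.2 hwC
          · exact hv.2 h.1
    · rw [disjoint_left]; intro v hv
      obtain ⟨a, -, h⟩ := mem_biUnion.1 hv
      simp only [mem_sdiff, mem_NB, mem_union, not_or] at h
      exact h.2.1
    · rw [disjoint_left]; intro v hv
      obtain ⟨a, -, h⟩ := mem_biUnion.1 hv
      simp only [mem_sdiff, mem_NB, mem_union, not_or] at h
      exact h.2.2
    · intro a ha v hav
      rw [mem_biUnion]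
      by_cases h1 : v ∈ S
      · exact Or.inl h1
      by_cases h2 : v ∈ F
      · exact Or.inr (Or.inl h2)
      exact Or.inr (Or.inr ⟨a, ha, by simp [hav, h1, h2]⟩)

lemma cov_swp {S X Y X' Y' : Finset V} (hcov : Cov H S X Y) {h : Sym2 V} {t t' : V} (hX : X ⊆ X') (hY : Y ⊆ Y')
    (htt : t ∈ S ∨ t' ∈ S ∨ (t ∈ X' ∧ t' ∈ X') ∨ (t ∈ Y' ∧ t' ∈ Y')) : Cov (swp H h s(t, t')) S X' Y' := by
  intro u v huv
  rcases swp_adj.1 huv with ⟨h1, -⟩ | ⟨h1, -⟩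
  · exact hcov.mono subset_rfl hX hY u v h1
  · rw [Sym2.eq_iff] at h1
    rcases h1 with ⟨rfl, rfl⟩ | ⟨rfl, rfl⟩
    · exact htt
    · clear hcov hX hY huv; tauto

/-- an unmatched set spanning two outside edges plus the triangle -/
lemma big_fail (hC : Ctx G c) (hH : Hyp G c H) {S C A N : Finset V} {t t' : V} (hS : S.card = 3) (hX : C.card = 3)
    (dj : Disjoint S C) (hcov : Cov H S (C ∪ {t, t'}) ∅) (tS : t ∉ S) (tS' : t' ∉ S) (hA : A ⊆ S) (hne : A.Nonempty)
    (hN : (N \ C).card + 2 ≤ A.card) (dN : Disjoint N S)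
    (h : ∀ a ∈ A, ∀ v, H.Adj a v → v ∈ S ∨ v ∈ C ∪ {t, t'} ∨ v ∈ N) : False := by
  have hc1 := card_sdiff_add_card_eq_card hA
  have hp := hne.card_pos
  have c1 := card_union_le (A ∪ N \ C) (C ∪ {t, t'})
  have c2 := card_union_le A (N \ C)
  have c3 := card_union_le C {t, t'}
  have c4 := card_le_two (a := t) (b := t')
  refine Ex hC hH (S := S \ A) (X := A ∪ N \ C ∪ (C ∪ {t, t'})) (Y := ∅) (hcov.fail ?_) ?_ (by simp) (by simp) (by omega)
    (Or.inl ⟨rfl, by omega⟩)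
  · intro a ha v hav
    rcases h a ha v hav with h1 | h1 | h1
    · exact Or.inl h1
    · exact Or.inr (Or.inl h1)
    · by_cases hv : v ∈ C
      · simp [hv]
      · simp [hv, h1]
  · rw [disjoint_right]
    intro v hv
    rw [mem_sdiff]
    rintro ⟨h1, h2⟩
    have h3 := disjoint_left.1 dj h1
    have h4 := disjoint_right.1 dN h1
    simp only [mem_union, mem_sdiff, mem_insert, mem_singleton, h2, h3, h4, false_and, false_or] at hv
    rcases hv with rfl | rfl
    · exact tS h1
    · exact tS' h1

lemma C3.swapTT (hC : Ctx G c) (hH : Hyp G c H) {S C : Finset V} (K : C3 H S C) {t t' : V} {h : Sym2 V}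
    (htt : G.Adj t t') (tS : t ∉ S) (tS' : t' ∉ S) (tC : t ∉ C) (tC' : t' ∉ C) (hh : h ∈ H.edgeSet)
    (hcol : c h = c s(t, t')) : 
    ∃ m p q, m ≠ p ∧ m ≠ q ∧ p ≠ q ∧ C = {m, p, q} ∧ h = s(p, q) ∧ 
      ∃ a ∈ S, ∀ v, H.Adj a v → v ∈ S ∨ v = t ∨ v = t' ∨ v = m := by
  have hH' := hH.swap (g := s(t, t')) (by simpa using htt) hh hcol
  obtain ⟨hS, hX, dj, cov, tri⟩ := K
  have nS : ∀ v, v ∈ C → v ∉ S := fun v hv => disjoint_right.1 dj hv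
  have aS : ∀ v, v ∈ S → v ∉ C := fun v hv => disjoint_left.1 dj hv
  have adj' : (swp H h s(t, t')).Adj t t' := swp_adj.2 (Or.inr ⟨rfl, htt.ne⟩)
  have tt2 := card_le_two (a := t) (b := t')
  by_cases hex : ∃ p ∈ C, ∃ q ∈ C, h = s(p, q)
  · obtain ⟨p, hp, q, hq, rfl⟩ := hex
    have hpq : p ≠ q := (show H.Adj p q from hh).ne
    obtain ⟨m, hm⟩ : (C \ {p, q}).Nonempty := card_pos.1 (by
      have := le_card_sdiff {p, q} C
      have := card_le_two (a := p) (b := q)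
      omega)
    simp only [mem_sdiff, mem_insert, mem_singleton, not_or] at hm
    obtain ⟨mC, mp, mq⟩ := hm
    have hCe : C = {m, p, q} := by
      symm
      apply eq_of_subset_of_card_le
      · intro v hv; simp only [mem_insert, mem_singleton] at hv; rcases hv with rfl | rfl | rfl <;> assumption
      · rw [hX, card_eq_three.2 ⟨m, p, q, mp, mq, hpq, rfl⟩]
    refine ⟨m, p, q, mp, mq, hpq, hCe, rfl, ?_⟩
    have a1 : (swp H s(p, q) s(t, t')).Adj m q := swp_adj.2 (Or.inl ⟨tri m mC q hq mq, by simp [mp, mq]⟩)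
    have a2 : (swp H s(p, q) s(t, t')).Adj m p := swp_adj.2 (Or.inl ⟨tri m mC p hp mp, by simp [mp, mq]⟩)
    obtain ⟨A, hA, hne, N, hN, NS, NF, hnb⟩ := hallC (C := C) (S := S) (F := {t, t', m}) (hH'.noM5 hC) hS dj adj' tS tS' tC tC' (by simp) (by simp)
      (by
        intro w hw hwF
        simp only [mem_insert, mem_singleton, not_or] at hwF
        rw [hCe] at hw
        simp only [mem_insert, mem_singleton] at hw
        rcases hw with rfl | rfl | rfl
        · tauto
        · exact ⟨m, mC, q, hq, a1, mp, hpq.symm⟩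
        · exact ⟨m, mC, p, hp, a2, mq, hpq⟩)
      ⟨m, mC, p, hp, a2⟩
    have hp := hne.card_pos
    rcases hN with ⟨hNC, hlt⟩ | hN
    · by_cases hA1 : A.card = 1
      · obtain ⟨a, rfl⟩ := card_eq_one.1 hA1
        have hN0 : N = ∅ := card_eq_zero.1 (by omega)
        have haS : a ∈ S := hA (by simp)
        refine ⟨a, haS, ?_⟩
        intro v hav
        have hav' : (swp H s(p, q) s(t, t')).Adj a v := swp_adj.2 (Or.inl ⟨hav, by
          intro he
          rw [Sym2.eq_iff] at he
          rcases he with ⟨rfl, -⟩ | ⟨rfl, -⟩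
          · exact nS _ ‹_› haS
          · exact nS _ ‹_› haS⟩)
        have := hnb a (by simp) v hav'
        simpa [hN0] using this
      · exfalso
        have hcov : Cov (swp H s(p, q) s(t, t')) (insert m S) {t, t'} ∅ := by
          intro u v huv
          rcases swp_adj.1 huv with ⟨h1, h1'⟩ | ⟨h1, -⟩
          · rcases cov u v h1 with h2 | h2 | h2 | h2
            · simp [h2]
            · simp [h2]
            · by_cases um : u = m
              · simp [um]
              by_cases vm : v = m
              · simp [vm]
              exfalso
              rw [hCe] at h2
              simp only [mem_insert, mem_singleton, um, vm, false_or] at h2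
              have hne := h1.ne
              rcases h2 with ⟨rfl | rfl, rfl | rfl⟩
              · exact hne rfl
              · exact h1' rfl
              · exact h1' Sym2.eq_swap
              · exact hne rfl
            · simp at h2
          · rw [Sym2.eq_iff] at h1
            rcases h1 with ⟨rfl, rfl⟩ | ⟨rfl, rfl⟩ <;> simp
        have hcc := hcov.fail (A := A) (N := N) (by
          intro a ha v hav
          have := hnb a ha v hav
          simp only [mem_insert, mem_singleton] at this ⊢
          clear * - this
          tauto)
        have hmS := nS m mC
        have cc : (insert m S).card = 4 := by rw [card_insert_of_notMem hmS, hS]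
        have hc1 := card_sdiff_add_card_eq_card (hA.trans (subset_insert m S))
        have c1 := card_union_le (A ∪ N) {t, t'}
        have c2 := card_union_le A N
        refine Ex hC hH' hcc ?_ (by simp) (by simp) (by omega) (Or.inl ⟨rfl, by omega⟩)
        rw [disjoint_right]
        intro v hv
        rw [mem_sdiff, mem_insert]
        rintro ⟨h1 | h1, h2⟩
        · subst h1
          have h4 := disjoint_right.1 hNC mC
          simp only [mem_union, mem_insert, mem_singleton, h2, h4, false_or] at hv
          rcases hv with rfl | rfl
          · exact tC mC
          · exact tC' mC
        · have h4 := disjoint_right.1 NS h1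
          simp only [mem_union, mem_insert, mem_singleton, h2, h4, false_or] at hv
          rcases hv with rfl | rfl
          · exact tS h1
          · exact tS' h1
    · exfalso
      refine big_fail hC hH' hS hX dj (cov_swp cov subset_union_left subset_rfl (by simp)) tS tS' hA hne hN NS ?_
      intro a ha v hav
      have := hnb a ha v hav
      simp only [mem_insert, mem_singleton, mem_union] at this ⊢
      have hvm : v = m → v ∈ C := by rintro rfl; exact mC
      clear * - this hvm
      tauto
  · exfalso
    push Not at hex
    have tri' : ∀ u ∈ C, ∀ v ∈ C, u ≠ v → (swp H h s(t, t')).Adj u v := fun u hu v hv huv =>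
      swp_adj.2 (Or.inl ⟨tri u hu v hv huv, (hex u hu v hv).symm⟩)
    obtain ⟨A, hA, hne, N, hN, NS, NF, hnb⟩ := hallC (C := C) (S := S) (F := {t, t'}) (hH'.noM5 hC) hS dj adj' tS tS' tC tC' (by simp) (by simp)
      (by
        intro w hw hwF
        obtain ⟨p, q, h1, h2, h3, h4⟩ := three_split hX hw
        have hp : p ∈ C := by simp [h4]
        have hq : q ∈ C := by simp [h4]
        exact ⟨p, hp, q, hq, tri' p hp q hq h3, h1.symm, h2.symm⟩)
      (by
        obtain ⟨p, q, r, h1, h2, h3, h4⟩ := card_eq_three.1 hX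
        have hp : p ∈ C := by simp [h4]
        have hq : q ∈ C := by simp [h4]
        exact ⟨p, hp, q, hq, tri' p hp q hq h1⟩)
    have hp := hne.card_pos
    rcases hN with ⟨hNC, hlt⟩ | hN
    · have hcov : Cov (swp H h s(t, t')) S {t, t'} C := by
        have h1 := cov_swp (h := h) (t := t) (t' := t') cov subset_rfl (empty_subset {t, t'}) (by simp)
        intro u v huv
        have := h1 u v huv
        clear * - this
        tauto
      have hcc := hcov.fail hnb
      have hc1 := card_sdiff_add_card_eq_card hA
      have c1 := card_union_le (A ∪ N) {t, t'}
      have c2 := card_union_le A N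
      refine Ex hC hH' hcc ?_ ?_ ?_ (by omega) (Or.inr ⟨by omega, by omega⟩)
      · rw [disjoint_right]
        intro v hv
        rw [mem_sdiff]
        rintro ⟨h1, h2⟩
        have h4 := disjoint_right.1 NS h1
        simp only [mem_union, mem_insert, mem_singleton, h2, h4, false_or] at hv
        rcases hv with rfl | rfl
        · exact tS h1
        · exact tS' h1
      · exact dj.mono_left sdiff_subset
      · rw [disjoint_left]
        intro v hv hvC
        have h4 := disjoint_right.1 hNC hvC
        have h5 : v ∉ A := fun h => nS v hvC (hA h)
        simp only [mem_union, mem_insert, mem_singleton, h5, h4, false_or] at hv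
        rcases hv with rfl | rfl
        · exact tC hvC
        · exact tC' hvC
    · refine big_fail hC hH' hS hX dj (cov_swp cov subset_union_left subset_rfl (by simp)) tS tS' hA hne hN NS ?_
      intro a ha v hav
      have := hnb a ha v hav
      simp only [mem_insert, mem_singleton, mem_union] at this ⊢
      clear * - this
      tauto

lemma C3.swapTC (hC : Ctx G c) (hH : Hyp G c H) {S C : Finset V} (K : C3 H S C) {t d p q : V} {h : Sym2 V}
    (htd : G.Adj t d) (tS : t ∉ S) (tC : t ∉ C) (hCe : C = {d, p, q}) (dp : d ≠ p) (dq : d ≠ q) (pq : p ≠ q)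
    (hh : h ∈ H.edgeSet) (hcol : c h = c s(t, d)) : h = s(p, q) := by
  by_contra hne
  have hH' := hH.swap (g := s(t, d)) (by simpa using htd) hh hcol
  obtain ⟨hS, hX, dj, cov, tri⟩ := K
  have hp : p ∈ C := by simp [hCe]
  have hq : q ∈ C := by simp [hCe]
  have hd : d ∈ C := by simp [hCe]
  refine fail4 hC hH' (F := insert t C) hS (by rw [card_insert_of_notMem tC, hX]) (by
      rw [disjoint_insert_right]; exact ⟨tS, dj⟩) (cov_swp cov (subset_insert _ _) subset_rfl (by simp [hd])) 
    (a := t) (b := d) (d := p) (e := q) (swp_adj.2 (Or.inr ⟨rfl, htd.ne⟩)) 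
    (swp_adj.2 (Or.inl ⟨tri p hp q hq pq, Ne.symm hne⟩)) (by rintro rfl; exact tC hp) (by rintro rfl; exact tC hq)
    dp dq (by simp) (by simp [hd]) (by simp [hp]) (by simp [hq])

lemma C3.swapDD (hC : Ctx G c) (hH : Hyp G c H) {S C : Finset V} (K : C3 H S C) {t t' d d' : V} 
    (htd : G.Adj t d) (htd' : G.Adj t' d') (tS : t ∉ S) (tS' : t' ∉ S) (tC : t ∉ C) (tC' : t' ∉ C) (hd : d ∈ C) (hd' : d' ∈ C)
    (tt : t ≠ t') : d = d' := by
  by_contra dd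
  obtain ⟨h1, hh1, e1⟩ := hH.all s(t, d) (by simpa using htd)
  obtain ⟨h2, hh2, e2⟩ := hH.all s(t', d') (by simpa using htd')
  obtain ⟨d2, d3, n1, n2, n3, hCe⟩ := three_split K.hX hd
  obtain ⟨p, hp, hpd, hpd'⟩ : ∃ p ∈ C, p ≠ d ∧ p ≠ d' := by
    by_cases d' = d2
    · exact ⟨d3, by simp [hCe], n2.symm, by grind⟩
    · exact ⟨d2, by simp [hCe], n1.symm, by grind⟩
  have hCe : C = {d, d', p} := by
    symm
    apply eq_of_subset_of_card_le
    · intro v hv; simp only [mem_insert, mem_singleton] at hv; rcases hv with rfl | rfl | rfl <;> assumption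
    · rw [K.hX, card_eq_three.2 ⟨d, d', p, dd, hpd.symm, hpd'.symm, rfl⟩]
  have f1 := K.swapTC hC hH htd tS tC hCe dd hpd.symm hpd'.symm hh1 e1
  have f2 := K.swapTC hC hH htd' tS' tC' (p := d) (q := p) (by rw [hCe]; ext; simp; tauto) (Ne.symm dd) hpd'.symm hpd.symm hh2 e2
  subst f1 f2
  have hH1 := hH.swap (g := s(t, d)) (by simpa using htd) hh1 e1
  have hne : ∀ {u v}, u ∉ C → v ∈ C → u ≠ v := by rintro u v h1 h2 rfl; exact h1 h2
  have m2 : s(d, p) ∈ (swp H s(d', p) s(t, d)).edgeSet := by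
    rw [SimpleGraph.mem_edgeSet, swp_adj]
    exact Or.inl ⟨hh2, by simp [dd, hpd.symm]⟩
  have hH2 := hH1.swap (g := s(t', d')) (by simpa using htd') m2 e2
  have dj := K.dj
  refine fail4 hC hH2 (F := {t, t', d, d'}) K.hS card_le_four ?_ ?_ (a := t) (b := d) (d := t') (e := d') 
    (swp_adj.2 (Or.inl ⟨swp_adj.2 (Or.inr ⟨rfl, htd.ne⟩), ?_⟩)) (swp_adj.2 (Or.inr ⟨rfl, htd'.ne⟩)) tt
    (hne tC hd') (hne tC' hd).symm dd (by simp) (by simp) (by simp) (by simp)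
  · simp only [disjoint_insert_right, disjoint_singleton_right]
    exact ⟨tS, tS', disjoint_right.1 dj hd, disjoint_right.1 dj hd'⟩
  · intro u v huv
    rcases swp_adj.1 huv with ⟨h1, h1'⟩ | ⟨h1, -⟩
    · rcases swp_adj.1 h1 with ⟨h2, h2'⟩ | ⟨h2, -⟩
      · rcases K.cov u v h2 with h3 | h3 | h3 | h3
        · exact Or.inl h3
        · exact Or.inr (Or.inl h3)
        · refine Or.inr (Or.inr (Or.inl ?_))
          have hn := h2.ne
          rw [hCe] at h3
          simp only [mem_insert, mem_singleton] at h3 ⊢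
          simp only [ne_eq, Sym2.eq_iff] at h1' h2'
          clear * - hn h3 h1' h2'
          grind
        · simp at h3
      · rw [Sym2.eq_iff] at h2
        rcases h2 with ⟨rfl, rfl⟩ | ⟨rfl, rfl⟩ <;> simp
    · rw [Sym2.eq_iff] at h1
      rcases h1 with ⟨rfl, rfl⟩ | ⟨rfl, rfl⟩ <;> simp
  · rw [ne_eq, Sym2.eq_iff]
    rintro (⟨h, -⟩ | ⟨h, -⟩)
    · exact hne tC hd h
    · exact hne tC hp h

end StepC2

set_option linter.unusedSectionVars false
set_option linter.unusedVariables false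

section StepC3
open Finset
variable {V : Type} [Fintype V] [DecidableEq V]
variable {G H : SimpleGraph V} {c : Sym2 V → ℕ}

lemma sum3b (hG : VK G) {S R : Finset V} (hS : S.card = 3) :
    ∑ v ∈ R, (NB G v ∩ S).card + (R.filter (fun v => (NB G v ∩ S).card ≤ 1)).card ≤ 2 * R.card + 2 := by
  have h1 : ∀ v ∈ R, (NB G v ∩ S).card + (if (NB G v ∩ S).card ≤ 1 then 1 else 0) ≤ 2 + if S ⊆ NB G v then 1 else 0 := by
    intro v _
    have h3 : (NB G v ∩ S).card ≤ 3 := hS ▸ card_le_card inter_subset_right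
    by_cases h : S ⊆ NB G v
    · rw [inter_eq_right.2 h, hS]; simp [h]
    · have : (NB G v ∩ S).card < 3 := by
        rw [← hS]
        refine card_lt_card ⟨inter_subset_right, fun hh => h (hh.trans inter_subset_left)⟩
      split_ifs <;> omega
  have h2 := sum_le_sum h1
  rw [sum_add_distrib, sum_add_distrib, sum_const, smul_eq_mul, ← card_filter, ← card_filter] at h2
  have := full3 hG (R := R) hS
  omega

lemma good_miss {S : Finset V} (hS : S.card = 3) {v : V} (h : ¬ (NB G v ∩ S).card ≤ 1) :
    ∃ m ∈ S, ∀ w ∈ S, w ≠ m → G.Adj w v := by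
  have h1 : (S \ NB G v).card ≤ 1 := by
    have := card_sdiff_add_card_inter S (NB G v)
    rw [inter_comm] at this
    omega
  have hpos : S.Nonempty := card_pos.1 (by omega)
  rcases (S \ NB G v).eq_empty_or_nonempty with h0 | ⟨m, hm⟩
  · obtain ⟨m, hm⟩ := hpos
    refine ⟨m, hm, fun w hw _ => ?_⟩
    by_contra hn
    have : w ∈ S \ NB G v := by simp [hw]; exact fun h => hn h.symm
    rw [h0] at this; simp at this
  · refine ⟨m, (mem_sdiff.1 hm).1, fun w hw hne => ?_⟩
    by_contra hn
    have : w ∈ S \ NB G v := by simp [hw]; exact fun h => hn h.symm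
    exact hne (card_le_one.1 h1 w this m hm)

lemma EIn3 {X : Finset V} (h : X.card = 3) : (EIn H X).card ≤ 3 := by
  have := EIn_sub_choose (G := H) X
  rwa [h] at this

lemma C3.sum (hC : Ctx G c) (hH : Hyp G c H) {S C : Finset V} (K : C3 H S C) :
    2 * Fintype.card V ≤ ∑ v ∈ Sᶜ, (NB H v ∩ S).card + 5 := by
  have h1 := edge_count H S
  have h2 := hH.card_ge hC
  have h3 : (EIn H S).card ≤ 3 := EIn3 K.hS
  have h4 : (EIn H Sᶜ).card ≤ (EIn H C).card := by
    apply card_le_card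
    intro e
    induction e with | _ u v
    rw [mk_mem_EIn, mk_mem_EIn, mem_compl, mem_compl]
    rintro ⟨a, b, d⟩
    have := K.cov u v a
    simp only [notMem_empty, false_and, or_false] at this
    exact ⟨a, by tauto⟩
  have h5 : (EIn H C).card ≤ 3 := EIn3 K.hX
  omega

lemma C3.oneTT (hC : Ctx G c) (hH : Hyp G c H) {S C : Finset V} (K : C3 H S C) {t t' s s' : V}
    (htt : G.Adj t t') (tS : t ∉ S) (tS' : t' ∉ S) (tC : t ∉ C) (tC' : t' ∉ C)
    (hss : G.Adj s s') (sS : s ∉ S) (sS' : s' ∉ S) (sC : s ∉ C) (sC' : s' ∉ C) : s(t, t') = s(s, s') := by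
  by_contra hne
  obtain ⟨h1, hh1, e1⟩ := hH.all s(t, t') (by simpa using htt)
  obtain ⟨h2, hh2, e2⟩ := hH.all s(s, s') (by simpa using hss)
  obtain ⟨m, p, q, -, -, -, hCe, -, a, ha, hnb⟩ := K.swapTT hC hH htt tS tS' tC tC' hh1 e1
  obtain ⟨m', p', q', -, -, -, hCe', -, a', ha', hnb'⟩ := K.swapTT hC hH hss sS sS' sC sC' hh2 e2
  have hmC : m ∈ C := by simp [hCe]
  have hmC' : m' ∈ C := by simp [hCe']
  have hn := hC.n11
  by_cases haa : a = a'
  · subst haa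
    obtain ⟨w, hwS, hw⟩ : ∃ w, w ∉ S ∧ ∀ v, (v = t ∨ v = t') → (v = s ∨ v = s') → v = w := by
      rw [Sym2.eq_iff] at hne
      have := htt.ne
      by_cases h : t = s ∨ t = s'
      · exact ⟨t, tS, by clear * - this h hne; grind⟩
      · exact ⟨t', tS', by clear * - h; grind⟩
    have hcov := K.cov.fail (A := {a}) (N := {w}) (by
      intro b hb v hbv
      rw [mem_singleton] at hb
      subst hb
      rw [mem_singleton]
      have i1 := hnb v hbv
      have i2 := hnb' v hbv
      have i3 := hw v
      by_cases hvC : v ∈ C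
      · exact Or.inr (Or.inl hvC)
      · have i4 : v ≠ m := by rintro rfl; exact hvC hmC
        have i5 : v ≠ m' := by rintro rfl; exact hvC hmC'
        clear * - i1 i2 i3 i4 i5
        tauto)
    have c1 := card_union_le ({a} ∪ {w}) C
    have c2 := card_union_le {a} {w}
    have c3 := K.hX
    have c4 := card_sdiff_add_card_eq_card (singleton_subset_iff.2 ha)
    have c5 := K.hS
    simp only [card_singleton] at c2 c4
    refine Ex hC hH hcov ?_ (by simp) (by simp) (by omega) (Or.inl ⟨rfl, by omega⟩)
    simp only [disjoint_union_right, disjoint_singleton_right, mem_sdiff, mem_singleton]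
    exact ⟨⟨by simp, by simp [hwS]⟩, K.dj.mono_left sdiff_subset⟩
  · classical
    have hsum := K.sum hC hH
    have b1 : ∀ v ∈ Sᶜ, (NB H v ∩ S).card ≤ (if H.Adj a v then 1 else 0) + (if H.Adj a' v then 1 else 0) + 1 := by
      intro v _
      have hsub : NB H v ∩ S ⊆ (if H.Adj a v then {a} else ∅) ∪ (if H.Adj a' v then {a'} else ∅) ∪ (S \ {a, a'}) := by
        intro w hw
        rw [mem_inter, mem_NB] at hw
        by_cases w1 : w = a
        · subst w1; simp [hw.1.symm]
        by_cases w2 : w = a'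
        · subst w2; simp [hw.1.symm]
        simp [w1, w2, hw.2]
      have c1 := card_le_card hsub
      have c2 := card_union_le ((if H.Adj a v then {a} else ∅) ∪ (if H.Adj a' v then {a'} else ∅)) (S \ {a, a'})
      have c3 := card_union_le (if H.Adj a v then {a} else ∅) (if H.Adj a' v then {a'} else ∅)
      have c4 : (S \ {a, a'}).card = 1 := by
        rw [card_sdiff_of_subset (by intro w hw; simp only [mem_insert, mem_singleton] at hw; rcases hw with rfl | rfl <;> assumption), K.hS, card_pair haa]
      have c5 : (if H.Adj a v then ({a} : Finset V) else ∅).card = if H.Adj a v then 1 else 0 := by split_ifs <;> simp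
      have c6 : (if H.Adj a' v then ({a'} : Finset V) else ∅).card = if H.Adj a' v then 1 else 0 := by split_ifs <;> simp
      omega
    have b2 := sum_le_sum b1
    rw [sum_add_distrib, sum_add_distrib, sum_const, ← card_filter, ← card_filter, smul_eq_mul] at b2
    have b3 : (Sᶜ.filter (fun v => H.Adj a v)).card ≤ 3 := by
      refine (card_le_card (t := {t, t', m}) ?_).trans card_le_three
      intro v hv
      rw [mem_filter, mem_compl] at hv
      have := hnb v hv.2
      simp only [mem_insert, mem_singleton]
      tauto
    have b4 : (Sᶜ.filter (fun v => H.Adj a' v)).card ≤ 3 := by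
      refine (card_le_card (t := {s, s', m'}) ?_).trans card_le_three
      intro v hv
      rw [mem_filter, mem_compl] at hv
      have := hnb' v hv.2
      simp only [mem_insert, mem_singleton]
      tauto
    have b5 := card_compl_add_card S
    have b6 := K.hS
    omega

set_option maxHeartbeats 1000000 in
lemma stepC (hC : Ctx G c) (hH : Hyp G c H) {S C : Finset V} (K : C3 H S C) : False := by
  classical
  have hn := hC.n11
  have hS := K.hS
  obtain ⟨T, hdis⟩ := tight3 hC hH K.cov K.dj (by simp) (by simp) hS (by simp [K.hX])
  have L : ∀ u v, lab C ∅ u = lab C ∅ v ↔ u = v ∨ (u ∈ C ∧ v ∈ C) := by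
    intro u v; rw [lab_eq (by simp)]; simp
  have nS : ∀ v, v ∈ C → v ∉ S := fun v hv => disjoint_right.1 K.dj hv
  have hsum := K.sum hC hH
  have hsum' : ∑ v ∈ Sᶜ, (NB H v ∩ S).card ≤ ∑ v ∈ Sᶜ, (NB G v ∩ S).card := by
    apply sum_le_sum
    intro v _
    apply card_le_card
    intro w
    rw [mem_inter, mem_inter, mem_NB, mem_NB]
    exact fun h => ⟨hH.le h.1, h.2⟩
  have hb := sum3b hC.vk (R := Sᶜ) hS
  have hcs := card_compl_add_card S
  have hbad : (Sᶜ.filter (fun v => (NB G v ∩ S).card ≤ 1)).card ≤ 1 := by omega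
  have hie := T.ie
  -- the two kinds of edges between classes
  let D := IE G S (lab C ∅)
  let D1 := D.filter (fun e => ∀ v ∈ e, v ∉ C)
  let D2 := D.filter (fun e => ¬ ∀ v ∈ e, v ∉ C)
  have hD : D1.card + D2.card = D.card := card_filter_add_card_filter_not _
  have hD' : D.card + 7 = Fintype.card V := hie
  have m1 : ∀ e ∈ D1, ∃ t t', e = s(t, t') ∧ G.Adj t t' ∧ t ∉ S ∧ t' ∉ S ∧ t ∉ C ∧ t' ∉ C := by
    intro e
    induction e with | _ u v
    intro he
    obtain ⟨he, h2⟩ := mem_filter.1 he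
    obtain ⟨i1, i2, i3, i4⟩ := mem_IE.1 he
    exact ⟨u, v, rfl, i1, i2, i3, h2 u (by simp), h2 v (by simp)⟩
  have m2 : ∀ e ∈ D2, ∃ t d, e = s(t, d) ∧ G.Adj t d ∧ t ∉ S ∧ t ∉ C ∧ d ∈ C := by
    intro e
    induction e with | _ u v
    intro he
    obtain ⟨he, h2⟩ := mem_filter.1 he
    obtain ⟨i1, i2, i3, i4⟩ := mem_IE.1 he
    rw [Ne, L] at i4
    by_cases hu : u ∈ C
    · exact ⟨v, u, Sym2.eq_swap, i1.symm, i3, by tauto, hu⟩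
    · by_cases hv : v ∈ C
      · exact ⟨u, v, rfl, i1, i2, hu, hv⟩
      · exfalso; apply h2; simp [hu, hv]
  have c1 : D1.card ≤ 1 := by
    rw [card_le_one]
    intro e he e' he'
    obtain ⟨t, t', rfl, a1, a2, a3, a4, a5⟩ := m1 e he
    obtain ⟨s, s', rfl, b1, b2, b3, b4, b5⟩ := m1 e' he'
    exact K.oneTT hC hH a1 a2 a3 a4 a5 b1 b2 b3 b4 b5
  have c2 : 3 ≤ D2.card := by omega
  obtain ⟨e0, he0⟩ := card_pos.1 (show 0 < D2.card by omega)
  obtain ⟨t0, d0, rfl, a01, a02, a03, hd0⟩ := m2 e0 he0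
  let T2 := Sᶜ.filter (fun t => t ∉ C ∧ G.Adj t d0)
  have hT2 : D2 ⊆ T2.image (fun t => s(t, d0)) := by
    intro e he
    obtain ⟨t, d, rfl, a1, a2, a3, a4⟩ := m2 e he
    have hdd : d = d0 := by
      by_cases htt : t = t0
      · subst htt
        have := T.inj (mem_filter.1 he).1 (mem_filter.1 he0).1 (by
          simp only [Sym2.map_mk]; rw [(L d d0).2 (Or.inr ⟨a4, hd0⟩)])
        rw [Sym2.eq_iff] at this
        rcases this with ⟨-, h⟩ | ⟨h, -⟩
        · exact h
        · exact absurd (h ▸ hd0) a3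
      · exact K.swapDD hC hH a1 a01 a2 a02 a3 a03 a4 hd0 htt
    subst hdd
    exact mem_image.2 ⟨t, by simp only [T2, mem_filter, mem_compl]; exact ⟨a2, a3, a1⟩, rfl⟩
  have cT2 : D2.card ≤ T2.card := (card_le_card hT2).trans card_image_le
  have memT2 : ∀ t, t ∈ T2 ↔ t ∉ S ∧ t ∉ C ∧ G.Adj t d0 := by intro t; simp [T2]
  -- components
  have d0S := nS d0 hd0
  obtain ⟨q, hq, hdq⟩ := hdis d0 d0S
  have mS : ∀ v, v ∈ ((↑S : Set V)ᶜ) ↔ v ∉ S := by simp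
  obtain ⟨Kc, hKc⟩ : ∃ Kc : Set V, Kc = {v | Reach G (↑S)ᶜ q v} := ⟨_, rfl⟩
  have cK : Conn G Kc := hKc ▸ Conn.comp ((mS q).2 hq)
  have memK : ∀ v, v ∈ Kc ↔ Reach G (↑S)ᶜ q v := by rw [hKc]; intro v; exact Iff.rfl
  have closK : ∀ u v, u ∈ Kc → v ∉ S → G.Adj u v → v ∈ Kc := by
    intro u v hu hv huv
    rw [memK] at hu ⊢
    exact comp_closed hu ((mS v).2 hv) huv
  have d0K : d0 ∉ Kc := by rw [memK]; exact fun h => hdq h.symm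
  have sK : ∀ w ∈ S, w ∉ Kc := by
    intro w hw h
    rw [memK] at h
    exact (mS w).1 h.mem_right hw
  have aK : ∀ w ∈ S, ∃ p ∈ Kc, G.Adj w p := by
    intro w hw
    rw [hKc]
    exact comp_touch' hC.vk hC.hE hS hq d0S (fun h => hdq h.symm) hw
  have nbK : ∀ v, v ∉ S → G.Adj v d0 → v ∉ Kc := fun v hv h hk => d0K (closK v d0 hk d0S h)
  obtain ⟨p1, p2, dp1, dp2, p12, hCe⟩ := three_split K.hX hd0
  have hp1 : p1 ∈ C := by simp [hCe]
  have hp2 : p2 ∈ C := by simp [hCe]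
  have adC : ∀ u ∈ C, ∀ v ∈ C, u ≠ v → G.Adj u v := fun u hu v hv huv => hH.le (K.tri u hu v hv huv)
  have CK : ∀ v ∈ C, v ∉ Kc := by
    intro v hv
    by_cases h : v = d0
    · rw [h]; exact d0K
    · exact nbK v (nS v hv) (adC v hv d0 hd0 h)
  -- the triangle object
  obtain ⟨mC, hOC⟩ : ∃ m, Ob G d0 S Kc {p1, p2} m := by
    obtain ⟨p, hp, hpg⟩ : ∃ p ∈ ({p1, p2} : Set V), ¬ (NB G p ∩ S).card ≤ 1 := by
      by_contra hcon
      push Not at hcon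
      have i1 := hcon p1 (by simp)
      have i2 := hcon p2 (by simp)
      exact p12 (card_le_one.1 hbad p1 (by simp [nS p1 hp1, i1]) p2 (by simp [nS p2 hp2, i2]))
    obtain ⟨m, hm, hmm⟩ := good_miss hS hpg
    refine ⟨m, Conn.pair (adC p1 hp1 p2 hp2 p12), by simp [dp1, dp2], ?_, ?_, ⟨p1, by simp, adC d0 hd0 p1 hp1 dp1⟩, hm, ?_⟩
    · rintro w hw (rfl | rfl)
      · exact nS _ hp1 hw
      · exact nS _ hp2 hw
    · rw [Set.disjoint_left]
      rintro w (rfl | rfl)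
      · exact CK _ hp1
      · exact CK _ hp2
    · intro w hw hne
      exact ⟨p, hp, hmm w hw hne⟩
  have hOt : ∀ t ∈ T2, ¬ (NB G t ∩ S).card ≤ 1 → ∃ m, Ob G d0 S Kc {t} m := by
    intro t ht hg
    rw [memT2] at ht
    obtain ⟨m, hm, hmm⟩ := good_miss hS hg
    refine ⟨m, Conn.singleton t, ?_, ?_, ?_, ⟨t, rfl, ht.2.2.symm⟩, hm, fun w hw hne => ⟨t, rfl, hmm w hw hne⟩⟩
    · exact ht.2.2.ne'
    · rintro w hw rfl; exact ht.1 hw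
    · rw [Set.disjoint_singleton_left]; exact nbK t ht.1 ht.2.2
  have hgood : T2.card ≤ (T2.filter (fun v => ¬ (NB G v ∩ S).card ≤ 1)).card + 1 := by
    have h1 := card_filter_add_card_filter_not (s := T2) (fun v => (NB G v ∩ S).card ≤ 1)
    have h2 : (T2.filter (fun v => (NB G v ∩ S).card ≤ 1)).card ≤ (Sᶜ.filter (fun v => (NB G v ∩ S).card ≤ 1)).card :=
      card_le_card (filter_subset_filter _ (filter_subset _ _))
    omega
  have dTC : ∀ t ∈ T2, Disjoint ({t} : Set V) {p1, p2} := by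
    intro t ht
    rw [memT2] at ht
    rw [Set.disjoint_singleton_left]
    rintro (rfl | rfl)
    · exact ht.2.1 hp1
    · exact ht.2.1 hp2
  by_cases h3 : 3 ≤ (T2.filter (fun v => ¬ (NB G v ∩ S).card ≤ 1)).card
  · obtain ⟨u, hu, v, hv, w, hw, huv, huw, hvw⟩ := two_lt_card.1 h3
    rw [mem_filter] at hu hv hw
    obtain ⟨_, o1⟩ := hOt u hu.1 hu.2
    obtain ⟨_, o2⟩ := hOt v hv.1 hv.2
    obtain ⟨_, o3⟩ := hOt w hw.1 hw.2
    exact Ob.four hC.vk hS cK d0K sK aK d0S o1 o2 o3 hOC (by simpa) (by simpa) (dTC u hu.1) (by simpa) (dTC v hv.1) (dTC w hw.1)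
  · obtain ⟨u, hu, v, hv, huv⟩ := one_lt_card.1 (show 1 < (T2.filter (fun v => ¬ (NB G v ∩ S).card ≤ 1)).card by omega)
    rw [mem_filter] at hu hv
    obtain ⟨_, o1⟩ := hOt u hu.1 hu.2
    obtain ⟨_, o2⟩ := hOt v hv.1 hv.2
    obtain ⟨e, he⟩ := card_pos.1 (show 0 < D1.card by omega)
    obtain ⟨t, t', rfl, a1, a2, a3, a4, a5⟩ := m1 e he
    obtain ⟨h1, hh1, e1⟩ := hH.all s(t, t') (by simpa using a1)
    obtain ⟨m, _, _, -, -, -, hCe', -, a, ha, hnb⟩ := K.swapTT hC hH a1 a2 a3 a4 a5 hh1 e1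
    have hmC : m ∈ C := by simp [hCe']
    have hnb' : ∀ v, v ∉ S → G.Adj a v → v = t ∨ v = t' ∨ v = m := by
      intro v hv hav
      have := hnb v ((T.edge a v hav).2 (Or.inl ha))
      tauto
    obtain ⟨p, q', hpq, hp, hq', ap, aq⟩ := Ob.three hC.vk hS cK d0K sK aK d0S o1 o2 hOC (by simpa) (dTC u hu.1) (dTC v hv.1) ha
    have nK : ∀ v', v' ∈ ({u} ∪ {v} ∪ {p1, p2} : Set V) → v' ∉ S ∧ v' ∉ Kc := by
      intro v' hv'
      have hu' := (memT2 u).1 hu.1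
      have hv'' := (memT2 v).1 hv.1
      rcases hv' with (rfl | rfl) | (rfl | rfl)
      · exact ⟨hu'.1, nbK _ hu'.1 hu'.2.2⟩
      · exact ⟨hv''.1, nbK _ hv''.1 hv''.2.2⟩
      · exact ⟨nS _ hp1, CK _ hp1⟩
      · exact ⟨nS _ hp2, CK _ hp2⟩
    obtain ⟨o, ho, hao⟩ := aK a ha
    have htK : t ∈ Kc ∧ t' ∈ Kc := by
      rcases hnb' o (fun h => sK o h ho) hao with rfl | rfl | rfl
      · exact ⟨ho, closK _ _ ho a3 a1⟩
      · exact ⟨closK _ _ ho a2 a1.symm, ho⟩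
      · exact absurd ho (CK _ hmC)
    have fin : ∀ v', v' ∈ ({u} ∪ {v} ∪ {p1, p2} : Set V) → G.Adj a v' → v' = m := by
      intro v' hv' hav
      have := nK v' hv'
      rcases hnb' v' this.1 hav with rfl | rfl | rfl
      · exact absurd htK.1 this.2
      · exact absurd htK.2 this.2
      · rfl
    exact hpq ((fin p hp ap).trans (fin q' hq' aq).symm)

end StepC3

set_option linter.unusedSectionVars false
set_option linter.unusedVariables false

section StepD1
open Finset
variable {V : Type} [Fintype V] [DecidableEq V]
variable {G H : SimpleGraph V} {c : Sym2 V → ℕ}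

structure C4 (H : SimpleGraph V) (S : Finset V) : Prop where
  hS : S.card = 4
  cov : ∀ u v, H.Adj u v → u ∈ S ∨ v ∈ S

structure Wk (H : SimpleGraph V) (S : Finset V) (a x w : V) : Prop where
  aS : a ∈ S
  xS : x ∉ S
  wS : w ∉ S
  xw : x ≠ w
  ax : H.Adj a x
  aw : H.Adj a w
  nb : ∀ z, z ∉ S → H.Adj a z → z = x ∨ z = w

lemma Wk.symm {S : Finset V} {a x w : V} (h : Wk H S a x w) : Wk H S a w x :=
  ⟨h.aS, h.wS, h.xS, h.xw.symm, h.aw, h.ax, fun z hz hh => (h.nb z hz hh).symm⟩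

lemma two_off (hC : Ctx G c) (hH : Hyp G c H) {S : Finset V} (hS : S.card = 3) : 2 ≤ (EIn H Sᶜ).card := by
  have h1 := edge_count H S
  have h2 := sum3 (hH.vk hC) (R := Sᶜ) hS
  have h3 := hH.card_ge hC
  have h4 : (EIn H S).card ≤ 3 := EIn3 hS
  have h5 := card_compl_add_card S
  have := hC.n11
  omega

lemma C4.two_nb (hC : Ctx G c) (hH : Hyp G c H) {S : Finset V} (K : C4 H S) {a : V} (ha : a ∈ S) :
    ∃ z z', z ≠ z' ∧ z ∉ S ∧ z' ∉ S ∧ H.Adj a z ∧ H.Adj a z' := by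
  have h := two_off hC hH (S := S.erase a) (by rw [card_erase_of_mem ha, K.hS])
  obtain ⟨e, he, e', he', hne⟩ := one_lt_card.1 (show 1 < _ from h)
  have key : ∀ e ∈ EIn H (S.erase a)ᶜ, ∃ z, e = s(a, z) ∧ z ∉ S ∧ H.Adj a z := by
    intro e
    induction e with | _ u v
    rw [mk_mem_EIn]
    simp only [mem_compl, mem_erase, not_and]
    rintro ⟨h1, h2, h3⟩
    have hn := h1.ne
    by_cases hu : u = a
    · subst hu
      exact ⟨v, rfl, h3 hn.symm, h1⟩
    · have hv : v = a := by
        by_contra hv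
        rcases K.cov u v h1 with h | h
        · exact h2 hu h
        · exact h3 hv h
      subst hv
      exact ⟨u, Sym2.eq_swap, h2 hu, h1.symm⟩
  obtain ⟨z, rfl, h1, h2⟩ := key e he
  obtain ⟨z', rfl, h1', h2'⟩ := key e' he'
  exact ⟨z, z', fun h => hne (by rw [h]), h1, h1', h2, h2'⟩

lemma C4.edge (hC : Ctx G c) (hH : Hyp G c H) {S : Finset V} (K : C4 H S) {u v : V} {h : Sym2 V}
    (huv : G.Adj u v) (uS : u ∉ S) (vS : v ∉ S) (hh : h ∈ H.edgeSet) (hcol : c h = c s(u, v)) :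
    ∃ a x y w, ((x = u ∧ y = v) ∨ (x = v ∧ y = u)) ∧ Wk H S a x w ∧ h = s(a, w) := by
  have hH' := hH.swap (g := s(u, v)) (by simpa using huv) hh hcol
  have adj' : (swp H h s(u, v)).Adj u v := swp_adj.2 (Or.inr ⟨rfl, huv.ne⟩)
  have : Nonempty V := ⟨u⟩
  have hS := K.hS
  obtain ⟨A, hA, hne, N, hN, NS, NF, hnb⟩ := hall_fail (F := {u, v}) (S := S) (hH'.noM5 hC) (by
    intro f hf hF
    refine hf.ext1 hS adj' uS vS ?_ ?_
    · rintro a ha rfl; exact hF a ha (by simp)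
    · rintro a ha rfl; exact hF a ha (by simp))
  have hcov : Cov (swp H h s(u, v)) S {u, v} ∅ := cov_swp (X := ∅) (Y := ∅) (by
    intro p q hpq; have := K.cov p q hpq; tauto) (by simp) subset_rfl (by simp)
  have hf := hcov.fail hnb
  have c1 := card_union_le (A ∪ N) {u, v}
  have c2 := card_union_le A N
  have c3 := card_le_two (a := u) (b := v)
  have c4 := card_sdiff_add_card_eq_card hA
  have c5 := hne.card_pos
  have hdj : Disjoint (S \ A) (A ∪ N ∪ {u, v}) := by
    rw [disjoint_right]
    intro z hz
    rw [mem_sdiff]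
    rintro ⟨h1, h2⟩
    have h4 := disjoint_right.1 NS h1
    simp only [mem_union, mem_insert, mem_singleton, h2, h4, false_or] at hz
    rcases hz with rfl | rfl
    · exact uS h1
    · exact vS h1
  by_cases hA1 : A.card = 1
  swap
  · exact (Ex hC hH' hf hdj (by simp) (by simp) (by omega) (Or.inl ⟨rfl, by omega⟩)).elim
  obtain ⟨a, rfl⟩ := card_eq_one.1 hA1
  have haS : a ∈ S := hA (by simp)
  have hN0 : N = ∅ := card_eq_zero.1 (by omega)
  subst hN0
  have au : a ≠ u := by rintro rfl; exact uS haS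
  have av : a ≠ v := by rintro rfl; exact vS haS
  have hX : ({a} ∪ ∅ ∪ {u, v} : Finset V).card = 3 := by
    rw [union_empty, ← insert_eq, card_eq_three]; exact ⟨a, u, v, au, av, huv.ne, rfl⟩
  have hnt : ¬ ((swp H h s(u, v)).Adj a u ∧ (swp H h s(u, v)).Adj a v) := by
    rintro ⟨h1, h2⟩
    refine stepC hC hH' (S := S \ {a}) (C := {a} ∪ ∅ ∪ {u, v}) ⟨by omega, hX, hdj, hf, ?_⟩
    intro p hp q hq hpq
    simp only [mem_union, mem_insert, mem_singleton, notMem_empty, or_false] at hp hq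
    rcases hp with rfl | rfl | rfl <;> rcases hq with rfl | rfl | rfl <;>
      first | exact absurd rfl hpq | assumption | (apply SimpleGraph.Adj.symm; assumption)
  have hnb' : ∀ z, z ∉ S → (swp H h s(u, v)).Adj a z → z = u ∨ z = v := by
    intro z hz haz
    have := hnb a (by simp) z haz
    simp only [mem_insert, mem_singleton, notMem_empty, or_false] at this
    tauto
  -- one of the two edges survives
  obtain ⟨x, y, hxy, hax⟩ : ∃ x y, ((x = u ∧ y = v) ∨ (x = v ∧ y = u)) ∧ (swp H h s(u, v)).Adj a x := by
    by_contra hcon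
    push Not at hcon
    have n1 := hcon u v (Or.inl ⟨rfl, rfl⟩)
    have n2 := hcon v u (Or.inr ⟨rfl, rfl⟩)
    have h2 := two_off hC hH' (S := S \ {a}) (by omega)
    have h3 : EIn (swp H h s(u, v)) (S \ {a})ᶜ ⊆ {s(u, v)} := by
      intro e
      induction e with | _ p q
      rw [mk_mem_EIn, mem_singleton]
      simp only [mem_compl, mem_sdiff, mem_singleton, not_and, not_not]
      rintro ⟨h1, h2, h3⟩
      have hne := h1.ne
      have key : ∀ p q, (swp H h s(u, v)).Adj p q → (q ∈ S → q = a) → p = a → False := by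
        rintro p q h1 h2 rfl
        by_cases hq : q ∈ S
        · exact h1.ne (h2 hq).symm
        · rcases hnb' q hq h1 with rfl | rfl
          · exact n1 h1
          · exact n2 h1
      have pa : p ≠ a := fun h => key p q h1 h3 h
      have qa : q ≠ a := fun h => key q p h1.symm h2 h
      have pS : p ∉ S := fun h => pa (h2 h)
      have qS : q ∉ S := fun h => qa (h3 h)
      have := hcov p q h1
      simp only [pS, qS, false_or, mem_insert, mem_singleton, notMem_empty, false_and, or_false] at this
      rcases this with ⟨rfl | rfl, rfl | rfl⟩
      · exact absurd rfl hne
      · rfl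
      · exact Sym2.eq_swap
      · exact absurd rfl hne
    have := card_le_card h3
    simp at this
    omega
  have xS : x ∉ S := by rcases hxy with ⟨rfl, -⟩ | ⟨rfl, -⟩ <;> assumption
  have hnx : ∀ z, z ∉ S → (swp H h s(u, v)).Adj a z → z = x := by
    intro z hz haz
    by_contra hzx
    apply hnt
    rcases hnb' z hz haz with rfl | rfl <;> rcases hxy with ⟨rfl, -⟩ | ⟨rfl, -⟩ <;> tauto
  have hne_g : ∀ z, s(a, z) ≠ s(u, v) := by
    intro z hz
    rw [Sym2.eq_iff] at hz
    rcases hz with ⟨h, -⟩ | ⟨h, -⟩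
    · exact au h
    · exact av h
  have haxH : H.Adj a x := by
    rcases swp_adj.1 hax with h1 | h1
    · exact h1.1
    · exact absurd h1.1 (hne_g x)
  have hor : ∀ z, z ∉ S → H.Adj a z → z = x ∨ s(a, z) = h := by
    intro z hz haz
    by_cases he : s(a, z) = h
    · exact Or.inr he
    · exact Or.inl (hnx z hz (swp_adj.2 (Or.inl ⟨haz, he⟩)))
  obtain ⟨w, hwS, hwx, haw⟩ : ∃ w, w ∉ S ∧ w ≠ x ∧ H.Adj a w := by
    obtain ⟨z, z', hzz, h1, h2, h3, h4⟩ := K.two_nb hC hH haS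
    by_cases hz : z = x
    · exact ⟨z', h2, fun h => hzz (hz.trans h.symm), h4⟩
    · exact ⟨z, h1, hz, h3⟩
  have hw : s(a, w) = h := (hor w hwS haw).resolve_left hwx
  refine ⟨a, x, y, w, hxy, ⟨haS, xS, hwS, hwx.symm, haxH, haw, ?_⟩, hw.symm⟩
  intro z hz haz
  rcases hor z hz haz with h1 | h1
  · exact Or.inl h1
  · right
    rw [← hw, Sym2.eq_iff] at h1
    rcases h1 with ⟨-, h1⟩ | ⟨h1, -⟩
    · exact h1
    · exact absurd haS (h1 ▸ hwS)

end StepD1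

set_option linter.unusedSectionVars false
set_option linter.unusedVariables false

section StepD2
open Finset
variable {V : Type} [Fintype V] [DecidableEq V]
variable {G H : SimpleGraph V} {c : Sym2 V → ℕ}

lemma tri_of_EIn {X : Finset V} (hX : X.card = 3) (h : 3 ≤ (EIn H X).card) {u v : V} (hu : u ∈ X) (hv : v ∈ X)
    (huv : u ≠ v) : H.Adj u v := by
  by_contra hn
  obtain ⟨p, q, up, uq, pq, hXe⟩ := three_split hX hu
  obtain ⟨m, hm⟩ : ∃ m, X = {u, v, m} := by
    rw [hXe] at hv
    simp only [mem_insert, mem_singleton] at hv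
    rcases hv with h | h | h
    · exact absurd h.symm huv
    · subst h; exact ⟨q, hXe⟩
    · subst h; exact ⟨p, by rw [hXe]; ext; simp; tauto⟩
  have hs : EIn H X ⊆ {s(u, m), s(v, m)} := by
    intro e
    induction e with | _ a b
    rw [mk_mem_EIn, hm]
    simp only [mem_insert, mem_singleton, Sym2.eq_iff]
    rintro ⟨h1, h2, h3⟩
    have hne := h1.ne
    have n1 : ¬ (a = u ∧ b = v) := by rintro ⟨rfl, rfl⟩; exact hn h1
    have n2 : ¬ (a = v ∧ b = u) := by rintro ⟨rfl, rfl⟩; exact hn h1.symm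
    clear * - h2 h3 hne n1 n2
    grind
  have h1 := card_le_card hs
  have h2 := card_le_two (a := s(u, m)) (b := s(v, m))
  omega

structure WF (G H : SimpleGraph V) (c : Sym2 V → ℕ) (S : Finset V) (a x w : V) : Prop where
  good : ∀ v, v ∉ S.erase a → ¬ (NB H v ∩ S.erase a).card ≤ 1
  tri : ∀ u ∈ S.erase a, ∀ v ∈ S.erase a, u ≠ v → H.Adj u v
  nxw : ¬ G.Adj x w
  nt : ∀ t, t ∉ S → G.Adj x t → G.Adj w t → False
  deg : ∀ o p q r s, o ∉ S.erase a → p ∉ S.erase a → q ∉ S.erase a → r ∉ S.erase a → s ∉ S.erase a →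
    G.Adj o p → G.Adj o q → G.Adj o r → G.Adj o s → p ≠ q → p ≠ r → p ≠ s → q ≠ r → q ≠ s → r ≠ s → False
  cnt : 3 ≤ (EIn G Sᶜ).card
  dsw : ∀ t t', t ∉ S → t' ∉ S → G.Adj x t → G.Adj w t' → c s(a, w) = c s(x, t) → c s(a, x) = c s(w, t') → False

lemma Wk.cov {S : Finset V} {a x w : V} (K : C4 H S) (W : Wk H S a x w) : Cov H (S.erase a) {a, x, w} ∅ := by
  intro u v huv
  have h1 := K.cov u v huv
  have h2 := W.nb u
  have h3 := W.nb v
  have h4 := huv.symm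
  have hn := huv.ne
  by_cases hu : u = a
  · subst hu
    by_cases hv : v ∈ S
    · right; left; simp [hv, hn.symm]
    · have := h3 hv huv
      simp; tauto
  · by_cases hv : v = a
    · subst hv
      by_cases hu : u ∈ S
      · left; simp [hu, hn]
      · have := h2 hu h4
        simp; tauto
    · simp [hu, hv]; tauto

set_option maxHeartbeats 1000000 in
lemma Wk.facts (hC : Ctx G c) (hH : Hyp G c H) {S : Finset V} (K : C4 H S) {a x w : V} (W : Wk H S a x w) :
    WF G H c S a x w := by
  classical
  have hn := hC.n11
  have aS := W.aS
  have xS := W.xS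
  have wS := W.wS
  have xw := W.xw
  have axn : a ≠ x := by rintro rfl; exact xS aS
  have awn : a ≠ w := by rintro rfl; exact wS aS
  have hcov := W.cov K
  have hS3 : (S.erase a).card = 3 := by rw [card_erase_of_mem aS, K.hS]
  have mS3 : ∀ v, v ∉ S.erase a ↔ (v = a ∨ v ∉ S) := by
    intro v; rw [mem_erase]; tauto
  have hX : ({a, x, w} : Finset V).card = 3 := card_eq_three.2 ⟨a, x, w, axn, awn, xw, rfl⟩
  have hdj : Disjoint (S.erase a) {a, x, w} := by
    simp only [disjoint_insert_right, disjoint_singleton_right, mS3]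
    exact ⟨Or.inl trivial, Or.inr xS, Or.inr wS⟩
  obtain ⟨T, hdis⟩ := tight3 hC hH hcov hdj (by simp) (by simp) hS3 (by simp [hX])
  have L : ∀ u v, lab {a, x, w} ∅ u = lab {a, x, w} ∅ v ↔ u = v ∨ (u ∈ ({a, x, w} : Finset V) ∧ v ∈ ({a, x, w} : Finset V)) := by
    intro u v; rw [lab_eq (by simp)]; simp
  have hoff : (EIn H (S.erase a)ᶜ).card ≤ 2 := by
    have hsub : EIn H (S.erase a)ᶜ ⊆ {s(a, x), s(a, w)} := by
      intro e
      induction e with | _ u v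
      rw [mk_mem_EIn, mem_compl, mem_compl, mS3, mS3]
      rintro ⟨h1, h2, h3⟩
      have hc := K.cov u v h1
      have b1 := W.nb u
      have b2 := W.nb v
      have b3 := h1.symm
      have hne := h1.ne
      simp only [mem_insert, mem_singleton, Sym2.eq_iff]
      by_cases hu : u = a
      · subst hu
        have : v ∉ S := h3.resolve_left hne.symm
        rcases b2 this h1 with h | h
        · exact Or.inl (Or.inl ⟨rfl, h⟩)
        · exact Or.inr (Or.inl ⟨rfl, h⟩)
      · have hu' := h2.resolve_left hu
        have hv : v = a := by clear * - hc h3 hu'; tauto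
        subst hv
        rcases b1 hu' b3 with h | h
        · exact Or.inl (Or.inr ⟨h, rfl⟩)
        · exact Or.inr (Or.inr ⟨h, rfl⟩)
    exact (card_le_card hsub).trans card_le_two
  have e1 := edge_count H (S.erase a)
  have e2 := hH.card_ge hC
  have e3 := EIn3 (H := H) hS3
  have e4 := sum3b (hH.vk hC) (R := (S.erase a)ᶜ) hS3
  have e5 := card_compl_add_card (S.erase a)
  have hbad : ((S.erase a)ᶜ.filter (fun v => (NB H v ∩ S.erase a).card ≤ 1)).card = 0 := by omega
  have good : ∀ v, v ∉ S.erase a → ¬ (NB H v ∩ S.erase a).card ≤ 1 := by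
    intro v hv h
    have : v ∈ ((S.erase a)ᶜ.filter (fun v => (NB H v ∩ S.erase a).card ≤ 1)) := by
      rw [mem_filter, mem_compl]; exact ⟨hv, h⟩
    rw [card_eq_zero.1 hbad] at this
    simp at this
  have goodG : ∀ v, v ∉ S.erase a → ¬ (NB G v ∩ S.erase a).card ≤ 1 := by
    intro v hv h
    apply good v hv
    refine le_trans (card_le_card ?_) h
    intro w
    rw [mem_inter, mem_inter, mem_NB, mem_NB]
    exact fun h => ⟨hH.le h.1, h.2⟩
  have deg : ∀ o p q r s, o ∉ S.erase a → p ∉ S.erase a → q ∉ S.erase a → r ∉ S.erase a → s ∉ S.erase a →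
    G.Adj o p → G.Adj o q → G.Adj o r → G.Adj o s → p ≠ q → p ≠ r → p ≠ s → q ≠ r → q ≠ s → r ≠ s → False := by
    intro o p q r s oS pS qS rS sS hop hoq hor hos pq pr ps qr qs rs
    obtain ⟨z, hz, hdz⟩ := hdis o oS
    have mS : ∀ v, v ∈ (((S.erase a : Finset V) : Set V)ᶜ) ↔ v ∉ (S.erase a) := by intro v; rw [Set.mem_compl_iff, mem_coe]
    obtain ⟨Kc, hKc⟩ : ∃ Kc : Set V, Kc = {v | Reach G (↑(S.erase a))ᶜ z v} := ⟨_, rfl⟩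
    have cK : Conn G Kc := hKc ▸ Conn.comp ((mS z).2 hz)
    have memK : ∀ v, v ∈ Kc ↔ Reach G (↑(S.erase a))ᶜ z v := by rw [hKc]; intro v; exact Iff.rfl
    have closK : ∀ u v, u ∈ Kc → v ∉ (S.erase a) → G.Adj u v → v ∈ Kc := by
      intro u v hu hv huv
      rw [memK] at hu ⊢
      exact comp_closed hu ((mS v).2 hv) huv
    have oK : o ∉ Kc := by rw [memK]; exact fun h => hdz h.symm
    have sK : ∀ w ∈ (S.erase a), w ∉ Kc := by
      intro w hw h
      rw [memK] at h
      exact (mS w).1 h.mem_right hw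
    have aK : ∀ w ∈ (S.erase a), ∃ p ∈ Kc, G.Adj w p := by
      intro w hw
      rw [hKc]
      exact comp_touch' hC.vk hC.hE hS3 hz oS (fun h => hdz h.symm) hw
    have hO : ∀ t, t ∉ (S.erase a) → G.Adj o t → ∃ m, Ob G o (S.erase a) Kc {t} m := by
      intro t ht hot
      obtain ⟨m, hm, hmm⟩ := good_miss hS3 (goodG t ht)
      refine ⟨m, Conn.singleton t, hot.ne, ?_, ?_, ⟨t, rfl, hot⟩, hm, fun w hw hne => ⟨t, rfl, hmm w hw hne⟩⟩
      · rintro w hw rfl; exact ht hw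
      · rw [Set.disjoint_singleton_left]; exact fun h => oK (closK t o h oS hot.symm)
    obtain ⟨_, o1⟩ := hO p pS hop
    obtain ⟨_, o2⟩ := hO q qS hoq
    obtain ⟨_, o3⟩ := hO r rS hor
    obtain ⟨_, o4⟩ := hO s sS hos
    exact Ob.four hC.vk hS3 cK oK sK aK oS o1 o2 o3 o4 (by simpa) (by simpa) (by simpa) (by simpa) (by simpa) (by simpa)
  have nxw : ¬ G.Adj x w := by
    intro h
    have := (T.edge x w h).2 (by simp)
    exact (K.cov x w this).elim xS wS
  have nt : ∀ t, t ∉ S → G.Adj x t → G.Adj w t → False := by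
    intro t ht h1 h2
    have ta : t ≠ a := by rintro rfl; exact ht aS
    have tx := h1.ne
    have tw := h2.ne
    have i1 : s(x, t) ∈ IE G (S.erase a) (lab {a, x, w} ∅) := by
      rw [mem_IE, mS3, mS3, Ne, L]; simp; clear * - h1 xS ht ta tx tw; tauto
    have i2 : s(w, t) ∈ IE G (S.erase a) (lab {a, x, w} ∅) := by
      rw [mem_IE, mS3, mS3, Ne, L]; simp; clear * - h2 wS ht ta tx tw; tauto
    have := T.inj i1 i2 (by simp only [Sym2.map_mk]; rw [(L x w).2 (by simp)])
    rw [Sym2.eq_iff] at this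
    clear * - this xw tx tw
    tauto
  refine ⟨good, ?_, nxw, nt, deg, ?_, ?_⟩
  · intro u hu v hv huv
    exact tri_of_EIn hS3 (by omega) hu hv huv
  · let Z := Sᶜ.filter (fun z => G.Adj a z ∧ z ≠ x ∧ z ≠ w)
    have hZ : Z.card ≤ 1 := by
      rw [card_le_one]
      intro z hz z' hz'
      simp only [Z, mem_filter, mem_compl] at hz hz'
      by_contra hne
      refine deg a x w z z' ?_ ?_ ?_ ?_ ?_ (hH.le W.ax) (hH.le W.aw) hz.2.1 hz'.2.1 xw ?_ ?_ ?_ ?_ hne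
      · simp
      · rw [mS3]; exact Or.inr xS
      · rw [mS3]; exact Or.inr wS
      · rw [mS3]; exact Or.inr hz.1
      · rw [mS3]; exact Or.inr hz'.1
      · exact hz.2.2.1.symm
      · exact hz'.2.2.1.symm
      · exact hz.2.2.2.symm
      · exact hz'.2.2.2.symm
    have hsub : IE G (S.erase a) (lab {a, x, w} ∅) ⊆ EIn G Sᶜ ∪ Z.image (fun z => s(a, z)) := by
      intro e
      induction e with | _ u v
      rw [mem_IE, mS3, mS3, Ne, L, mem_union, mk_mem_EIn, mem_image]
      rintro ⟨h1, h2, h3, h4⟩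
      have hne := h1.ne
      simp only [mem_insert, mem_singleton] at h4
      by_cases hu : u = a
      · subst hu
        right
        refine ⟨v, ?_, rfl⟩
        simp only [Z, mem_filter, mem_compl]
        clear * - h1 h3 h4 hne
        tauto
      · by_cases hv : v = a
        · subst hv
          right
          refine ⟨u, ?_, Sym2.eq_swap⟩
          have := h1.symm
          simp only [Z, mem_filter, mem_compl]
          clear * - this h2 h4 hne
          tauto
        · left
          simp only [mem_compl]
          clear * - h1 h2 h3 hu hv
          tauto
    have b1 := card_le_card hsub
    have b2 := card_union_le (EIn G Sᶜ) (Z.image (fun z => s(a, z)))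
    have b3 := card_image_le (s := Z) (f := fun z => s(a, z))
    have b4 := T.ie
    omega
  · intro t t' tS tS' hxt hwt e1 e2
    have tw : t ≠ w := by rintro rfl; exact nxw hxt
    have tx : t' ≠ x := by rintro rfl; exact nxw hwt.symm
    have tt : t ≠ t' := by rintro rfl; exact nt t tS hxt hwt
    have ta : t ≠ a := by rintro rfl; exact tS aS
    have ta' : t' ≠ a := by rintro rfl; exact tS' aS
    have hH1 := hH.swap (g := s(x, t)) (by simpa using hxt) (by simpa using W.aw) e1
    have m2 : s(a, x) ∈ (swp H s(a, w) s(x, t)).edgeSet := by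
      rw [SimpleGraph.mem_edgeSet, swp_adj]
      exact Or.inl ⟨W.ax, by rw [ne_eq, Sym2.eq_iff]; clear * - xw awn; tauto⟩
    have hH2 := hH1.swap (g := s(w, t')) (by simpa using hwt) m2 e2
    refine fail4 hC hH2 (S := S.erase a) (F := {x, t, w, t'}) hS3 card_le_four ?_ ?_ (a := x) (b := t) (d := w) (e := t')
      (swp_adj.2 (Or.inl ⟨swp_adj.2 (Or.inr ⟨rfl, hxt.ne⟩), ?_⟩)) (swp_adj.2 (Or.inr ⟨rfl, hwt.ne⟩)) xw
      tx.symm tw tt (by simp) (by simp) (by simp) (by simp)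
    · simp only [disjoint_insert_right, disjoint_singleton_right, mS3]
      exact ⟨Or.inr xS, Or.inr tS, Or.inr wS, Or.inr tS'⟩
    · intro u v huv
      rcases swp_adj.1 huv with ⟨h1, h1'⟩ | ⟨h1, -⟩
      · rcases swp_adj.1 h1 with ⟨h2, h2'⟩ | ⟨h2, -⟩
        · have hn := h2.ne
          rcases hcov u v h2 with h3 | h3 | h3 | h3
          · exact Or.inl h3
          · exact Or.inr (Or.inl h3)
          · refine Or.inr (Or.inr (Or.inl ?_))
            simp only [mem_insert, mem_singleton] at h3 ⊢
            simp only [ne_eq, Sym2.eq_iff] at h1' h2'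
            clear * - hn h3 h1' h2'
            grind
          · simp at h3
        · rw [Sym2.eq_iff] at h2
          rcases h2 with ⟨rfl, rfl⟩ | ⟨rfl, rfl⟩ <;> simp
      · rw [Sym2.eq_iff] at h1
        rcases h1 with ⟨rfl, rfl⟩ | ⟨rfl, rfl⟩ <;> simp
    · rw [ne_eq, Sym2.eq_iff]
      clear * - axn ta
      tauto

end StepD2

set_option linter.unusedSectionVars false
set_option linter.unusedVariables false

section StepD3
open Finset
variable {V : Type} [Fintype V] [DecidableEq V]
variable {G H : SimpleGraph V} {c : Sym2 V → ℕ}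

lemma noWeak (hC : Ctx G c) {S : Finset V} (K : C4 G S) : False := by
  classical
  have hn := hC.n11
  have hcs := card_compl_add_card S
  have hS := K.hS
  have key : ∀ a ∈ S, (Sᶜ \ NB G a).card ≤ 1 := by
    intro a ha
    have hS3 : (S.erase a).card = 3 := by rw [card_erase_of_mem ha, K.hS]
    have haS : a ∉ S.erase a := by simp
    have h1 : ((S.erase a)ᶜ.image (id : V → V)).card ≤ ((IE G (S.erase a) (id : V → V)).image (Sym2.map id)).card + 2 := by
      by_cases hr : ∀ q, q ∉ S.erase a → Reach G (↑(S.erase a))ᶜ a q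
      · exact (quot_one _ _ haS hr).trans (by omega)
      · push Not at hr
        obtain ⟨p', hp', hr⟩ := hr
        refine quot_two _ _ haS hp' ?_
        intro q hq
        by_contra hcon
        push Not at hcon
        exact three_comps hC.vk hC.hE hS3 haS hp' hq hr hcon.1 hcon.2
    rw [image_id] at h1
    have h2 := card_image_le (s := IE G (S.erase a) (id : V → V)) (f := Sym2.map id)
    have h3 : IE G (S.erase a) (id : V → V) ⊆ (Sᶜ ∩ NB G a).image (fun z => s(a, z)) := by
      intro e
      induction e with | _ u v
      rw [mem_IE]
      simp only [mem_image, mem_inter, mem_compl, mem_NB, mem_erase, not_and, id]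
      rintro ⟨i1, i2, i3, i4⟩
      by_cases hu : u = a
      · subst hu
        exact ⟨v, ⟨i3 (Ne.symm i4), i1⟩, rfl⟩
      · have hv : v = a := by
          by_contra hv
          rcases K.cov u v i1 with h | h
          · exact i2 hu h
          · exact i3 hv h
        subst hv
        exact ⟨u, ⟨i2 hu, i1.symm⟩, Sym2.eq_swap⟩
    have h4 := (card_le_card h3).trans card_image_le
    have h5 := card_compl_add_card (S.erase a)
    have h6 := card_sdiff_add_card_inter Sᶜ (NB G a)
    omega
  obtain ⟨a, ha⟩ := card_pos.1 (show 0 < S.card by omega)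
  have hS3 : (S.erase a).card = 3 := by rw [card_erase_of_mem ha, K.hS]
  have hf := full3 hC.vk (R := Sᶜ) hS3
  have hsub : Sᶜ ⊆ Sᶜ.filter (fun v => S.erase a ⊆ NB G v) ∪ (S.erase a).biUnion (fun b => Sᶜ \ NB G b) := by
    intro v hv
    rw [mem_union]
    by_cases h : S.erase a ⊆ NB G v
    · left; rw [mem_filter]; exact ⟨hv, h⟩
    · right
      rw [not_subset] at h
      obtain ⟨b, hb, hbv⟩ := h
      rw [mem_biUnion]
      refine ⟨b, hb, ?_⟩
      rw [mem_sdiff, mem_NB]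
      rw [mem_NB] at hbv
      exact ⟨hv, fun h => hbv h.symm⟩
  have b1 := card_le_card hsub
  have b2 := card_union_le (Sᶜ.filter (fun v => S.erase a ⊆ NB G v)) ((S.erase a).biUnion (fun b => Sᶜ \ NB G b))
  have b3 : ((S.erase a).biUnion (fun b => Sᶜ \ NB G b)).card ≤ (S.erase a).card * 1 :=
    card_biUnion_le_card_mul _ _ _ (fun b hb => key b (mem_of_mem_erase hb))
  omega

lemma threeWeak (hC : Ctx G c) (hH : Hyp G c H) {S T : Finset V} (K : C4 H S) (hT : T ⊆ S) (hT3 : T.card = 3)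
    (hW : ∀ a ∈ T, ∃ x w, Wk H S a x w) : False := by
  classical
  have hn := hC.n11
  have e1 := edge_count H S
  have e2 := hH.card_ge hC
  have e3 := EIn_sub_choose (G := H) S
  rw [K.hS] at e3
  have e3' : (EIn H S).card ≤ 6 := e3
  have e4 : (EIn H Sᶜ).card = 0 := by
    rw [card_eq_zero, eq_empty_iff_forall_notMem]
    intro e
    induction e with | _ u v
    rw [mk_mem_EIn, mem_compl, mem_compl]
    rintro ⟨h1, h2, h3⟩
    exact (K.cov u v h1).elim h2 h3
  have e5 : ∀ v ∈ Sᶜ, (NB H v ∩ S).card ≤ ∑ a ∈ T, (if H.Adj a v then 1 else 0) + 1 := by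
    intro v _
    rw [← card_filter]
    have hsub : NB H v ∩ S ⊆ T.filter (fun a => H.Adj a v) ∪ (S \ T) := by
      intro b hb
      rw [mem_inter, mem_NB] at hb
      rw [mem_union, mem_filter, mem_sdiff]
      by_cases hbT : b ∈ T
      · exact Or.inl ⟨hbT, hb.1.symm⟩
      · exact Or.inr ⟨hb.2, hbT⟩
    have h1 := card_le_card hsub
    have h2 := card_union_le (T.filter (fun a => H.Adj a v)) (S \ T)
    have h3 := card_sdiff_add_card_eq_card hT
    have h4 := K.hS
    omega
  have e6 := sum_le_sum e5
  rw [sum_add_distrib, sum_comm, sum_const, smul_eq_mul] at e6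
  have e7 : ∑ a ∈ T, ∑ v ∈ Sᶜ, (if H.Adj a v then 1 else 0) ≤ ∑ a ∈ T, 2 := by
    apply sum_le_sum
    intro a ha
    obtain ⟨x, w, W⟩ := hW a ha
    rw [← card_filter]
    refine (card_le_card (t := {x, w}) ?_).trans card_le_two
    intro v hv
    rw [mem_filter, mem_compl] at hv
    rw [mem_insert, mem_singleton]
    exact W.nb v hv.1 hv.2
  rw [sum_const, smul_eq_mul, hT3] at e7
  have e8 := card_compl_add_card S
  have := K.hS
  omega

lemma Wk.of_adj {S : Finset V} {a x w v : V} (W : Wk H S a x w) (hv : v ∉ S) (h : H.Adj a v) :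
    ∃ y, Wk H S a v y := by
  rcases W.nb v hv h with rfl | rfl
  · exact ⟨w, W⟩
  · exact ⟨x, W.symm⟩

lemma Wk.disj (hC : Ctx G c) (hH : Hyp G c H) {S : Finset V} (K : C4 H S) {a x w a' x' w' v : V}
    (W : Wk H S a x w) (W' : Wk H S a' x' w') (haa : a ≠ a') (hv : v ∉ S) (h : H.Adj a v) (h' : H.Adj a' v) : False := by
  obtain ⟨y, W⟩ := W.of_adj hv h
  obtain ⟨y', W'⟩ := W'.of_adj hv h'
  have c0 : ((S.erase a).erase a').card = 2 := by
    rw [card_erase_of_mem (mem_erase.2 ⟨haa.symm, W'.aS⟩), card_erase_of_mem W.aS, K.hS]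
  have c1 : ({a, a', v, y, y'} : Finset V).card ≤ 5 := card_le_five
  refine Ex hC hH (S := (S.erase a).erase a') (X := {a, a', v, y, y'}) (Y := ∅) ?_ ?_ (by simp) (by simp) (by omega)
    (Or.inl ⟨rfl, by omega⟩)
  · intro p q hpq
    have h1 := K.cov p q hpq
    have h2 := W.nb p
    have h3 := W.nb q
    have h2' := W'.nb p
    have h3' := W'.nb q
    have h4 := hpq.symm
    simp only [mem_erase, mem_insert, mem_singleton]
    clear * - hpq h1 h2 h3 h2' h3' h4
    grind
  · have := W.wS
    have := W'.wS
    simp only [disjoint_insert_right, disjoint_singleton_right, mem_erase]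
    tauto

lemma adjAll (hC : Ctx G c) (hH : Hyp G c H) {S : Finset V} (K : C4 H S) {a x w a' x' w' v b : V}
    (W : Wk H S a x w) (W' : Wk H S a' x' w') (haa : a ≠ a') (hv : v ∉ S) (hb : b ∈ S) (ba : b ≠ a) (ba' : b ≠ a') : 
    H.Adj v b := by
  have key : ∀ {a x w a'}, Wk H S a x w → a' ∈ S → a ≠ a' → b ≠ a → b ≠ a' → ¬ H.Adj a' v → H.Adj v b := by
    intro a x w a' W ha' haa ba ba' hn
    have hg := (W.facts hC hH K).good v (by simp [hv])
    by_contra hcon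
    apply hg
    have c0 : (((S.erase a).erase a').erase b).card = 1 := by
      rw [card_erase_of_mem, card_erase_of_mem (mem_erase.2 ⟨haa.symm, ha'⟩), card_erase_of_mem W.aS, K.hS]
      simp [ba, ba', hb]
    rw [← c0]
    apply card_le_card
    intro z
    rw [mem_inter, mem_NB]
    rintro ⟨h1, h2⟩
    rw [mem_erase (s := (S.erase a).erase a'), mem_erase (s := S.erase a)]
    refine ⟨?_, ?_, h2⟩
    · rintro rfl; exact hcon h1
    · rintro rfl; exact hn h1.symm
  by_cases h : H.Adj a' v
  · refine key W' W.aS haa.symm ba' ba ?_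
    exact fun h2 => W.disj hC hH K W' haa hv h2 h
  · exact key W W'.aS haa ba ba' h

/-- edges assigned to a weak vertex -/
noncomputable def WE (G : SimpleGraph V) (c : Sym2 V → ℕ) (S : Finset V) (a x w : V) : Finset (Sym2 V) := by
  classical
  exact (EIn G Sᶜ).filter (fun e => (x ∈ e ∧ c s(a, w) = c e) ∨ (w ∈ e ∧ c s(a, x) = c e))

lemma mem_WE {S : Finset V} {a x w : V} {e : Sym2 V} : e ∈ WE G c S a x w ↔
    e ∈ EIn G Sᶜ ∧ ((x ∈ e ∧ c s(a, w) = c e) ∨ (w ∈ e ∧ c s(a, x) = c e)) := by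
  simp [WE]

lemma WE_side (hC : Ctx G c) (hH : Hyp G c H) {S : Finset V} (K : C4 H S) {a x w : V} (W : Wk H S a x w) :
    ∃ z y, Wk H S a z y ∧ ∀ e ∈ WE G c S a x w, ∃ t, t ∉ S ∧ G.Adj z t ∧ e = s(z, t) := by
  have side : ∀ z e, e ∈ EIn G Sᶜ → z ∈ e → ∃ t, t ∉ S ∧ G.Adj z t ∧ e = s(z, t) := by
    intro z e
    induction e with | _ u v
    rw [mk_mem_EIn, Sym2.mem_iff, mem_compl, mem_compl]
    rintro ⟨h1, h2, h3⟩ (rfl | rfl)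
    · exact ⟨v, h3, h1, rfl⟩
    · exact ⟨u, h2, h1.symm, Sym2.eq_swap⟩
  by_cases h : ∃ e ∈ EIn G Sᶜ, x ∈ e ∧ c s(a, w) = c e
  · obtain ⟨e0, h0, hx, hc⟩ := h
    obtain ⟨t0, t0S, ht0, rfl⟩ := side x e0 h0 hx
    refine ⟨x, w, W, ?_⟩
    intro e he
    rw [mem_WE] at he
    rcases he with ⟨h1, h2 | h2⟩
    · exact side x e h1 h2.1
    · obtain ⟨t1, t1S, ht1, rfl⟩ := side w e h1 h2.1
      exact ((W.facts hC hH K).dsw t0 t1 t0S t1S ht0 ht1 hc h2.2).elim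
  · refine ⟨w, x, W.symm, ?_⟩
    intro e he
    rw [mem_WE] at he
    rcases he with ⟨h1, h2 | h2⟩
    · exact (h ⟨e, h1, h2⟩).elim
    · exact side w e h1 h2.1

lemma WE_two (hC : Ctx G c) (hH : Hyp G c H) {S : Finset V} (K : C4 H S) {a x w : V} (W : Wk H S a x w) :
    (WE G c S a x w).card ≤ 2 := by
  by_contra hcon
  push Not at hcon
  obtain ⟨z, y, W', hs⟩ := WE_side hC hH K W
  obtain ⟨e1, h1, e2, h2, e3, h3, n12, n13, n23⟩ := two_lt_card.1 hcon
  obtain ⟨t1, t1S, a1, rfl⟩ := hs e1 h1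
  obtain ⟨t2, t2S, a2, rfl⟩ := hs e2 h2
  obtain ⟨t3, t3S, a3, rfl⟩ := hs e3 h3
  have ne : ∀ t, t ∉ S → a ≠ t := by rintro t ht rfl; exact ht W.aS
  have nS : ∀ t, t ∉ S → t ∉ S.erase a := by intro t ht; simp [ht]
  refine (W'.facts hC hH K).deg z a t1 t2 t3 (nS z W'.xS) (by simp) (nS _ t1S) (nS _ t2S) (nS _ t3S) (hH.le W'.ax.symm) a1 a2 a3
    (ne _ t1S) (ne _ t2S) (ne _ t3S) ?_ ?_ ?_
  · rintro rfl; exact n12 rfl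
  · rintro rfl; exact n13 rfl
  · rintro rfl; exact n23 rfl

lemma WE_one (hC : Ctx G c) (hH : Hyp G c H) {S : Finset V} (K : C4 H S) {a x w a' x' w' : V} (W : Wk H S a x w)
    (W' : Wk H S a' x' w') (haa : a ≠ a') : (WE G c S a x w).card ≤ 1 := by
  by_contra hcon
  push Not at hcon
  obtain ⟨z, y, Wz, hs⟩ := WE_side hC hH K W
  obtain ⟨e1, h1, e2, h2, n12⟩ := one_lt_card.1 hcon
  obtain ⟨t1, t1S, a1, rfl⟩ := hs e1 h1
  obtain ⟨t2, t2S, a2, rfl⟩ := hs e2 h2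
  have t12 : t1 ≠ t2 := by rintro rfl; exact n12 rfl
  have c0 : ((S.erase a).erase a').card = 2 := by
    rw [card_erase_of_mem (mem_erase.2 ⟨haa.symm, W'.aS⟩), card_erase_of_mem W.aS, K.hS]
  obtain ⟨b, d, bd, hbd⟩ := card_eq_two.1 c0
  have hb : b ∈ (S.erase a).erase a' := by simp [hbd]
  have hd : d ∈ (S.erase a).erase a' := by simp [hbd]
  rw [mem_erase, mem_erase] at hb hd
  have all : ∀ v, v ∉ S → G.Adj b v ∧ G.Adj d v := fun v hv =>
    ⟨hH.le (adjAll hC hH K W W' haa hv hb.2.2 hb.2.1 hb.1).symm, hH.le (adjAll hC hH K W W' haa hv hd.2.2 hd.2.1 hd.1).symm⟩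
  have F := W'.facts hC hH K
  have ab : G.Adj b a := hH.le (F.tri b (by simp [hb]) a (by simp [haa, W.aS]) hb.2.1)
  have ad : G.Adj d a := hH.le (F.tri d (by simp [hd]) a (by simp [haa, W.aS]) hd.2.1)
  have ne : ∀ {s t}, s ∈ S → t ∉ S → s ≠ t := by rintro s t h1 h2 rfl; exact h2 h1
  exact hC.vk.noK33_vert (x := b) (y := d) (z := z) (p := a) (q := t1) (r := t2) bd (ne hb.2.2 Wz.xS) (ne hd.2.2 Wz.xS)
    (ne W.aS t1S) (ne W.aS t2S) t12 ab (all t1 t1S).1 (all t2 t2S).1 ad (all t1 t1S).2 (all t2 t2S).2 (hH.le Wz.ax.symm) a1 a2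

lemma stepD (hC : Ctx G c) (hH : Hyp G c H) {S : Finset V} (K : C4 H S) : False := by
  classical
  have cls : ∀ e ∈ EIn G Sᶜ, ∃ a x w, Wk H S a x w ∧ e ∈ WE G c S a x w := by
    intro e
    induction e with | _ u v
    intro he
    have he' := he
    rw [mk_mem_EIn, mem_compl, mem_compl] at he
    obtain ⟨h, hh, hcol⟩ := hH.all s(u, v) (by simpa using he.1)
    obtain ⟨a, x, y, w, hxy, W, rfl⟩ := K.edge hC hH he.1 he.2.1 he.2.2 hh hcol
    refine ⟨a, x, w, W, mem_WE.2 ⟨he', Or.inl ⟨?_, hcol⟩⟩⟩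
    rw [Sym2.mem_iff]
    tauto
  have inv : ∀ {a x w x' w' e}, Wk H S a x w → Wk H S a x' w' → e ∈ WE G c S a x' w' → e ∈ WE G c S a x w := by
    intro a x w x' w' e W W' he
    rw [mem_WE] at he ⊢
    have h1 := W.nb x' W'.xS W'.ax
    have h2 := W.nb w' W'.wS W'.aw
    have h3 := W'.xw
    rcases h1 with rfl | rfl <;> rcases h2 with rfl | rfl
    · exact absurd rfl h3
    · exact he
    · exact ⟨he.1, he.2.symm⟩
    · exact absurd rfl h3
  obtain ⟨a, x, w, W⟩ : ∃ a x w, Wk H S a x w := by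
    by_contra hcon
    refine noWeak hC (S := S) ⟨K.hS, ?_⟩
    intro u v huv
    by_contra h
    push Not at h
    obtain ⟨a, x, w, W, -⟩ := cls s(u, v) (by rw [mk_mem_EIn, mem_compl, mem_compl]; exact ⟨huv, h⟩)
    exact hcon ⟨a, x, w, W⟩
  have cnt := (W.facts hC hH K).cnt
  by_cases h2 : ∃ a' x' w', a' ≠ a ∧ Wk H S a' x' w'
  · obtain ⟨a', x', w', haa, W'⟩ := h2
    have hsub : EIn G Sᶜ ⊆ WE G c S a x w ∪ WE G c S a' x' w' := by
      intro e he
      obtain ⟨a2, x2, w2, W2, h2⟩ := cls e he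
      rw [mem_union]
      by_cases h3 : a2 = a
      · subst h3; exact Or.inl (inv W W2 h2)
      · by_cases h4 : a2 = a'
        · subst h4; exact Or.inr (inv W' W2 h2)
        · exfalso
          refine threeWeak hC hH K (T := {a, a', a2}) ?_ (card_eq_three.2 ⟨a, a', a2, haa.symm, Ne.symm h3, Ne.symm h4, rfl⟩) ?_
          · intro z
            simp only [mem_insert, mem_singleton]
            rintro (rfl | rfl | rfl)
            · exact W.aS
            · exact W'.aS
            · exact W2.aS
          · intro z
            simp only [mem_insert, mem_singleton]
            rintro (rfl | rfl | rfl)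
            · exact ⟨_, _, W⟩
            · exact ⟨_, _, W'⟩
            · exact ⟨_, _, W2⟩
    have b1 := card_le_card hsub
    have b2 := card_union_le (WE G c S a x w) (WE G c S a' x' w')
    have b3 := WE_one hC hH K W W' haa.symm
    have b4 := WE_one hC hH K W' W haa
    omega
  · have hsub : EIn G Sᶜ ⊆ WE G c S a x w := by
      intro e he
      obtain ⟨a2, x2, w2, W2, h3⟩ := cls e he
      by_cases h4 : a2 = a
      · subst h4; exact inv W W2 h3
      · exact (h2 ⟨a2, x2, w2, h4, W2⟩).elim
    have b1 := card_le_card hsub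
    have b2 := WE_two hC hH K W
    omega

lemma stepCD (hC : Ctx G c) (hH : Hyp G c H) {S C : Finset V} (hS : S.card = 3) (hX : C.card = 3) (hd : Disjoint S C)
    (hcov : Cov H S C ∅) : False := by
  by_cases htri : ∀ u ∈ C, ∀ v ∈ C, u ≠ v → H.Adj u v
  · exact stepC hC hH ⟨hS, hX, hd, hcov, htri⟩
  · push Not at htri
    obtain ⟨u, hu, v, hv, huv, hn⟩ := htri
    obtain ⟨m, hm, mu, mv⟩ : ∃ m ∈ C, m ≠ u ∧ m ≠ v := by
      have h1 : ((C.erase u).erase v).card = 1 := by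
        rw [card_erase_of_mem (mem_erase.2 ⟨huv.symm, hv⟩), card_erase_of_mem hu, hX]
      obtain ⟨m, hm⟩ := card_pos.1 (show 0 < ((C.erase u).erase v).card by omega)
      rw [mem_erase, mem_erase] at hm
      exact ⟨m, hm.2.2, hm.2.1, hm.1⟩
    have hCe : C = {u, v, m} := by
      symm
      apply eq_of_subset_of_card_le
      · intro z hz; simp only [mem_insert, mem_singleton] at hz; rcases hz with rfl | rfl | rfl <;> assumption
      · rw [hX, card_eq_three.2 ⟨u, v, m, huv, mu.symm, mv.symm, rfl⟩]
    refine stepD hC hH (S := insert m S) ⟨?_, ?_⟩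
    · rw [card_insert_of_notMem (disjoint_right.1 hd hm), hS]
    · intro p q hpq
      have h1 := hcov p q hpq
      have hne := hpq.ne
      have n1 : ¬ (p = u ∧ q = v) := by rintro ⟨rfl, rfl⟩; exact hn hpq
      have n2 : ¬ (p = v ∧ q = u) := by rintro ⟨rfl, rfl⟩; exact hn hpq.symm
      rw [hCe] at h1
      simp only [mem_insert, mem_singleton, notMem_empty, false_and, or_false] at h1 ⊢
      clear * - h1 hne n1 n2
      grind

lemma final (hC : Ctx G c) (hH : Hyp G c H) : False := by
  rcases tb_cases hC.n11 (hH.noM5 hC) with ⟨S, hS, h⟩ | ⟨S, X, hS, hX, hd, h⟩ | ⟨S, X, Y, hS, hX, hY, h1, h2, h3, h⟩ |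
    ⟨S, X, hS, hX, hd, h⟩ | ⟨S, hS, h⟩
  · exact stepA hC hH hS h
  · exact stepBa hC hH hS hX hd h
  · exact stepBb hC hH hS hX hY h1 h2 h3 h
  · exact stepCD hC hH hS hX hd h
  · refine stepD hC hH (S := S) ⟨hS, ?_⟩
    intro u v huv
    have := h u v huv
    simpa using this

end StepD3

set_option linter.unusedSectionVars false
set_option linter.unusedVariables false

section Finish
open Finset

lemma exists_hyp {V : Type} [Fintype V] [DecidableEq V] (G : SimpleGraph V) (c : Sym2 V → ℕ) : ∃ H, Hyp G c H := by
  obtain ⟨T, hT, hb⟩ := (Set.surjOn_image c G.edgeSet).exists_bijOn_subset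
  have hE : (SimpleGraph.fromEdgeSet T).edgeSet = T := by
    rw [SimpleGraph.edgeSet_fromEdgeSet]
    ext e
    rw [Set.mem_sdiff]
    exact ⟨fun h => h.1, fun h => ⟨h, fun hd => G.not_isDiag_of_mem_edgeSet (hT h) hd⟩⟩
  refine ⟨SimpleGraph.fromEdgeSet T, ?_, ?_, ?_⟩
  · rw [← SimpleGraph.edgeSet_subset_edgeSet, hE]; exact hT
  · rw [hE]; exact hb.injOn
  · intro e he
    rw [hE]
    obtain ⟨h, hh, heq⟩ := hb.surjOn (Set.mem_image_of_mem c he)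
    exact ⟨h, hh, heq⟩

lemma rainbow_of_M5 {V : Type} [Fintype V] [DecidableEq V] {G H : SimpleGraph V} {c : Sym2 V → ℕ} (hle : H ≤ G)
    (hinj : Set.InjOn c H.edgeSet) (h : M5 H) : HasRainbowMatching G c 5 := by
  obtain ⟨A, f, hA, h1, h2, h3⟩ := h
  have hsub : (↑(A.image (fun a => s(a, f a))) : Set (Sym2 V)) ⊆ H.edgeSet := by
    intro e he
    rw [mem_coe, mem_image] at he
    obtain ⟨a, ha, rfl⟩ := he
    exact h1 a ha
  refine ⟨A.image (fun a => s(a, f a)), ⟨?_, ?_, ?_⟩, hinj.mono hsub⟩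
  · rw [card_image_of_injOn, hA]
    intro a ha b hb hab
    simp only [Sym2.eq_iff] at hab
    rcases hab with ⟨h, -⟩ | ⟨h, -⟩
    · exact h
    · exact absurd (h ▸ ha) (h2 b hb)
  · exact hsub.trans (SimpleGraph.edgeSet_subset_edgeSet.2 hle)
  · intro e he e' he' hne v hv hv'
    rw [mem_image] at he he'
    obtain ⟨a, ha, rfl⟩ := he
    obtain ⟨b, hb, rfl⟩ := he'
    have hab : a ≠ b := by rintro rfl; exact hne rfl
    rw [Sym2.mem_iff] at hv hv'
    rcases hv with rfl | rfl <;> rcases hv' with h | h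
    · exact hab h
    · exact h2 b hb (h ▸ ha)
    · exact h2 a ha (h ▸ hb)
    · exact hab (h3 ha hb h)

end Finish

theorem rb_planeTriangulation_fiveMatching_upper (n : ℕ) (hn : 11 ≤ n)
    (G : SimpleGraph (Fin n)) (hG : IsPlaneTriangulation G)
    (c : Sym2 (Fin n) → ℕ) (hc : 2 * n + 1 ≤ (c '' G.edgeSet).ncard) :
    HasRainbowMatching G c 5 := by
  by_contra hno
  obtain ⟨-, hp, hE⟩ := hG
  have hES : (↑(ES G) : Set (Sym2 (Fin n))) = G.edgeSet := by
    ext e; simp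
  have hC : Ctx G c := by
    refine ⟨VK_of_planar G hp, by simpa using hn, ?_, ?_, ?_⟩
    · rw [← hES, Set.ncard_coe_finset] at hE
      simpa using hE
    · rw [← hES, ← Finset.coe_image, Set.ncard_coe_finset] at hc
      simpa using hc
    · intro H hle hinj h
      exact hno (rainbow_of_M5 hle hinj h)
  obtain ⟨H, hH⟩ := exists_hyp G c
  exact final hC hH
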